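/- For every integer g ≥ 2 and every natural number K ≥ 1, there are infinitely many natural numbers n such that s_g(p_n) = s_g(p_{n+1}) = ⋯ = s_g(p_{n+K−1}), i.e., the base-g digit sum is constant along some run of K consecutive primes, for infinitely many starting indices n. -/

import Mathlib

namespace DSR

open Finset

lemma abel_bound (c w : ℕ → ℂ) (B : ℝ) (hB : ∀ n, ‖∑ i ∈ range n, c i‖ ≤ B) (N : ℕ) :
    ‖∑ n ∈ range N, c n * w n‖ ≤ B * (‖w N‖ + ∑ n ∈ range N, ‖w (n+1) - w n‖) := by
  have key : ∑ n ∈ range N, c n * w n = (∑ i ∈ range N, c i) * w N -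
      ∑ n ∈ range N, (∑ i ∈ range (n+1), c i) * (w (n+1) - w n) := by
    induction N with
    | zero => simp
    | succ N ih => rw [sum_range_succ, ih, sum_range_succ _ N, sum_range_succ (fun n =>
        (∑ i ∈ range (n+1), c i) * (w (n+1) - w n)) N, sum_range_succ _ N]; ring
  rw [key, mul_add]
  refine (norm_sub_le _ _).trans (add_le_add ?_ ?_)
  · rw [norm_mul]; exact mul_le_mul_of_nonneg_right (hB N) (norm_nonneg _)
  · rw [mul_sum]
    refine (norm_sum_le _ _).trans (sum_le_sum fun n _ => ?_)
    rw [norm_mul]; exact mul_le_mul_of_nonneg_right (hB _) (norm_nonneg _)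

lemma periodic_partial (c : ℕ → ℂ) (q : ℕ) (hq : 0 < q) (hp : ∀ n, c (q + n) = c n)
    (h0 : ∑ i ∈ range q, c i = 0) (B : ℝ) (hB : ∀ n < q, ‖∑ i ∈ range n, c i‖ ≤ B) (n : ℕ) :
    ‖∑ i ∈ range n, c i‖ ≤ B := by
  induction n using Nat.strong_induction_on with
  | _ n ih =>
    by_cases h : n < q
    · exact hB n h
    · obtain ⟨m, rfl⟩ := Nat.exists_eq_add_of_le (not_lt.mp h)
      rw [sum_range_add, h0, zero_add, sum_congr rfl (fun i _ => hp i)]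
      exact ih m (by omega)

lemma sum_range_zmod {M : Type*} [AddCommMonoid M] (q : ℕ) [NeZero q] (f : ZMod q → M) :
    ∑ i ∈ range q, f (i : ZMod q) = ∑ a, f a := by
  refine Finset.sum_bij' (fun i _ => (i : ZMod q)) (fun a _ => a.val) ?_ ?_ ?_ ?_ ?_
  · simp
  · intro a _; simpa using ZMod.val_lt a
  · intro i hi; simpa using ZMod.val_cast_of_lt (mem_range.mp hi)
  · intro a _; simp
  · simp

lemma char_partial {q : ℕ} [NeZero q] (χ : DirichletCharacter ℂ q) (hχ : χ ≠ 1) (n : ℕ) :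
    ‖∑ i ∈ range n, χ (i : ZMod q)‖ ≤ q := by
  refine periodic_partial (fun i => χ (i : ZMod q)) q (NeZero.pos q) ?_ ?_ _ ?_ n
  · intro n; simp
  · exact (sum_range_zmod q (fun a => χ a)).trans (MulChar.sum_eq_zero_of_ne_one hχ)
  · intro n hn
    refine (norm_sum_le _ _).trans ((sum_le_sum fun (i:ℕ) _ => χ.norm_le_one (i : ZMod q)).trans ?_)
    simp; exact hn.le

lemma class_partial (q : ℕ) (hq : 0 < q) (a n : ℕ) :
    ‖∑ i ∈ range n, ((if i ≡ a [MOD q] then (1:ℂ) else 0) - 1 / q)‖ ≤ 1 := by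
  have key : ∀ n, ∑ i ∈ range n, ((if i ≡ a [MOD q] then (1:ℂ) else 0) - 1 / q) =
      ((Nat.count (fun x => x ≡ a [MOD q]) n : ℕ) : ℝ) - (n / q : ℝ) := by
    intro n
    rw [sum_sub_distrib, Nat.count_eq_card_filter_range]
    simp [div_eq_mul_inv]
  rw [key, Nat.count_modEq_card _ hq]
  rw [← Complex.ofReal_sub, Complex.norm_real, Real.norm_eq_abs, abs_le]
  have hq' : (0:ℝ) < q := by exact_mod_cast hq
  have hn : (n:ℝ) = q * (n / q : ℕ) + (n % q : ℕ) := by exact_mod_cast (Nat.div_add_mod n q).symm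
  have hm : ((n % q : ℕ):ℝ) < q := by exact_mod_cast Nat.mod_lt n hq
  have hm0 : (0:ℝ) ≤ ((n % q : ℕ):ℝ) := Nat.cast_nonneg _
  have e : (n:ℝ) / q = (n / q : ℕ) + (n % q : ℕ) / q := by
    rw [eq_comm, ← sub_eq_zero]; field_simp; linarith
  have e1 : ((n % q : ℕ):ℝ) / q ≤ 1 := by rw [div_le_one hq']; exact hm.le
  have e0 : (0:ℝ) ≤ ((n % q : ℕ):ℝ) / q := by positivity
  rw [e]; push_cast
  split_ifs <;> constructor <;> push_cast <;> linarith

/-- nonprincipal character sums against a weight of bounded variation -/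
lemma char_sum_bound {q : ℕ} [NeZero q] (χ : DirichletCharacter ℂ q) (hχ : χ ≠ 1) (w : ℕ → ℂ) (N : ℕ) :
    ‖∑ n ∈ range N, χ (n : ZMod q) * w n‖ ≤ q * (‖w N‖ + ∑ n ∈ range N, ‖w (n+1) - w n‖) :=
  abel_bound _ _ _ (char_partial χ hχ) N

lemma class_sum_bound {q : ℕ} (hq : 0 < q) (a : ℕ) (w : ℕ → ℂ) (N : ℕ) :
    ‖(∑ n ∈ range N with n ≡ a [MOD q], w n) - (1 / q) * ∑ n ∈ range N, w n‖ ≤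
      ‖w N‖ + ∑ n ∈ range N, ‖w (n+1) - w n‖ := by
  have := abel_bound (fun i => (if i ≡ a [MOD q] then (1:ℂ) else 0) - 1 / q) w 1 (class_partial q hq a) N
  rw [one_mul] at this
  convert this using 2
  rw [sum_filter, mul_sum, ← sum_sub_distrib]
  refine sum_congr rfl fun i _ => ?_
  split_ifs <;> ring

end DSR

namespace DSR

open Finset DirichletCharacter

/-- a Dirichlet character of some modulus -/
abbrev PChar := Σ q : ℕ, DirichletCharacter ℂ q

noncomputable def ev (t : PChar) (n : ℕ) : ℂ := t.2 (n : ZMod t.1)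

lemma ev_norm_le (t : PChar) (n : ℕ) : ‖ev t n‖ ≤ 1 := t.2.norm_le_one _

lemma ev_mul (t : PChar) (m n : ℕ) : ev t (m * n) = ev t m * ev t n := by simp [ev]

open Classical in
/-- all primitive characters of conductor `1 ≤ q ≤ Q` -/
noncomputable def primChars (Q : ℕ) : Finset PChar :=
  (Finset.Icc 1 Q).sigma fun q => (Set.toFinite {χ : DirichletCharacter ℂ q | χ.IsPrimitive}).toFinset

lemma mem_primChars {Q : ℕ} {t : PChar} :
    t ∈ primChars Q ↔ (1 ≤ t.1 ∧ t.1 ≤ Q) ∧ t.2.IsPrimitive := by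
  simp [primChars]

lemma card_primChars_le (Q : ℕ) : (primChars Q).card ≤ Q ^ 2 := by
  rw [primChars, card_sigma]
  have : ∀ q ∈ Finset.Icc 1 Q,
      ((Set.toFinite {χ : DirichletCharacter ℂ q | χ.IsPrimitive}).toFinset).card ≤ Q := by
    intro q hq
    rw [Finset.mem_Icc] at hq
    have : NeZero q := ⟨by omega⟩
    calc _ ≤ Nat.card (DirichletCharacter ℂ q) := by
            rw [Nat.card_eq_fintype_card]; exact card_le_univ _
      _ = q.totient := card_eq_totient_of_hasEnoughRootsOfUnity ℂ q
      _ ≤ Q := (Nat.totient_le q).trans hq.2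
  refine (sum_le_sum this).trans ?_
  simp [sq]

lemma changeLevel_natCast {q m : ℕ} (hm : q ∣ m) (χ : DirichletCharacter ℂ q) (n : ℕ) (hn : n.Coprime m) :
    changeLevel hm χ (n : ZMod m) = χ (n : ZMod q) := by
  have := changeLevel_eq_cast_of_dvd χ hm (ZMod.unitOfCoprime n hn)
  simpa [ZMod.cast_natCast hm] using this

lemma char_natCast_eq_zero {q : ℕ} (χ : DirichletCharacter ℂ q) (n : ℕ) (hn : ¬ n.Coprime q) :
    χ (n : ZMod q) = 0 := by
  apply χ.map_nonunit
  rwa [ZMod.isUnit_iff_coprime]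

/-- `χ₁ χ̄₂` at level `q₁ q₂` -/
noncomputable def pairChar (t t' : PChar) : DirichletCharacter ℂ (t.1 * t'.1) :=
  changeLevel (dvd_mul_right _ _) t.2 * (changeLevel (dvd_mul_left _ _) t'.2)⁻¹

lemma pairChar_apply (t t' : PChar) (n : ℕ) :
    pairChar t t' (n : ZMod (t.1 * t'.1)) = ev t n * (starRingEnd ℂ) (ev t' n) := by
  have hs : (starRingEnd ℂ) (ev t' n) = (ev t' n)⁻¹ := by
    have h1 := MulChar.star_apply' t'.2 (n : ZMod t'.1)
    rw [MulChar.inv_apply_eq_inv'] at h1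
    exact h1
  rw [hs]
  by_cases h : n.Coprime (t.1 * t'.1)
  · rw [pairChar, MulChar.mul_apply, MulChar.inv_apply_eq_inv', changeLevel_natCast _ _ _ h,
      changeLevel_natCast _ _ _ h]; rfl
  · rw [char_natCast_eq_zero _ _ h]
    rw [Nat.coprime_mul_iff_right, not_and_or] at h
    rcases h with h | h
    · simp [ev, char_natCast_eq_zero _ _ h]
    · simp [ev, char_natCast_eq_zero _ _ h]

lemma pairChar_ne_one {t t' : PChar} (h1 : 1 ≤ t.1) (h1' : 1 ≤ t'.1) (ht : t.2.IsPrimitive)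
    (ht' : t'.2.IsPrimitive) (h : t ≠ t') : pairChar t t' ≠ 1 := by
  obtain ⟨q, χ⟩ := t
  obtain ⟨q', χ'⟩ := t'
  intro he
  simp only at h1 h1' ht ht'
  have : NeZero (q * q') := ⟨by positivity⟩
  rw [pairChar, mul_inv_eq_one] at he
  simp only at he
  have hq : q = q' := by
    have e := congrArg conductor he
    rw [conductor_changeLevel, conductor_changeLevel] at e
    rw [isPrimitive_def] at ht ht'
    rw [← ht, ← ht', e]
  subst hq
  exact h (by rw [changeLevel_injective _ he])

lemma bombieri {T N : Type*} (s : Finset T) (I : Finset N) (v : T → N → ℂ) (a : N → ℂ) (B : ℝ)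
    (hB0 : 0 ≤ B)
    (hB : ∀ t ∈ s, ∑ t' ∈ s, ‖∑ n ∈ I, v t n * (starRingEnd ℂ) (v t' n)‖ ≤ B) :
    ∑ t ∈ s, ‖∑ n ∈ I, a n * v t n‖ ^ 2 ≤ B * ∑ n ∈ I, ‖a n‖ ^ 2 := by
  set c : T → ℂ := fun t => ∑ n ∈ I, a n * v t n with hc
  set S : ℝ := ∑ t ∈ s, ‖c t‖ ^ 2 with hS
  set A : ℝ := ∑ n ∈ I, ‖a n‖ ^ 2 with hA
  have hS0 : 0 ≤ S := sum_nonneg fun _ _ => by positivity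
  have hA0 : 0 ≤ A := sum_nonneg fun _ _ => by positivity
  set d : N → ℂ := fun n => ∑ t ∈ s, (starRingEnd ℂ) (c t) * v t n with hd
  have e1 : (S : ℂ) = ∑ n ∈ I, a n * d n := by
    simp only [hd, mul_sum]
    rw [sum_comm, hS]
    push_cast
    refine sum_congr rfl fun t _ => ?_
    rw [← Complex.conj_mul']
    conv_lhs => rw [hc]
    rw [mul_sum]
    exact sum_congr rfl fun n _ => by ring
  have e2 : S ≤ ∑ n ∈ I, ‖a n‖ * ‖d n‖ := by
    have : S = ‖(S : ℂ)‖ := by rw [Complex.norm_real, Real.norm_of_nonneg hS0]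
    rw [this, e1]
    exact (norm_sum_le _ _).trans (sum_le_sum fun n _ => (norm_mul _ _).le)
  have e3 : S ^ 2 ≤ A * ∑ n ∈ I, ‖d n‖ ^ 2 :=
    (pow_le_pow_left₀ hS0 e2 2).trans (sum_mul_sq_le_sq_mul_sq _ _ _)
  have e4 : ((∑ n ∈ I, ‖d n‖ ^ 2 : ℝ) : ℂ) = ∑ t ∈ s, ∑ t' ∈ s, (starRingEnd ℂ) (c t) * c t' *
      ∑ n ∈ I, v t n * (starRingEnd ℂ) (v t' n) := by
    push_cast
    simp only [mul_sum]
    simp_rw [sum_comm (s := s) (t := I)]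
    refine sum_congr rfl fun n _ => ?_
    rw [← Complex.mul_conj', hd]
    simp only [map_sum, sum_mul_sum, map_mul, Complex.conj_conj]
    exact sum_congr rfl fun t _ => sum_congr rfl fun t' _ => by ring
  have e5 : ∑ n ∈ I, ‖d n‖ ^ 2 ≤ B * S := by
    have h0 : 0 ≤ ∑ n ∈ I, ‖d n‖ ^ 2 := sum_nonneg fun _ _ => by positivity
    have : ∑ n ∈ I, ‖d n‖ ^ 2 = ‖((∑ n ∈ I, ‖d n‖ ^ 2 : ℝ) : ℂ)‖ := by
      rw [Complex.norm_real, Real.norm_of_nonneg h0]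
    rw [this, e4]
    set G : T → T → ℝ := fun t t' => ‖∑ n ∈ I, v t n * (starRingEnd ℂ) (v t' n)‖ with hG
    have hsym : ∀ t t', G t t' = G t' t := by
      intro t t'
      simp only [hG]
      rw [← Complex.norm_conj]
      congr 1
      simp only [map_sum, map_mul, Complex.conj_conj]
      exact sum_congr rfl fun n _ => by ring
    have hle : ‖∑ t ∈ s, ∑ t' ∈ s, (starRingEnd ℂ) (c t) * c t' *
      ∑ n ∈ I, v t n * (starRingEnd ℂ) (v t' n)‖ ≤
      ∑ t ∈ s, ∑ t' ∈ s, (‖c t‖ ^ 2 / 2 * G t t' + ‖c t'‖ ^ 2 / 2 * G t t') := by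
      refine (norm_sum_le _ _).trans (sum_le_sum fun t _ => (norm_sum_le _ _).trans (sum_le_sum fun t' _ => ?_))
      rw [norm_mul, norm_mul, Complex.norm_conj]
      have hg : 0 ≤ G t t' := norm_nonneg _
      have : ‖c t‖ * ‖c t'‖ ≤ ‖c t‖ ^ 2 / 2 + ‖c t'‖ ^ 2 / 2 := by nlinarith [sq_nonneg (‖c t‖ - ‖c t'‖)]
      calc _ = ‖c t‖ * ‖c t'‖ * G t t' := rfl
        _ ≤ (‖c t‖ ^ 2 / 2 + ‖c t'‖ ^ 2 / 2) * G t t' := mul_le_mul_of_nonneg_right this hg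
        _ = _ := by ring
    refine hle.trans ?_
    simp only [sum_add_distrib]
    have h1 : ∑ t ∈ s, ∑ t' ∈ s, ‖c t‖ ^ 2 / 2 * G t t' ≤ B * S / 2 := by
      simp only [← mul_sum]
      calc _ ≤ ∑ t ∈ s, ‖c t‖ ^ 2 / 2 * B :=
            sum_le_sum fun t ht => mul_le_mul_of_nonneg_left (hB t ht) (by positivity)
        _ = B * S / 2 := by rw [← sum_mul, ← sum_div]; ring
    have h2 : ∑ t ∈ s, ∑ t' ∈ s, ‖c t'‖ ^ 2 / 2 * G t t' = ∑ t ∈ s, ∑ t' ∈ s, ‖c t‖ ^ 2 / 2 * G t t' := by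
      rw [sum_comm]
      exact sum_congr rfl fun t _ => sum_congr rfl fun t' _ => by rw [hsym]
    rw [h2]; linarith
  by_cases hz : S = 0
  · rw [hz]; exact mul_nonneg hB0 hA0
  · have hSp : 0 < S := lt_of_le_of_ne hS0 (Ne.symm hz)
    have : S * S ≤ (B * A) * S := by nlinarith [mul_le_mul_of_nonneg_left e5 hA0]
    exact le_of_mul_le_mul_right this hSp

lemma char_interval {q : ℕ} [NeZero q] (χ : DirichletCharacter ℂ q) (hχ : χ ≠ 1) {A B : ℕ} (h : A ≤ B) :
    ‖∑ n ∈ Ico A B, χ (n : ZMod q)‖ ≤ 2 * q := by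
  rw [sum_Ico_eq_sub _ h]
  refine (norm_sub_le _ _).trans ?_
  linarith [char_partial χ hχ A, char_partial χ hχ B]

lemma large_sieve (Q : ℕ) {A B : ℕ} (h : A ≤ B) (a : ℕ → ℂ) :
    ∑ t ∈ primChars Q, ‖∑ n ∈ Ico A B, a n * ev t n‖ ^ 2 ≤
      (((B - A : ℕ) : ℝ) + 2 * (Q:ℝ) ^ 4) * ∑ n ∈ Ico A B, ‖a n‖ ^ 2 := by
  classical
  refine bombieri (primChars Q) (Ico A B) ev a _ (by positivity) fun t ht => ?_
  have hoff : ∀ t' ∈ (primChars Q).erase t,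
      ‖∑ n ∈ Ico A B, ev t n * (starRingEnd ℂ) (ev t' n)‖ ≤ 2 * (Q:ℝ) ^ 2 := by
    intro t' ht'
    obtain ⟨hne, ht'⟩ := mem_erase.mp ht'
    rw [mem_primChars] at ht ht'
    have : NeZero (t.1 * t'.1) := ⟨Nat.mul_ne_zero (by omega) (by omega)⟩
    have h1 := char_interval (pairChar t t')
      (pairChar_ne_one ht.1.1 ht'.1.1 ht.2 ht'.2 (Ne.symm hne)) h
    simp only [pairChar_apply] at h1
    refine h1.trans ?_
    have : ((t.1 * t'.1 : ℕ) : ℝ) ≤ (Q:ℝ) ^ 2 := by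
      exact_mod_cast (Nat.mul_le_mul ht.1.2 ht'.1.2).trans_eq (sq Q).symm
    linarith
  rw [← add_sum_erase _ _ ht]
  refine add_le_add ?_ ((sum_le_sum hoff).trans ?_)
  · refine (norm_sum_le _ _).trans ((sum_le_sum (g := fun _ => (1:ℝ)) fun n _ => ?_).trans ?_)
    · rw [norm_mul, Complex.norm_conj]
      exact mul_le_one₀ (ev_norm_le _ _) (norm_nonneg _) (ev_norm_le _ _)
    · simp
  · rw [sum_const, nsmul_eq_mul]
    have : (((primChars Q).erase t).card : ℝ) ≤ (Q:ℝ) ^ 2 := by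
      exact_mod_cast (card_le_card (erase_subset _ _)).trans (card_primChars_le Q)
    nlinarith [sq_nonneg (Q:ℝ)]

end DSR

namespace DSR

open Finset MeasureTheory

/-- Fourier representation of a smooth compactly supported function -/
lemma fourier_repr (f : ℝ → ℂ) (hc : HasCompactSupport f) (hs : ContDiff ℝ (⊤ : ℕ∞) f) :
    ∃ G : ℝ → ℂ, Continuous G ∧ Integrable G ∧ (∀ k : ℕ, Integrable (fun t => |t| ^ k * ‖G t‖)) ∧
      ∀ u, f u = ∫ t : ℝ, Complex.exp (2 * Real.pi * (t:ℂ) * (u:ℂ) * Complex.I) * G t := by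
  let φ : SchwartzMap ℝ ℂ := hc.toSchwartzMap hs
  let ψ : SchwartzMap ℝ ℂ := FourierTransform.fourier φ
  refine ⟨ψ, ψ.continuous, ψ.integrable, fun k => by simpa using ψ.integrable_pow_mul volume k, fun u => ?_⟩
  have h1 : FourierTransformInv.fourierInv ψ = φ := FourierPair.fourierInv_fourier_eq φ
  have h2 : f u = (FourierTransformInv.fourierInv ψ) u := by rw [h1]; rfl
  rw [h2, SchwartzMap.fourierInv_coe, Real.fourierInv_eq']
  refine integral_congr_ae (Filter.Eventually.of_forall fun t => ?_)
  simp only [smul_eq_mul]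
  congr 2
  simp
  ring

/-- The bump -/
noncomputable def bump : ContDiffBump (3/2 : ℝ) := ⟨1/4, 1/2, by norm_num, by norm_num⟩

noncomputable def F (u : ℝ) : ℝ := bump u

lemma F_nonneg (u : ℝ) : 0 ≤ F u := bump.nonneg
lemma F_le_one (u : ℝ) : F u ≤ 1 := bump.le_one
lemma F_one {u : ℝ} (h1 : 5/4 ≤ u) (h2 : u ≤ 7/4) : F u = 1 := by
  apply bump.one_of_mem_closedBall
  rw [Real.closedBall_eq_Icc]; constructor <;> simp only [bump] <;> linarith
lemma F_supp {u : ℝ} (h : F u ≠ 0) : 1 < u ∧ u < 2 := by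
  have : u ∈ Function.support bump := h
  rw [bump.support_eq, Real.ball_eq_Ioo] at this
  simp only [bump] at this
  constructor <;> linarith [this.1, this.2]
lemma F_contDiff : ContDiff ℝ (⊤ : ℕ∞) F := bump.contDiff
lemma F_compact : HasCompactSupport F := bump.hasCompactSupport

lemma F_lip : ∃ C : ℝ, 0 < C ∧ ∀ u v, |F u - F v| ≤ C * |u - v| := by
  obtain ⟨C, hC⟩ := (F_contDiff.of_le (m := 1) (by exact_mod_cast le_top)).lipschitzWith_of_hasCompactSupport F_compact one_ne_zero
  refine ⟨C + 1, by positivity, fun u v => ?_⟩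
  have := hC.dist_le_mul u v
  rw [Real.dist_eq, Real.dist_eq] at this
  nlinarith [abs_nonneg (u - v)]

/-- `L = log x`, `x = R^120` -/
noncomputable def LL (R : ℕ) : ℝ := 120 * Real.log R

noncomputable def nu (R n : ℕ) : ℝ := F (Real.log n / LL R) / n

lemma nu_nonneg (R n : ℕ) : 0 ≤ nu R n := div_nonneg (F_nonneg _) (Nat.cast_nonneg _)

lemma one_le_log {R : ℕ} (hR : 3 ≤ R) : 1 ≤ Real.log R := by
  rw [Real.le_log_iff_exp_le (by positivity)]
  have : (3:ℝ) ≤ R := by exact_mod_cast hR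
  linarith [Real.exp_one_lt_d9]

lemma LL_ge {R : ℕ} (hR : 3 ≤ R) : 120 ≤ LL R := by
  have := one_le_log hR
  unfold LL; linarith

lemma nu_supp {R n : ℕ} (hR : 3 ≤ R) (h : nu R n ≠ 0) : R ^ 120 < n ∧ n < R ^ 240 := by
  have hn : n ≠ 0 := by rintro rfl; simp [nu] at h
  have hF : F (Real.log n / LL R) ≠ 0 := by intro h0; simp [nu, h0] at h
  obtain ⟨h1, h2⟩ := F_supp hF
  have hL := LL_ge hR
  have hL0 : 0 < LL R := by linarith
  rw [lt_div_iff₀ hL0] at h1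
  rw [div_lt_iff₀ hL0] at h2
  have hn0 : (0:ℝ) < n := by positivity
  have hR0 : (0:ℝ) < R := by positivity
  unfold LL at h1 h2
  constructor
  · have : Real.log ((R:ℝ) ^ 120) < Real.log n := by rw [Real.log_pow]; push_cast; linarith
    have := (Real.log_lt_log_iff (by positivity) hn0).mp this
    exact_mod_cast this
  · have : Real.log n < Real.log ((R:ℝ) ^ 240) := by rw [Real.log_pow]; push_cast; linarith
    have := (Real.log_lt_log_iff hn0 (by positivity)).mp this
    exact_mod_cast this

lemma nu_eq_zero {R n : ℕ} (hR : 3 ≤ R) (h : n ≤ R ^ 120 ∨ R ^ 240 ≤ n) : nu R n = 0 := by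
  by_contra h0
  have := nu_supp hR h0
  omega

lemma nu_le (R n : ℕ) : nu R n ≤ 1 / n := by
  unfold nu
  exact div_le_div_of_nonneg_right (F_le_one _) (Nat.cast_nonneg _)

lemma nu_le' {R : ℕ} (hR : 3 ≤ R) (n : ℕ) : nu R n ≤ 1 / (R:ℝ) ^ 120 := by
  by_cases h : nu R n = 0
  · rw [h]; positivity
  · refine (nu_le R n).trans ?_
    have h1 := (nu_supp hR h).1
    have h2 : (R:ℝ) ^ 120 ≤ n := by exact_mod_cast h1.le
    exact one_div_le_one_div_of_le (by positivity) h2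

lemma log_succ_sub_le {n : ℕ} (hn : 0 < n) : |Real.log (n + 1 : ℕ) - Real.log n| ≤ 1 / n := by
  have hn' : (0:ℝ) < n := by exact_mod_cast hn
  rw [abs_of_nonneg]
  · rw [← Real.log_div (by positivity) (by positivity)]
    refine (Real.log_le_sub_one_of_pos (by positivity)).trans ?_
    push_cast; field_simp; simp
  · rw [sub_nonneg]; exact Real.log_le_log hn' (by push_cast; linarith)

lemma nu_diff : ∃ C : ℝ, 0 < C ∧ ∀ R n : ℕ, 3 ≤ R → 0 < n → |nu R (n+1) - nu R n| ≤ C / (n:ℝ) ^ 2 := by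
  obtain ⟨C, hC, hF⟩ := F_lip
  refine ⟨C + 1, by positivity, fun R n hR hn => ?_⟩
  have hn' : (0:ℝ) < n := by exact_mod_cast hn
  have hL := LL_ge hR
  have hL0 : 0 < LL R := by linarith
  set a := F (Real.log (n+1 : ℕ) / LL R)
  set b := F (Real.log n / LL R)
  have e : nu R (n+1) - nu R n = (a - b) / n - a * (1 / n - 1 / (n+1 : ℕ)) := by
    simp only [nu]; ring
  have h1 : |a - b| ≤ C / n := by
    refine (hF _ _).trans ?_
    rw [← sub_div, abs_div, abs_of_pos hL0, div_eq_mul_inv C]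
    refine mul_le_mul_of_nonneg_left ?_ hC.le
    refine (div_le_self (abs_nonneg _) (by linarith)).trans ?_
    simpa using log_succ_sub_le hn
  have h2 : |a * (1 / n - 1 / (n+1 : ℕ))| ≤ 1 / (n:ℝ)^2 := by
    have ha : |a| ≤ 1 := by rw [abs_of_nonneg (F_nonneg _)]; exact F_le_one _
    have hb : |(1 / n - 1 / (n+1 : ℕ) : ℝ)| ≤ 1 / (n:ℝ)^2 := by
      have : (1 / n - 1 / (n+1 : ℕ) : ℝ) = 1 / (n * (n+1)) := by push_cast; field_simp; simp
      rw [this, abs_of_pos (by positivity)]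
      exact one_div_le_one_div_of_le (by positivity) (by nlinarith)
    rw [abs_mul]
    calc _ ≤ 1 * (1 / (n:ℝ)^2) := mul_le_mul ha hb (abs_nonneg _) zero_le_one
      _ = _ := one_mul _
  rw [e]
  calc _ ≤ |(a - b) / n| + |a * (1 / n - 1 / (n+1 : ℕ))| := abs_sub _ _
    _ ≤ C / n / n + 1 / (n:ℝ)^2 := by
        refine add_le_add ?_ h2
        rw [abs_div, abs_of_pos hn']
        exact div_le_div_of_nonneg_right h1 hn'.le
    _ = _ := by field_simp

/-- total variation of `nu` -/
lemma nu_var : ∃ C : ℝ, 0 < C ∧ ∀ R N : ℕ, 3 ≤ R → ∑ n ∈ range N, |nu R (n+1) - nu R n| ≤ C / (R:ℝ) ^ 120 := by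
  obtain ⟨C, hC, h⟩ := nu_diff
  refine ⟨C * 3, by positivity, fun R N hR => ?_⟩
  have hR0 : (0:ℝ) < (R:ℝ)^120 := by positivity
  have hx1 : 1 ≤ R ^ 120 := Nat.one_le_pow _ _ (by omega)
  calc _ ≤ ∑ n ∈ range N, if n ∈ Ioo (R^120 - 1) N then C / (n:ℝ)^2 else 0 := by
        refine sum_le_sum fun n hn => ?_
        split_ifs with h0
        · rw [mem_Ioo] at h0
          exact h R n hR (by omega)
        · rw [mem_Ioo] at h0
          rw [mem_range] at hn
          rw [nu_eq_zero hR (Or.inl (by omega)), nu_eq_zero hR (Or.inl (by omega))]; simp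
    _ ≤ ∑ n ∈ Ioo (R^120 - 1) N, C / (n:ℝ)^2 := by
        rw [← sum_filter]
        refine sum_le_sum_of_subset_of_nonneg (fun n hn => (mem_filter.mp hn).2) fun _ _ _ => by positivity
    _ = C * ∑ n ∈ Ioo (R^120 - 1) N, ((n:ℝ)^2)⁻¹ := by rw [mul_sum]; rfl
    _ ≤ C * (2 / (((R^120 - 1 : ℕ):ℝ) + 1)) := mul_le_mul_of_nonneg_left (sum_Ioo_inv_sq_le _ _) hC.le
    _ = C * (2 / (R:ℝ)^120) := by rw [Nat.cast_sub hx1]; push_cast; ring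
    _ ≤ _ := by rw [mul_div_assoc' C]; exact div_le_div_of_nonneg_right (by linarith) hR0.le

end DSR

namespace DSR

open Finset MeasureTheory ArithmeticFunction

/-- truncation of an arithmetic function -/
noncomputable def lo (y : ℕ) (f : ArithmeticFunction ℝ) : ArithmeticFunction ℝ :=
  ⟨fun n => if n ≤ y then f n else 0, by simp⟩
noncomputable def hi (y : ℕ) (f : ArithmeticFunction ℝ) : ArithmeticFunction ℝ :=
  ⟨fun n => if n ≤ y then 0 else f n, by simp⟩

lemma lo_apply (y : ℕ) (f : ArithmeticFunction ℝ) (n : ℕ) : lo y f n = if n ≤ y then f n else 0 := rfl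
lemma hi_apply (y : ℕ) (f : ArithmeticFunction ℝ) (n : ℕ) : hi y f n = if n ≤ y then 0 else f n := rfl

lemma lo_add_hi (y : ℕ) (f : ArithmeticFunction ℝ) : lo y f + hi y f = f := by
  ext n; rw [ArithmeticFunction.add_apply, lo_apply, hi_apply]; split_ifs <;> simp

noncomputable abbrev muR : ArithmeticFunction ℝ := ((ArithmeticFunction.moebius : ArithmeticFunction ℤ) : ArithmeticFunction ℝ)
noncomputable abbrev zetaR : ArithmeticFunction ℝ := ((ArithmeticFunction.zeta : ArithmeticFunction ℕ) : ArithmeticFunction ℝ)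

lemma vaughan (y : ℕ) : vonMangoldt = lo y vonMangoldt + lo y muR * ArithmeticFunction.log
    - (lo y muR * lo y vonMangoldt) * zetaR + hi y muR * (hi y vonMangoldt * zetaR) := by
  have h1 : (vonMangoldt : ArithmeticFunction ℝ) = lo y vonMangoldt + hi y vonMangoldt := (lo_add_hi _ _).symm
  have h2 : muR * zetaR = 1 := coe_moebius_mul_coe_zeta
  have h3 : hi y vonMangoldt * zetaR = ArithmeticFunction.log - lo y vonMangoldt * zetaR := by
    rw [← vonMangoldt_mul_zeta]; nth_rewrite 2 [h1]; ring
  have h4 : hi y vonMangoldt = (lo y muR + hi y muR) * (hi y vonMangoldt * zetaR) := by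
    rw [lo_add_hi, mul_comm (hi y vonMangoldt), ← mul_assoc, h2, one_mul]
  conv_lhs => rw [h1, h4, add_mul]
  nth_rewrite 1 [h3]
  ring

lemma conv_sum (f g : ArithmeticFunction ℝ) (h : ℕ → ℂ) (N : ℕ) (hN : ∀ k, N ≤ k → h k = 0) :
    ∑ k ∈ range N, (((f * g) k : ℝ) : ℂ) * h k =
      ∑ a ∈ range N, ∑ b ∈ range N, ((f a : ℝ) : ℂ) * ((g b : ℝ) : ℂ) * h (a * b) := by
  have e1 : ∀ k, (((f * g) k : ℝ) : ℂ) * h k =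
      ∑ p ∈ k.divisorsAntidiagonal, ((f p.1 : ℝ) : ℂ) * ((g p.2 : ℝ) : ℂ) * h (p.1 * p.2) := by
    intro k
    rw [mul_apply, Complex.ofReal_sum, sum_mul]
    refine sum_congr rfl fun p hp => ?_
    rw [(Nat.mem_divisorsAntidiagonal.mp hp).1]; push_cast; ring
  simp_rw [e1]
  rw [← sum_product', sum_sigma']
  refine sum_bij_ne_zero (fun x _ _ => x.2) ?_ ?_ ?_ ?_
  · rintro ⟨k, a, b⟩ hx _
    simp only [mem_sigma, mem_range, Nat.mem_divisorsAntidiagonal] at hx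
    obtain ⟨hk, rfl, h0⟩ := hx
    simp only [mem_product, mem_range]
    have ha : a ≠ 0 := by rintro rfl; simp at h0
    have hb : b ≠ 0 := by rintro rfl; simp at h0
    exact ⟨(Nat.le_mul_of_pos_right a (by omega)).trans_lt hk, (Nat.le_mul_of_pos_left b (by omega)).trans_lt hk⟩
  · rintro ⟨k, a, b⟩ hx _ ⟨k', a', b'⟩ hx' _ he
    simp only [mem_sigma, mem_range, Nat.mem_divisorsAntidiagonal] at hx hx'
    obtain ⟨rfl, rfl⟩ := Prod.mk.inj he
    obtain rfl : k = k' := by rw [← hx.2.1, ← hx'.2.1]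
    rfl
  · rintro ⟨a, b⟩ hab hne
    have ha : a ≠ 0 := by rintro rfl; simp at hne
    have hb : b ≠ 0 := by rintro rfl; simp at hne
    refine ⟨⟨a * b, a, b⟩, ?_, hne, rfl⟩
    simp only [mem_sigma, mem_range, Nat.mem_divisorsAntidiagonal]
    refine ⟨?_, trivial, Nat.mul_ne_zero ha hb⟩
    by_contra hc
    exact hne (by simp [hN _ (not_lt.mp hc)])
  · rintro ⟨k, a, b⟩ hx _; rfl

lemma subsample (f : ℕ → ℝ) (d N : ℕ) :
    ∑ m ∈ range N, |f (d * (m+1)) - f (d * m)| ≤ ∑ n ∈ range (d * N), |f (n+1) - f n| := by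
  induction N with
  | zero => simp
  | succ N ih =>
    rw [sum_range_succ, Nat.mul_succ, sum_range_add]
    refine add_le_add ih ?_
    have := Finset.sum_range_sub (fun i => f (d * N + i)) d
    simp only [add_zero] at this
    rw [← this]
    exact abs_sum_le_sum_abs _ _

lemma log_le_R {R : ℕ} (hR : 3 ≤ R) : Real.log R ≤ R := (Real.log_le_sub_one_of_pos (by positivity)).trans (by linarith)

lemma inv_sum_le {R : ℕ} (hR : 3 ≤ R) : ∑ m ∈ range (R^240), 1 / (m:ℝ) ≤ 241 * R := by
  have h1 : ∑ m ∈ range (R^240), 1 / (m:ℝ) ≤ ∑ m ∈ range (R^240 + 1), 1 / (m:ℝ) :=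
    sum_le_sum_of_subset_of_nonneg (range_mono (by omega)) fun _ _ _ => by positivity
  have h2 := harmonic_le_one_add_log (R^240)
  rw [harmonic] at h2
  push_cast at h2
  rw [sum_range_succ'] at h1
  push_cast at h1
  simp only [one_div] at h1
  rw [Real.log_pow] at h2
  simp only [one_div]
  have := log_le_R hR
  have h3 : (3:ℝ) ≤ R := by exact_mod_cast hR
  simp only [inv_zero, add_zero] at h1
  push_cast at h2
  linarith

lemma typeI : ∃ C : ℝ, 0 < C ∧ ∀ R : ℕ, 3 ≤ R → ∀ t ∈ primChars (R^3), t.1 ≠ 1 → ∀ d : ℕ, 0 < d →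
    ‖∑ m ∈ range (R^240), ev t m * (nu R (d * m) : ℂ)‖ ≤ C * R ^ 4 / R ^ 120 ∧
    ‖∑ m ∈ range (R^240), ev t m * ((Real.log m * nu R (d * m) : ℝ) : ℂ)‖ ≤ C * R ^ 4 / R ^ 120 := by
  obtain ⟨C, hC, hV⟩ := nu_var
  refine ⟨240 * C + 241, by positivity, fun R hR t ht ht1 d hd => ?_⟩
  have hR3 : (3:ℝ) ≤ R := by exact_mod_cast hR
  have hR0 : (0:ℝ) < R := by linarith
  rw [mem_primChars] at ht
  have : NeZero t.1 := ⟨by omega⟩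
  have hχ : t.2 ≠ 1 := by
    intro h
    have := ht.2
    rw [DirichletCharacter.isPrimitive_def, h, DirichletCharacter.conductor_one] at this
    exact ht1 this.symm
  have hq : (t.1 : ℝ) ≤ (R:ℝ)^3 := by exact_mod_cast ht.1.2
  have hv : ∑ m ∈ range (R^240), |nu R (d * (m+1)) - nu R (d * m)| ≤ C / (R:ℝ)^120 :=
    (subsample _ _ _).trans (hV R _ hR)
  have hz : nu R (d * R^240) = 0 := nu_eq_zero hR (Or.inr (Nat.le_mul_of_pos_left _ hd))
  constructor
  · have := char_sum_bound t.2 hχ (fun m => (nu R (d * m) : ℂ)) (R^240)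
    refine this.trans ?_
    simp only [hz, ← Complex.ofReal_sub, Complex.norm_real, Real.norm_eq_abs]
    simp only [abs_zero, zero_add]
    calc _ ≤ (R:ℝ)^3 * (C / (R:ℝ)^120) := mul_le_mul hq hv (sum_nonneg fun _ _ => abs_nonneg _) (by positivity)
      _ = (C * (R:ℝ)^3) / R^120 := by ring
      _ ≤ _ := by
        apply div_le_div_of_nonneg_right _ (by positivity)
        have : (R:ℝ)^3 ≤ R^4 := pow_le_pow_right₀ (by linarith) (by norm_num)
        have h4 : 0 ≤ (R:ℝ)^4 := by positivity
        nlinarith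
  · have := char_sum_bound t.2 hχ (fun m => ((Real.log m * nu R (d * m) : ℝ) : ℂ)) (R^240)
    refine this.trans ?_
    simp only [hz, ← Complex.ofReal_sub, Complex.norm_real, Real.norm_eq_abs]
    simp only [mul_zero, abs_zero, zero_add]
    have hterm : ∀ m ∈ range (R^240), |Real.log ((m+1 : ℕ):ℝ) * nu R (d * (m+1)) - Real.log m * nu R (d * m)| ≤
        240 * R * |nu R (d * (m+1)) - nu R (d * m)| + 1 / (R:ℝ)^120 * (1 / m) := by
      intro m hm
      rw [mem_range] at hm
      have e : Real.log ((m+1 : ℕ):ℝ) * nu R (d * (m+1)) - Real.log m * nu R (d * m) =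
        Real.log ((m+1 : ℕ):ℝ) * (nu R (d * (m+1)) - nu R (d * m)) + nu R (d * m) * (Real.log ((m+1 : ℕ):ℝ) - Real.log m) := by ring
      rw [e]
      refine (abs_add_le _ _).trans (add_le_add ?_ ?_)
      · rw [abs_mul]
        refine mul_le_mul_of_nonneg_right ?_ (abs_nonneg _)
        rw [abs_of_nonneg (Real.log_natCast_nonneg _)]
        have : Real.log ((m+1 : ℕ):ℝ) ≤ Real.log ((R:ℝ)^240) :=
          Real.log_le_log (by positivity) (by exact_mod_cast hm)
        rw [Real.log_pow] at this
        push_cast at this ⊢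
        have h2 := log_le_R hR
        linarith
      · rw [abs_mul, abs_of_nonneg (nu_nonneg _ _)]
        rcases Nat.eq_zero_or_pos m with h0 | h0
        · subst h0; simp
        · exact mul_le_mul (nu_le' hR _) (log_succ_sub_le h0) (abs_nonneg _) (by positivity)
    calc _ ≤ (R:ℝ)^3 * (240 * R * (C / (R:ℝ)^120) + 1 / (R:ℝ)^120 * (241 * R)) := by
          refine mul_le_mul hq ?_ (sum_nonneg fun _ _ => abs_nonneg _) (by positivity)
          refine (sum_le_sum hterm).trans ?_
          rw [sum_add_distrib, ← mul_sum, ← mul_sum]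
          refine add_le_add (mul_le_mul_of_nonneg_left hv (by positivity)) (mul_le_mul_of_nonneg_left (inv_sum_le hR) (by positivity))
      _ = _ := by ring

end DSR

namespace DSR

open Finset MeasureTheory ArithmeticFunction

noncomputable def SS (R : ℕ) (t : PChar) : ℂ :=
  ∑ n ∈ range (R^240), ((vonMangoldt n : ℝ) : ℂ) * (ev t n * (nu R n : ℂ))

lemma sum_dyadic (f : ℕ → ℂ) (h0 : f 0 = 0) (J : ℕ) :
    ∑ n ∈ range (2^J), f n = ∑ j ∈ range J, ∑ n ∈ Ico (2^j) (2^(j+1)), f n := by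
  induction J with
  | zero => simp [h0]
  | succ J ih =>
    rw [sum_range_succ (fun j => ∑ n ∈ Ico (2^j) (2^(j+1)), f n), ← ih,
      sum_range_add_sum_Ico _ (Nat.pow_le_pow_right (by norm_num) (by omega))]

noncomputable def JJ (R : ℕ) : ℕ := Nat.log 2 (R^240) + 1

lemma JJ_le {R : ℕ} (hR : 3 ≤ R) : (JJ R : ℝ) ≤ 481 * Real.log R := by
  have h1 : 2 ^ Nat.log 2 (R^240) ≤ R ^ 240 := Nat.pow_log_le_self 2 (by positivity)
  have h2 : (2:ℝ) ^ Nat.log 2 (R^240) ≤ (R:ℝ) ^ 240 := by exact_mod_cast h1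
  have h3 := Real.log_le_log (by positivity) h2
  rw [Real.log_pow, Real.log_pow] at h3
  have := Real.log_two_gt_d9
  have hl := one_le_log hR
  unfold JJ
  push_cast at h3 ⊢
  have h4 : ((Nat.log 2 (R^240) : ℕ) : ℝ) * (1/2) ≤ (Nat.log 2 (R^240) : ℕ) * Real.log 2 :=
    mul_le_mul_of_nonneg_left (by linarith) (Nat.cast_nonneg _)
  linarith

lemma dyadic_sq {R : ℕ} (hR : 3 ≤ R) (a : ℕ → ℂ) (K : ℝ) (hK : 0 ≤ K)
    (ha : ∀ m < R^240, ‖a m‖ ≤ K) (ha0 : ∀ m ≤ R^12, a m = 0) :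
    ∑ t ∈ primChars (R^3), ‖∑ m ∈ range (R^240), a m / m * ev t m‖ ^ 2 ≤ 5 * (JJ R : ℝ) ^ 2 * K ^ 2 := by
  set b : ℕ → ℂ := fun m => if m < R^240 then a m / m else 0 with hb
  have e1 : ∀ t : PChar, ∑ m ∈ range (R^240), a m / m * ev t m =
      ∑ j ∈ range (JJ R), ∑ n ∈ Ico (2^j) (2^(j+1)), b n * ev t n := by
    intro t
    rw [← sum_dyadic (fun n => b n * ev t n) (by simp [hb])]
    have hsub : range (R^240) ⊆ range (2^(JJ R)) :=
      range_mono (Nat.lt_pow_succ_log_self (by norm_num) _).le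
    rw [← sum_subset hsub]
    · refine sum_congr rfl fun m hm => ?_
      simp [hb, mem_range.mp hm]
    · intro m _ hm
      rw [mem_range] at hm
      simp [hb, hm]
  have e2 : ∀ j ∈ range (JJ R), ∑ t ∈ primChars (R^3), ‖∑ n ∈ Ico (2^j) (2^(j+1)), b n * ev t n‖ ^ 2 ≤ 5 * K^2 := by
    intro j _
    by_cases hj : 2^(j+1) ≤ R^12
    · have : ∀ t, ∑ n ∈ Ico (2^j) (2^(j+1)), b n * ev t n = 0 := by
        intro t
        refine sum_eq_zero fun n hn => ?_
        rw [mem_Ico] at hn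
        simp [hb, ha0 n (by omega)]
      simp only [this]
      simp; positivity
    · push Not at hj
      have hle : 2^j ≤ 2^(j+1) := Nat.pow_le_pow_right (by norm_num) (by omega)
      refine (large_sieve (R^3) hle b).trans ?_
      have h1 : 2^(j+1) - 2^j = 2^j := by rw [pow_succ]; omega
      rw [h1]
      have h2 : ∑ n ∈ Ico (2^j) (2^(j+1)), ‖b n‖^2 ≤ ∑ n ∈ Ico (2^j) (2^(j+1)), K^2 / (2^j)^2 := by
        refine sum_le_sum fun n hn => ?_
        rw [mem_Ico] at hn
        simp only [hb]
        split_ifs with hlt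
        · rw [norm_div, div_pow, Complex.norm_natCast]
          have : ((2:ℝ)^j) ≤ n := by exact_mod_cast hn.1
          have h3 := ha n hlt
          gcongr
        · simp; positivity
      rw [sum_const, Nat.card_Ico, h1, nsmul_eq_mul] at h2
      have hj' : (R:ℝ)^12 < 2 * 2^j := by
        have : R^12 < 2 * 2^j := by rw [pow_succ 2 j] at hj; omega
        exact_mod_cast this
      have h2j : (0:ℝ) < 2^j := by positivity
      have h3 : (2^j : ℝ) * (K^2 / (2^j)^2) = K^2 / 2^j := by field_simp
      push_cast at h2 ⊢
      rw [h3] at h2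
      calc _ ≤ ((2:ℝ)^j + 2 * ((R:ℝ)^3)^4) * (K^2/2^j) := mul_le_mul_of_nonneg_left h2 (by positivity)
        _ ≤ (5 * 2^j) * (K^2/2^j) := by
          refine mul_le_mul_of_nonneg_right ?_ (by positivity)
          rw [← pow_mul]; norm_num; linarith
        _ = 5 * K^2 := by field_simp
  calc _ ≤ ∑ t ∈ primChars (R^3), (JJ R : ℝ) * ∑ j ∈ range (JJ R), ‖∑ n ∈ Ico (2^j) (2^(j+1)), b n * ev t n‖ ^ 2 := by
        refine sum_le_sum fun t _ => ?_
        rw [e1]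
        refine (pow_le_pow_left₀ (norm_nonneg _) (norm_sum_le _ _) 2).trans ?_
        simpa using sq_sum_le_card_mul_sum_sq (s := range (JJ R)) (f := fun j => ‖∑ n ∈ Ico (2^j) (2^(j+1)), b n * ev t n‖)
    _ = (JJ R : ℝ) * ∑ j ∈ range (JJ R), ∑ t ∈ primChars (R^3), ‖∑ n ∈ Ico (2^j) (2^(j+1)), b n * ev t n‖ ^ 2 := by
        rw [← mul_sum, sum_comm]
    _ ≤ (JJ R : ℝ) * ∑ j ∈ range (JJ R), 5 * K^2 := by
        exact mul_le_mul_of_nonneg_left (sum_le_sum e2) (Nat.cast_nonneg _)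
    _ = _ := by rw [sum_const, card_range, nsmul_eq_mul]; ring

lemma typeII : ∃ C : ℝ, 0 < C ∧ ∀ R : ℕ, 3 ≤ R → ∀ f g : ArithmeticFunction ℝ,
    (∀ m ≤ R^12, f m = 0) → (∀ m ≤ R^12, g m = 0) → (∀ m, |f m| ≤ 1) → (∀ m, |g m| ≤ Real.log m) →
    ∑ t ∈ primChars (R^3), ‖∑ m ∈ range (R^240), ∑ n ∈ range (R^240),
      ((f m : ℝ) : ℂ) * ((g n : ℝ) : ℂ) * (ev t (m * n) * (nu R (m * n) : ℂ))‖ ≤ C * Real.log R ^ 3 := by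
  obtain ⟨G, hGc, hGi, -, hG⟩ := fourier_repr (fun u => (F u : ℂ))
    (F_compact.comp_left (g := fun x : ℝ => (x : ℂ)) (by simp)) (Complex.ofRealCLM.contDiff.comp F_contDiff)
  set I : ℝ := ∫ t, ‖G t‖ with hI
  have hI0 : 0 ≤ I := integral_nonneg fun _ => norm_nonneg _
  refine ⟨5 * 481^2 * 240 * I + 1, by positivity, fun R hR f g hf0 hg0 hf hg => ?_⟩
  set c : ℝ → ℕ → ℂ := fun s m => Complex.exp (2 * Real.pi * s * ((Real.log m / LL R : ℝ) : ℂ) * Complex.I) with hc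
  have hcn : ∀ s m, ‖c s m‖ = 1 := by
    intro s m
    have : (2 * Real.pi * s * ((Real.log m / LL R : ℝ) : ℂ) * Complex.I) =
      ((2 * Real.pi * s * (Real.log m / LL R) : ℝ) : ℂ) * Complex.I := by push_cast; ring
    simp only [hc]
    rw [this, Complex.norm_exp_ofReal_mul_I]
  have hcc : ∀ m, Continuous fun s => c s m := by intro m; simp only [hc]; fun_prop
  set A : ℝ → PChar → ℂ := fun s t => ∑ m ∈ range (R^240), ((f m : ℝ) : ℂ) * c s m / m * ev t m with hA
  set B : ℝ → PChar → ℂ := fun s t => ∑ n ∈ range (R^240), ((g n : ℝ) : ℂ) * c s n / n * ev t n with hB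
  have hAc : ∀ t, Continuous fun s => A s t := by
    intro t; simp only [hA]
    refine continuous_finsetSum _ fun m _ => ?_
    have := hcc m
    fun_prop
  have hBc : ∀ t, Continuous fun s => B s t := by
    intro t; simp only [hB]
    refine continuous_finsetSum _ fun m _ => ?_
    have := hcc m
    fun_prop
  have hterm : ∀ t : PChar, ∀ m n : ℕ, ∀ s : ℝ, G s * (((f m : ℝ) : ℂ) * c s m / m * ev t m) * (((g n : ℝ) : ℂ) * c s n / n * ev t n)
      = (((f m : ℝ) : ℂ) * ((g n : ℝ) : ℂ) * (ev t m * ev t n) / (m * n)) * (c s m * c s n * G s) := by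
    intro t m n s
    ring
  have hint0 : ∀ m n, Integrable fun s => c s m * c s n * G s := by
    intro m n
    refine hGi.bdd_mul (c := 1) ((hcc m).mul (hcc n)).aestronglyMeasurable (Filter.Eventually.of_forall fun s => ?_)
    simp [hcn]
  have hrep : ∀ t, ∑ m ∈ range (R^240), ∑ n ∈ range (R^240),
      ((f m : ℝ) : ℂ) * ((g n : ℝ) : ℂ) * (ev t (m * n) * (nu R (m * n) : ℂ)) = ∫ s, G s * A s t * B s t := by
    intro t
    have : ∀ s, G s * A s t * B s t = ∑ m ∈ range (R^240), ∑ n ∈ range (R^240),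
        (((f m : ℝ) : ℂ) * ((g n : ℝ) : ℂ) * (ev t m * ev t n) / (m * n)) * (c s m * c s n * G s) := by
      intro s
      simp only [hA, hB, mul_assoc (G s), sum_mul_sum]
      rw [mul_sum]
      refine sum_congr rfl fun m _ => ?_
      rw [mul_sum]
      refine sum_congr rfl fun n _ => ?_
      rw [← mul_assoc, hterm]
    simp_rw [this]
    rw [integral_finsetSum _ fun m _ => integrable_finsetSum _ fun n _ => (hint0 m n).const_mul _]
    refine sum_congr rfl fun m _ => ?_
    rw [integral_finsetSum _ fun n _ => (hint0 m n).const_mul _]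
    refine sum_congr rfl fun n _ => ?_
    rw [integral_const_mul, ev_mul]
    by_cases hm : m = 0
    · subst hm; simp
    by_cases hn : n = 0
    · subst hn; simp
    have hl : Real.log ((m * n : ℕ) : ℝ) = Real.log m + Real.log n := by
      push_cast; exact Real.log_mul (by positivity) (by positivity)
    have h1 : ((F (Real.log ((m * n : ℕ) : ℝ) / LL R) : ℝ) : ℂ) = ∫ s, c s m * c s n * G s := by
      rw [hG]
      refine integral_congr_ae (Filter.Eventually.of_forall fun s => ?_)
      simp only [hc]
      rw [← Complex.exp_add, hl]
      congr 2
      push_cast; ring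
    rw [← h1]
    simp only [nu]
    push_cast
    ring
  have hAB : ∀ s, ∑ t ∈ primChars (R^3), ‖A s t‖ * ‖B s t‖ ≤ 5 * 481^2 * 240 * Real.log R ^ 3 := by
    intro s
    have hl := one_le_log hR
    have hJ := JJ_le hR
    have hA2 : ∑ t ∈ primChars (R^3), ‖A s t‖^2 ≤ 5 * (JJ R : ℝ)^2 * 1^2 := by
      refine dyadic_sq hR (fun m => ((f m : ℝ) : ℂ) * c s m) 1 zero_le_one (fun m _ => ?_) (fun m hm => ?_)
      · rw [norm_mul, hcn, mul_one, Complex.norm_real]; exact hf m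
      · simp [hf0 m hm]
    have hB2 : ∑ t ∈ primChars (R^3), ‖B s t‖^2 ≤ 5 * (JJ R : ℝ)^2 * (240 * Real.log R)^2 := by
      refine dyadic_sq hR (fun m => ((g m : ℝ) : ℂ) * c s m) _ (by positivity) (fun m hm => ?_) (fun m hm => ?_)
      · rw [norm_mul, hcn, mul_one, Complex.norm_real]
        refine (hg m).trans ?_
        rcases Nat.eq_zero_or_pos m with h0 | h0
        · subst h0; simp; linarith
        have : Real.log m ≤ Real.log ((R:ℝ)^240) := Real.log_le_log (by positivity) (by exact_mod_cast hm.le)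
        rwa [Real.log_pow] at this
      · simp [hg0 m hm]
    have h1 := sum_mul_sq_le_sq_mul_sq (primChars (R^3)) (fun t => ‖A s t‖) (fun t => ‖B s t‖)
    have h2 : (∑ t ∈ primChars (R^3), ‖A s t‖ * ‖B s t‖)^2 ≤ (5 * (JJ R : ℝ)^2 * (240 * Real.log R))^2 := by
      calc _ ≤ _ := h1
        _ ≤ (5 * (JJ R : ℝ)^2 * 1^2) * (5 * (JJ R : ℝ)^2 * (240 * Real.log R)^2) :=
          mul_le_mul hA2 hB2 (sum_nonneg fun _ _ => by positivity) (by positivity)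
        _ = _ := by ring
    have h3 := abs_le_of_sq_le_sq h2 (by positivity)
    refine (le_abs_self _).trans (h3.trans ?_)
    have : (JJ R : ℝ)^2 ≤ (481 * Real.log R)^2 := pow_le_pow_left₀ (Nat.cast_nonneg _) hJ 2
    calc _ ≤ 5 * (481 * Real.log R)^2 * (240 * Real.log R) := by gcongr
      _ = _ := by ring
  have hintg : ∀ t, Integrable fun s => ‖G s‖ * (‖A s t‖ * ‖B s t‖) := by
    intro t
    have h1 : Integrable fun s => G s * A s t * B s t := by
      have : ∀ s, G s * A s t * B s t = ∑ m ∈ range (R^240), ∑ n ∈ range (R^240),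
          (((f m : ℝ) : ℂ) * ((g n : ℝ) : ℂ) * (ev t m * ev t n) / (m * n)) * (c s m * c s n * G s) := by
        intro s
        simp only [hA, hB, mul_assoc (G s), sum_mul_sum]
        rw [mul_sum]
        refine sum_congr rfl fun m _ => ?_
        rw [mul_sum]
        refine sum_congr rfl fun n _ => ?_
        rw [← mul_assoc, hterm]
      simp_rw [this]
      exact integrable_finsetSum _ fun m _ => integrable_finsetSum _ fun n _ => (hint0 m n).const_mul _
    simpa [mul_assoc] using h1.norm
  simp_rw [hrep]
  calc _ ≤ ∑ t ∈ primChars (R^3), ∫ s, ‖G s‖ * (‖A s t‖ * ‖B s t‖) := by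
        refine sum_le_sum fun t _ => (norm_integral_le_integral_norm _).trans_eq ?_
        refine integral_congr_ae (Filter.Eventually.of_forall fun s => ?_)
        simp [mul_assoc]
    _ = ∫ s, ∑ t ∈ primChars (R^3), ‖G s‖ * (‖A s t‖ * ‖B s t‖) := (integral_finsetSum _ fun t _ => hintg t).symm
    _ ≤ ∫ s, ‖G s‖ * (5 * 481^2 * 240 * Real.log R ^ 3) := by
        refine integral_mono (integrable_finsetSum _ fun t _ => hintg t) (hGi.norm.mul_const _) fun s => ?_
        simp only [← mul_sum]
        exact mul_le_mul_of_nonneg_left (hAB s) (norm_nonneg _)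
    _ = I * (5 * 481^2 * 240 * Real.log R ^ 3) := integral_mul_const _ _
    _ ≤ _ := by
        have : 0 ≤ Real.log R ^ 3 := by have := one_le_log hR; positivity
        nlinarith

lemma hi_zeta_bounds (y m : ℕ) : |(hi y vonMangoldt * zetaR) m| ≤ Real.log m ∧
    (m ≤ y → (hi y vonMangoldt * zetaR) m = 0) := by
  constructor
  · have h1 : (vonMangoldt * zetaR) m = Real.log m := by rw [vonMangoldt_mul_zeta]; rfl
    rw [← h1, mul_apply, mul_apply]
    refine (abs_sum_le_sum_abs _ _).trans (sum_le_sum fun p _ => ?_)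
    rw [abs_mul, hi_apply]
    have hz : (0:ℝ) ≤ zetaR p.2 := by rw [natCoe_apply]; positivity
    rw [abs_of_nonneg hz]
    refine mul_le_mul_of_nonneg_right ?_ hz
    split_ifs
    · simp [vonMangoldt_nonneg]
    · rw [abs_of_nonneg vonMangoldt_nonneg]
  · intro hm
    rw [mul_apply]
    refine sum_eq_zero fun p hp => ?_
    have := Nat.divisor_le (Nat.fst_mem_divisors_of_mem_antidiagonal hp)
    rw [hi_apply, if_pos (by omega), zero_mul]

lemma muR_abs_le (n : ℕ) : |muR n| ≤ 1 := by
  rw [intCoe_apply]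
  exact_mod_cast abs_moebius_le_one

lemma lolo_bounds (y m : ℕ) : |(lo y muR * lo y vonMangoldt) m| ≤ Real.log m ∧
    (y * y < m → (lo y muR * lo y vonMangoldt) m = 0) := by
  constructor
  · have h1 : (zetaR * vonMangoldt) m = Real.log m := by rw [mul_comm, vonMangoldt_mul_zeta]; rfl
    rw [← h1, mul_apply, mul_apply]
    refine (abs_sum_le_sum_abs _ _).trans (sum_le_sum fun p hp => ?_)
    have hp0 := Nat.mem_divisorsAntidiagonal.mp hp
    have h0 : p.1 ≠ 0 := by intro h; rw [h] at hp0; simp at hp0; omega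
    rw [abs_mul, lo_apply, lo_apply, natCoe_apply, zeta_apply_ne h0, Nat.cast_one]
    refine mul_le_mul ?_ ?_ (abs_nonneg _) zero_le_one
    · split_ifs
      · exact muR_abs_le _
      · simp
    · split_ifs
      · rw [abs_of_nonneg vonMangoldt_nonneg]
      · simp [vonMangoldt_nonneg]
  · intro hm
    rw [mul_apply]
    refine sum_eq_zero fun p hp => ?_
    have hp0 := (Nat.mem_divisorsAntidiagonal.mp hp).1
    rw [lo_apply, lo_apply]
    split_ifs with h1 h2
    · have := Nat.mul_le_mul h1 h2
      omega
    all_goals simp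

lemma typeI_sum {R : ℕ} (hR : 3 ≤ R) (c : ℕ → ℝ) (X : ℕ → ℂ) (C : ℝ) (hC : 0 ≤ C)
    (hc : ∀ d, |c d| ≤ Real.log d + 1) (hc0 : ∀ d, R^24 < d → c d = 0) (hcz : c 0 = 0)
    (hX : ∀ d, 0 < d → ‖X d‖ ≤ C * R^4 / R^120) :
    ‖∑ d ∈ range (R^240), (c d : ℂ) * X d‖ ≤ 4 * C / R^6 := by
  have hR1 : (1:ℝ) ≤ R := by exact_mod_cast (by omega : 1 ≤ R)
  have hR0 : (0:ℝ) < R := by linarith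
  have hsub : range (R^24 + 1) ⊆ range (R^240) := by
    refine range_mono (Nat.succ_le_of_lt (Nat.pow_lt_pow_right (by omega) (by norm_num)))
  rw [← sum_subset hsub]
  · refine (norm_sum_le _ _).trans ?_
    have : ∀ d ∈ range (R^24 + 1), ‖(c d : ℂ) * X d‖ ≤ 2 * R^24 * (C * R^4 / R^120) := by
      intro d hd
      rw [mem_range] at hd
      rcases Nat.eq_zero_or_pos d with h0 | h0
      · subst h0; rw [hcz]; simp; positivity
      rw [norm_mul, Complex.norm_real, Real.norm_eq_abs]
      refine mul_le_mul ?_ (hX d h0) (norm_nonneg _) (by positivity)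
      refine (hc d).trans ?_
      have h1 := Real.log_le_sub_one_of_pos (x := d) (by positivity)
      have h2 : (d:ℝ) ≤ (R:ℝ)^24 := by exact_mod_cast (by omega : d ≤ R^24)
      have : (1:ℝ) ≤ (R:ℝ)^24 := one_le_pow₀ hR1
      linarith
    refine (sum_le_sum this).trans ?_
    rw [sum_const, card_range, nsmul_eq_mul]
    push_cast
    have h1 : (1:ℝ) ≤ (R:ℝ)^24 := one_le_pow₀ hR1
    calc _ ≤ ((R:ℝ)^24 + R^24) * (2 * R^24 * (C * R^4 / R^120)) := by gcongr
      _ = 4 * C * R^52 / R^120 := by ring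
      _ ≤ 4 * C * R^114 / R^120 := by
        refine div_le_div_of_nonneg_right ?_ (by positivity)
        exact mul_le_mul_of_nonneg_left (pow_le_pow_right₀ hR1 (by norm_num)) (by positivity)
      _ = _ := by field_simp
  · intro d _ hd
    rw [mem_range] at hd
    rw [hc0 d (by omega)]; simp

lemma large_cond : ∃ C : ℝ, 0 < C ∧ ∀ R : ℕ, 3 ≤ R →
    ∑ t ∈ primChars (R^3) with t.1 ≠ 1, ‖SS R t‖ ≤ C * Real.log R ^ 3 := by
  obtain ⟨C1, hC1, hI⟩ := typeI
  obtain ⟨C2, hC2, hII⟩ := typeII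
  refine ⟨8 * C1 + C2, by positivity, fun R hR => ?_⟩
  have hl := one_le_log hR
  have hR1 : (1:ℝ) ≤ R := by exact_mod_cast (by omega : 1 ≤ R)
  have hR0 : (0:ℝ) < R := by linarith
  set y := R^12 with hy
  set T3 : PChar → ℂ := fun t => ∑ m ∈ range (R^240), ∑ n ∈ range (R^240),
      ((hi y muR m : ℝ) : ℂ) * (((hi y vonMangoldt * zetaR) n : ℝ) : ℂ) * (ev t (m * n) * (nu R (m * n) : ℂ)) with hT3
  have h3 := hII R hR (hi y muR) (hi y vonMangoldt * zetaR)
    (fun m hm => by rw [hi_apply, if_pos hm]) (fun m hm => (hi_zeta_bounds y m).2 hm)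
    (fun m => by rw [hi_apply]; split_ifs; simp; exact muR_abs_le m) (fun m => (hi_zeta_bounds y m).1)
  have hpt : ∀ t ∈ (primChars (R^3)).filter (fun t => t.1 ≠ 1), ‖SS R t‖ ≤ 8 * C1 / R^6 + ‖T3 t‖ := by
    intro t ht
    obtain ⟨ht, ht1⟩ := mem_filter.mp ht
    set h : ℕ → ℂ := fun n => ev t n * (nu R n : ℂ) with hh
    have hz : ∀ k, R^240 ≤ k → h k = 0 := fun k hk => by simp [hh, nu_eq_zero hR (Or.inr hk)]
    have e : SS R t = ∑ n ∈ range (R^240), (((lo y muR * ArithmeticFunction.log) n : ℝ) : ℂ) * h n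
        - ∑ n ∈ range (R^240), ((((lo y muR * lo y vonMangoldt) * zetaR) n : ℝ) : ℂ) * h n
        + ∑ n ∈ range (R^240), (((hi y muR * (hi y vonMangoldt * zetaR)) n : ℝ) : ℂ) * h n := by
      rw [← sum_sub_distrib, ← sum_add_distrib, SS]
      refine sum_congr rfl fun n _ => ?_
      have hv0 : (vonMangoldt : ArithmeticFunction ℝ) + (lo y muR * lo y vonMangoldt) * zetaR = lo y vonMangoldt +
          lo y muR * ArithmeticFunction.log + hi y muR * (hi y vonMangoldt * zetaR) := by
        linear_combination vaughan y
      have hv := congrArg (fun f : ArithmeticFunction ℝ => f n) hv0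
      simp only [ArithmeticFunction.add_apply] at hv
      rw [eq_sub_of_add_eq hv, lo_apply]
      split_ifs with hn
      · have : h n = 0 := by
          have : n ≤ R^120 := hn.trans (Nat.pow_le_pow_right (by omega) (by norm_num))
          simp [hh, nu_eq_zero hR (Or.inl this)]
        simp only [hh] at this
        simp only [hh, this, mul_zero]; ring
      · push_cast; ring
    rw [conv_sum _ _ _ _ hz, conv_sum _ _ _ _ hz, conv_sum _ _ _ _ hz] at e
    have eq1 : ∑ a ∈ range (R^240), ∑ b ∈ range (R^240), ((lo y muR a : ℝ) : ℂ) * ((ArithmeticFunction.log b : ℝ) : ℂ) * h (a * b)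
        = ∑ a ∈ range (R^240), ((lo y muR a : ℝ) : ℂ) * (ev t a * ∑ m ∈ range (R^240), ev t m * ((Real.log m * nu R (a * m) : ℝ) : ℂ)) := by
      refine sum_congr rfl fun a _ => ?_
      rw [mul_sum, mul_sum]
      refine sum_congr rfl fun m _ => ?_
      simp only [hh, ev_mul, log_apply]; push_cast; ring
    have eq2 : ∑ a ∈ range (R^240), ∑ b ∈ range (R^240), (((lo y muR * lo y vonMangoldt) a : ℝ) : ℂ) * ((zetaR b : ℝ) : ℂ) * h (a * b)
        = ∑ a ∈ range (R^240), (((lo y muR * lo y vonMangoldt) a : ℝ) : ℂ) * (ev t a * ∑ m ∈ range (R^240), ev t m * (nu R (a * m) : ℂ)) := by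
      refine sum_congr rfl fun a _ => ?_
      rw [mul_sum, mul_sum]
      refine sum_congr rfl fun m _ => ?_
      by_cases hm : m = 0
      · subst hm; simp [hh, nu]
      · simp only [hh, ev_mul, natCoe_apply, zeta_apply_ne hm]; push_cast; ring
    have b1 : ‖∑ a ∈ range (R^240), ((lo y muR a : ℝ) : ℂ) * (ev t a * ∑ m ∈ range (R^240), ev t m * ((Real.log m * nu R (a * m) : ℝ) : ℂ))‖ ≤ 4 * C1 / R^6 := by
      refine typeI_sum hR _ _ C1 hC1.le ?_ ?_ (by simp) ?_
      · intro d
        have := Real.log_natCast_nonneg d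
        rw [lo_apply]; split_ifs
        · linarith [muR_abs_le d]
        · simp; linarith
      · intro d hd
        have : R^12 ≤ R^24 := Nat.pow_le_pow_right (by omega) (by norm_num)
        rw [lo_apply, if_neg (by omega)]
      · intro d hd
        rw [norm_mul]
        exact (mul_le_of_le_one_left (norm_nonneg _) (ev_norm_le _ _)).trans (hI R hR t ht ht1 d hd).2
    have b2 : ‖∑ a ∈ range (R^240), (((lo y muR * lo y vonMangoldt) a : ℝ) : ℂ) * (ev t a * ∑ m ∈ range (R^240), ev t m * (nu R (a * m) : ℂ))‖ ≤ 4 * C1 / R^6 := by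
      refine typeI_sum hR _ _ C1 hC1.le ?_ ?_ (by simp) ?_
      · intro d
        linarith [(lolo_bounds y d).1]
      · intro d hd
        refine (lolo_bounds y d).2 ?_
        rw [hy, ← pow_add]; exact hd
      · intro d hd
        rw [norm_mul]
        exact (mul_le_of_le_one_left (norm_nonneg _) (ev_norm_le _ _)).trans (hI R hR t ht ht1 d hd).1
    rw [eq1, eq2] at e
    rw [e]
    calc _ ≤ 4 * C1 / R^6 + 4 * C1 / R^6 + ‖T3 t‖ :=
          (norm_add_le _ _).trans (add_le_add ((norm_sub_le _ _).trans (add_le_add b1 b2)) le_rfl)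
      _ = _ := by ring
  have hl3 : 1 ≤ Real.log R ^ 3 := one_le_pow₀ hl
  calc _ ≤ ∑ t ∈ (primChars (R^3)).filter (fun t => t.1 ≠ 1), (8 * C1 / R^6 + ‖T3 t‖) := sum_le_sum hpt
    _ ≤ ∑ t ∈ primChars (R^3), (8 * C1 / R^6 + ‖T3 t‖) :=
        sum_le_sum_of_subset_of_nonneg (filter_subset _ _) fun _ _ _ => by positivity
    _ = (primChars (R^3)).card * (8 * C1 / R^6) + ∑ t ∈ primChars (R^3), ‖T3 t‖ := by
        rw [sum_add_distrib, sum_const, nsmul_eq_mul]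
    _ ≤ (R:ℝ)^6 * (8 * C1 / R^6) + C2 * Real.log R ^ 3 := by
        refine add_le_add (mul_le_mul_of_nonneg_right ?_ (by positivity)) h3
        have := card_primChars_le (R^3)
        rw [← pow_mul] at this
        exact_mod_cast this
    _ = 8 * C1 + C2 * Real.log R ^ 3 := by field_simp
    _ ≤ _ := by nlinarith

end DSR
namespace DSR
open Finset MeasureTheory

lemma tele_sqrt (N : ℕ) (hN : 1 ≤ N) (K : ℕ) :
    ∑ i ∈ range K, 1 / (((N + i : ℕ) : ℝ) * √((N + i : ℕ) : ℝ)) ≤ 6 / √(N:ℝ) - 6 / √((N + K : ℕ) : ℝ) := by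
  induction K with
  | zero => simp
  | succ K ih =>
    rw [sum_range_succ]
    have h0 : (1:ℝ) ≤ ((N + K : ℕ) : ℝ) := by exact_mod_cast (by omega)
    have h1 : ((N + (K+1) : ℕ) : ℝ) = ((N + K : ℕ) : ℝ) + 1 := by push_cast; ring
    rw [h1]
    generalize ((N + K : ℕ) : ℝ) = x at *
    have hx : 0 < √x := by positivity
    have hx2 : √x ^ 2 = x := Real.sq_sqrt (by linarith)
    have hy : 0 < √(x+1) := by positivity
    have hy2 : √(x+1) ^ 2 = x + 1 := Real.sq_sqrt (by linarith)
    have hyx : √(x+1) ≤ 3/2 * √x := by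
      apply Real.sqrt_le_iff.2 ⟨by positivity, ?_⟩
      nlinarith
    have key : 1 / (x * √x) ≤ 6 / √x - 6 / √(x+1) := by
      rw [div_sub_div _ _ hx.ne' hy.ne', div_le_div_iff₀ (by positivity) (by positivity)]
      generalize √x = a at *
      generalize √(x+1) = b at *
      have hab : a ≤ b := by nlinarith
      have : (b - a) * (b + a) = 1 := by nlinarith
      subst hx2
      have h5 : b * (b + a) ≤ 15/4 * a^2 := by nlinarith
      have h6 : 1 * (a * b) * (b+a) ≤ (6 * b - a * 6) * (a^2 * a) * (b+a) := by
        have : (6 * b - a * 6) * (a^2 * a) * (b+a) = 6 * a^3 := by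
          linear_combination 6 * a^3 * this
        rw [this]; nlinarith
      exact le_of_mul_le_mul_right h6 (by positivity)
    linarith

lemma tail_bound (c w : ℕ → ℂ) (B C : ℝ) (hC : 0 ≤ C) (hB : ∀ n, ‖∑ i ∈ range n, c i‖ ≤ B)
    (hw : ∀ n : ℕ, 1 ≤ n → ‖w n‖ ≤ C / √(n:ℝ))
    (hd : ∀ n : ℕ, 1 ≤ n → ‖w (n+1) - w n‖ ≤ C * (1 / ((n:ℝ) * √(n:ℝ)))) (N : ℕ) (hN : 1 ≤ N) (K : ℕ) :
    ‖∑ i ∈ range K, c (N + i) * w (N + i)‖ ≤ 2 * B * (6 * C / √(N:ℝ)) := by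
  have h0 : 0 ≤ B := (norm_nonneg _).trans (hB 0)
  have h1 : ∀ n, ‖∑ i ∈ range n, c (N + i)‖ ≤ 2 * B := by
    intro n
    have := sum_range_add_sub_sum_range c N n
    rw [← this]
    exact (norm_sub_le _ _).trans (by linarith [hB (N+n), hB N])
  refine (abel_bound (fun i => c (N + i)) (fun i => w (N+i)) (2*B) h1 K).trans ?_
  apply mul_le_mul_of_nonneg_left _ (by linarith)
  have h2 := hw (N+K) (by omega)
  have h3 : ∑ i ∈ range K, ‖w (N + (i+1)) - w (N+i)‖ ≤
      C * (6 / √(N:ℝ) - 6 / √((N + K : ℕ) : ℝ)) := by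
    refine le_trans (sum_le_sum fun i _ => hd (N+i) (by omega)) ?_
    rw [← mul_sum]
    exact mul_le_mul_of_nonneg_left (tele_sqrt N hN K) hC
  have h4 : 0 ≤ C / √((N + K : ℕ) : ℝ) := by positivity
  have h5 : C * (6 / √(N:ℝ) - 6 / √((N + K : ℕ) : ℝ)) = 6 * C / √(N:ℝ) - 6 * (C / √((N + K : ℕ) : ℝ)) := by ring
  linarith

lemma log_pow_le (j : ℕ) : ∃ C : ℝ, 0 < C ∧ ∀ x : ℝ, 1 ≤ x → (1 + Real.log (x + 1)) ^ j ≤ C * √x := by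
  refine ⟨(2 * (2 * (j+1) + 1)) ^ j * 1 + 1, by positivity, fun x hx => ?_⟩
  have hs : 1 ≤ √x := Real.one_le_sqrt.2 hx
  rcases Nat.eq_zero_or_pos j with rfl | hj
  · simp; linarith
  have hl : Real.log (x+1) ≤ Real.log x + 1 := by
    have : Real.log (x+1) ≤ Real.log (2 * x) := Real.log_le_log (by linarith) (by linarith)
    rw [Real.log_mul (by norm_num) (by linarith)] at this
    linarith [Real.log_two_lt_d9]
  have hlx : 0 ≤ Real.log x := Real.log_nonneg hx
  have hε : (0:ℝ) < 1 / (2 * j) := by positivity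
  have h1 := Real.log_le_rpow_div (by linarith : 0 ≤ x) hε
  have h2 : 1 ≤ x ^ (1 / (2 * j) : ℝ) := Real.one_le_rpow hx hε.le
  have h3 : 1 + Real.log (x+1) ≤ (2 * (2 * (j+1) + 1)) * x ^ (1 / (2 * j) : ℝ) := by
    have : x ^ (1 / (2 * j) : ℝ) / (1 / (2 * j)) = 2 * j * x ^ (1 / (2 * j) : ℝ) := by field_simp
    rw [this] at h1
    nlinarith
  have h4 : 0 ≤ 1 + Real.log (x+1) := by linarith [Real.log_nonneg (by linarith : 1 ≤ x + 1)]
  calc (1 + Real.log (x + 1)) ^ j ≤ ((2 * (2 * (j+1) + 1)) * x ^ (1 / (2 * j) : ℝ)) ^ j := pow_le_pow_left₀ h4 h3 j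
    _ = (2 * (2 * (j+1) + 1)) ^ j * √x := by
      rw [mul_pow, ← Real.rpow_natCast (x ^ _), ← Real.rpow_mul (by linarith), Real.sqrt_eq_rpow]
      congr 2
      field_simp
    _ ≤ _ := by
      apply mul_le_mul_of_nonneg_right _ (by linarith)
      linarith

/-- the weight `log^j n / n^s` -/
noncomputable def wt (j : ℕ) (s : ℂ) (n : ℕ) : ℂ := (Real.log n : ℂ) ^ j * Complex.exp (-s * Real.log n)

lemma wt_norm (j : ℕ) (s : ℂ) (n : ℕ) (hn : 1 ≤ n) (hs : 1 ≤ s.re) : ‖wt j s n‖ ≤ Real.log n ^ j * (1 / n) := by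
  have h0 : 0 ≤ Real.log n := Real.log_nonneg (by exact_mod_cast hn)
  have hn' : (0:ℝ) < n := by exact_mod_cast hn
  rw [wt, norm_mul, norm_pow, Complex.norm_real, Real.norm_of_nonneg h0, Complex.norm_exp]
  apply mul_le_mul_of_nonneg_left _ (by positivity)
  rw [one_div, ← Real.exp_log hn', ← Real.exp_neg, Real.exp_log hn']
  apply Real.exp_le_exp.2
  simp only [Complex.mul_re, Complex.neg_re, Complex.ofReal_re, Complex.ofReal_im, mul_zero, sub_zero]
  nlinarith

lemma wt_bounds (j : ℕ) : ∃ C : ℝ, 0 < C ∧ ∀ s : ℂ, 1 ≤ s.re → ‖s‖ ≤ 5 → ∀ n : ℕ, 1 ≤ n →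
    ‖wt j s n‖ ≤ C / √(n:ℝ) ∧ ‖wt j s (n+1) - wt j s n‖ ≤ C * (1 / ((n:ℝ) * √(n:ℝ))) := by
  obtain ⟨C, hC, h⟩ := log_pow_le j
  refine ⟨(j + 5) * C, by positivity, fun s hs hs5 n hn => ?_⟩
  have hn' : (1:ℝ) ≤ n := by exact_mod_cast hn
  have h0 : 0 ≤ Real.log n := Real.log_nonneg hn'
  have hle : Real.log n ≤ Real.log (n+1) := Real.log_le_log (by linarith) (by linarith)
  have hsq : √(n:ℝ) * √(n:ℝ) = n := Real.mul_self_sqrt (by linarith)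
  have hsp : 0 < √(n:ℝ) := by positivity
  have hCn := h n hn'
  constructor
  · refine (wt_norm j s n hn hs).trans ?_
    have h1 : Real.log n ^ j ≤ C * √(n:ℝ) := le_trans (pow_le_pow_left₀ h0 (by linarith) j) hCn
    calc Real.log n ^ j * (1 / n) ≤ C * √(n:ℝ) * (1/n) := by gcongr
      _ = C / √(n:ℝ) := by
        nth_rewrite 2 [← hsq]; field_simp
      _ ≤ _ := by
        apply div_le_div_of_nonneg_right _ hsp.le
        have : (0:ℝ) ≤ j := by positivity
        nlinarith
  · set f : ℝ → ℂ := fun v => (v:ℂ) ^ j * Complex.exp (-s * v) with hf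
    have hder : ∀ v ∈ Set.Icc (Real.log n) (Real.log (n+1)), HasDerivWithinAt f
        ((j * (v:ℂ)^(j-1) * 1) * Complex.exp (-s * v) + (v:ℂ) ^ j * (Complex.exp (-s * v) * (-s * 1)))
        (Set.Icc (Real.log n) (Real.log (n+1))) v := by
      intro v _
      have e1 : HasDerivAt (fun v : ℝ => (v:ℂ)) 1 v := Complex.ofRealCLM.hasDerivAt
      exact ((e1.pow j).mul ((e1.const_mul (-s)).cexp)).hasDerivWithinAt
    have hbd : ∀ v ∈ Set.Icc (Real.log n) (Real.log (n+1)),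
        ‖(j * (v:ℂ)^(j-1) * 1) * Complex.exp (-s * v) + (v:ℂ) ^ j * (Complex.exp (-s * v) * (-s * 1))‖
        ≤ (j+5) * (C * √(n:ℝ)) * (1 / n) := by
      rintro v ⟨hv1, hv2⟩
      have hv0 : 0 ≤ v := h0.trans hv1
      have hpow : (1 + v) ^ j ≤ C * √(n:ℝ) := le_trans (pow_le_pow_left₀ (by linarith) (by linarith) j) hCn
      have hp1 : v ^ (j-1) ≤ (1+v)^j :=
        (pow_le_pow_left₀ hv0 (by linarith) _).trans (pow_le_pow_right₀ (by linarith) (by omega))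
      have hp2 : v ^ j ≤ (1+v)^j := pow_le_pow_left₀ hv0 (by linarith) _
      have hexp : ‖Complex.exp (-s * v)‖ ≤ 1 / n := by
        rw [Complex.norm_exp, one_div, ← Real.exp_log (by linarith : (0:ℝ) < n), ← Real.exp_neg]
        apply Real.exp_le_exp.2
        simp only [Complex.mul_re, Complex.neg_re, Complex.ofReal_re, Complex.ofReal_im, mul_zero, sub_zero]
        nlinarith
      have : (j * (v:ℂ)^(j-1) * 1) * Complex.exp (-s * v) + (v:ℂ) ^ j * (Complex.exp (-s * v) * (-s * 1))
        = (j * (v:ℂ)^(j-1) - s * (v:ℂ)^j) * Complex.exp (-s * v) := by ring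
      rw [this, norm_mul]
      apply mul_le_mul _ hexp (norm_nonneg _) (by positivity)
      refine (norm_sub_le _ _).trans ?_
      rw [norm_mul, norm_mul, norm_pow, norm_pow, Complex.norm_real, Real.norm_of_nonneg hv0, Complex.norm_natCast]
      have a1 : (j:ℝ) * v^(j-1) ≤ j * (C * √(n:ℝ)) := by gcongr; linarith
      have a2 : ‖s‖ * v^j ≤ 5 * (C * √(n:ℝ)) := by gcongr; linarith
      linarith
    have := Convex.norm_image_sub_le_of_norm_hasDerivWithin_le hder hbd (convex_Icc _ _)
      (Set.left_mem_Icc.2 hle) (Set.right_mem_Icc.2 hle)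
    have e : wt j s (n+1) - wt j s n = f (Real.log (n+1)) - f (Real.log n) := by
      simp [wt, hf]
    rw [e]
    refine this.trans ?_
    have hl := log_succ_sub_le hn
    push_cast at hl
    rw [Real.norm_eq_abs]
    calc (j+5) * (C * √(n:ℝ)) * (1 / n) * |Real.log (n+1) - Real.log n| ≤ (j+5) * (C * √(n:ℝ)) * (1 / n) * (1/n) := by gcongr
      _ = _ := by
        have : (n:ℝ) ≠ 0 := by linarith
        field_simp
        rw [Real.sq_sqrt (by linarith)]

lemma inv_sum_log (N : ℕ) : ∑ n ∈ Ico 1 N, 1 / (n:ℝ) ≤ 1 + Real.log N := by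
  have h := harmonic_le_one_add_log N
  refine le_trans ?_ h
  rw [harmonic_eq_sum_Icc]
  push_cast
  simp only [one_div]
  apply sum_le_sum_of_subset_of_nonneg
  · intro x hx; simp at hx ⊢; omega
  · intros; positivity

lemma ell_partial (j : ℕ) : ∃ C : ℝ, 0 < C ∧ ∀ (q : ℕ) [NeZero q] (χ : DirichletCharacter ℂ q), χ ≠ 1 →
    ∀ s : ℂ, 1 ≤ s.re → ‖s‖ ≤ 5 → ∀ M : ℕ, ‖∑ n ∈ Ico 1 M, χ n * wt j s n‖ ≤ C * (1 + Real.log q) ^ (j+1) := by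
  obtain ⟨C, hC, h⟩ := wt_bounds j
  refine ⟨2 ^ (j+1) + 12 * C, by positivity, fun q _ χ hχ s hs hs5 M => ?_⟩
  have hq : 1 ≤ q := Nat.one_le_iff_ne_zero.2 (NeZero.ne q)
  have hq' : (1:ℝ) ≤ q := by exact_mod_cast hq
  have hl : 0 ≤ Real.log q := Real.log_nonneg hq'
  have hN : 1 ≤ q^2 := Nat.one_le_pow _ _ hq
  have hpw : (1:ℝ) ≤ (1 + Real.log q)^(j+1) := one_le_pow₀ (by linarith)
  have head : ∀ M', M' ≤ q^2 → ‖∑ n ∈ Ico 1 M', χ n * wt j s n‖ ≤ 2^(j+1) * (1 + Real.log q)^(j+1) := by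
    intro M' hM'
    calc ‖∑ n ∈ Ico 1 M', χ n * wt j s n‖ ≤ ∑ n ∈ Ico 1 M', ‖χ n * wt j s n‖ := norm_sum_le _ _
      _ ≤ ∑ n ∈ Ico 1 M', (2 * Real.log q)^j * (1 / n) := by
        apply sum_le_sum
        intro n hn
        rw [mem_Ico] at hn
        rw [norm_mul]
        have h1 := wt_norm j s n hn.1 hs
        have h2 : Real.log n ≤ 2 * Real.log q := by
          rw [show 2 * Real.log q = Real.log ((q:ℝ)^2) by rw [Real.log_pow]; norm_num]
          apply Real.log_le_log (by exact_mod_cast hn.1)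
          exact_mod_cast (by omega)
        have h3 : 0 ≤ Real.log n := Real.log_nonneg (by exact_mod_cast hn.1)
        calc ‖χ n‖ * ‖wt j s n‖ ≤ 1 * (Real.log n ^ j * (1/n)) := by
              apply mul_le_mul (χ.norm_le_one _) h1 (norm_nonneg _) zero_le_one
          _ ≤ _ := by rw [one_mul]; gcongr
      _ ≤ ∑ n ∈ Ico 1 (q^2), (2 * Real.log q)^j * (1 / n) := by
        apply sum_le_sum_of_subset_of_nonneg (Ico_subset_Ico le_rfl hM')
        intros; positivity
      _ ≤ (2 * Real.log q)^j * (1 + 2 * Real.log q) := by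
        rw [← mul_sum]
        gcongr
        refine (inv_sum_log _).trans ?_
        push_cast; rw [Real.log_pow]; norm_num
      _ ≤ (2 * (1 + Real.log q))^j * (2 * (1 + Real.log q)) := by gcongr <;> linarith
      _ = _ := by rw [mul_pow]; ring
  rcases le_total M (q^2) with hM | hM
  · refine (head M hM).trans ?_
    gcongr; linarith
  · rw [← sum_Ico_consecutive _ hN hM, sum_Ico_eq_sum_range _ (q^2)]
    refine (norm_add_le _ _).trans ?_
    have t := tail_bound (fun n => χ n) (wt j s) q C hC.le (fun n => char_partial χ hχ n)
      (fun n hn => (h s hs hs5 n hn).1) (fun n hn => (h s hs hs5 n hn).2) (q^2) hN (M - q^2)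
    have e : 2 * (q:ℝ) * (6 * C / √((q^2 : ℕ) : ℝ)) = 12 * C := by
      push_cast; rw [Real.sqrt_sq (by linarith)]; field_simp; norm_num
    rw [e] at t
    have := head (q^2) le_rfl
    nlinarith
end DSR
namespace DSR
open Finset MeasureTheory LSeries

lemma logMul_iter (j : ℕ) (f : ℕ → ℂ) (n : ℕ) : (logMul^[j] f) n = (Real.log n : ℂ) ^ j * f n := by
  induction j with
  | zero => simp
  | succ j ih =>
    rw [Function.iterate_succ_apply', logMul, ih, pow_succ', ← Complex.natCast_log]
    ring

lemma term_logMul (j : ℕ) (f : ℕ → ℂ) (s : ℂ) (n : ℕ) (hn : n ≠ 0) :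
    LSeries.term (logMul^[j] f) s n = f n * wt j s n := by
  rw [LSeries.term_of_ne_zero hn, logMul_iter, wt, div_eq_mul_inv, ← Complex.cpow_neg,
    Complex.cpow_def_of_ne_zero (by exact_mod_cast hn), ← Complex.natCast_log]
  rw [mul_comm (Real.log n : ℂ) (-s)]
  ring

lemma LS_partial (j : ℕ) (f : ℕ → ℂ) (s : ℂ) (h : LSeriesSummable (logMul^[j] f) s) (B : ℝ)
    (hB : ∀ M : ℕ, ‖∑ n ∈ Ico 1 M, f n * wt j s n‖ ≤ B) : ‖LSeries (logMul^[j] f) s‖ ≤ B := by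
  have h1 := h.hasSum.tendsto_sum_nat
  refine le_of_tendsto h1.norm ?_
  filter_upwards with M
  have : ∑ n ∈ range M, LSeries.term (logMul^[j] f) s n = ∑ n ∈ Ico 1 M, f n * wt j s n := by
    rcases Nat.eq_zero_or_pos M with rfl | hM
    · simp
    rw [range_eq_Ico, sum_eq_sum_Ico_succ_bot hM]
    simp only [LSeries.term_zero, zero_add]
    apply sum_congr rfl
    intro n hn
    rw [mem_Ico] at hn
    exact term_logMul j f s n (by omega)
  rw [this]
  exact hB M

lemma char_summable (j : ℕ) {q : ℕ} [NeZero q] (χ : DirichletCharacter ℂ q) (s : ℂ) (hs : 1 < s.re) :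
    LSeriesSummable (logMul^[j] (fun n => χ n)) s := by
  apply LSeriesSummable_of_abscissaOfAbsConv_lt_re
  rw [absicssaOfAbsConv_logPowMul, DirichletCharacter.absicssaOfAbsConv_eq_one (NeZero.ne q)]
  exact_mod_cast hs

lemma ell_bound (j : ℕ) : ∃ C : ℝ, 0 < C ∧ ∀ (q : ℕ) [NeZero q] (χ : DirichletCharacter ℂ q), χ ≠ 1 →
    ∀ s : ℂ, 1 < s.re → ‖s‖ ≤ 5 → ‖LSeries (logMul^[j] (fun n => χ n)) s‖ ≤ C * (1 + Real.log q) ^ (j+1) := by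
  obtain ⟨C, hC, h⟩ := ell_partial j
  exact ⟨C, hC, fun q _ χ hχ s hs hs5 => LS_partial j _ s (char_summable j χ s hs) _ (h q χ hχ s hs.le hs5)⟩

lemma re_log_comb {r : ℝ} (hr0 : 0 ≤ r) (hr1 : r < 1) {a b : ℂ} (ha : ‖a‖ ≤ 1) (hb : ‖b‖ ≤ 1) :
    0 ≤ 3 * (-Complex.log (1 - r)).re + 2 * (-Complex.log (1 - r * a)).re + 2 * (-Complex.log (1 - r * b)).re
      + 2 * (-Complex.log (1 - r * (a * (starRingEnd ℂ) b))).re := by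
  have h0 : ‖(r : ℂ)‖ < 1 := by simpa only [Complex.norm_of_nonneg hr0]
  have hh : ∀ c : ℂ, ‖c‖ ≤ 1 → ‖(r:ℂ) * c‖ < 1 := by
    intro c hc
    rw [norm_mul]
    exact lt_of_le_of_lt (mul_le_of_le_one_right (norm_nonneg _) hc) h0
  have hab : ‖a * (starRingEnd ℂ) b‖ ≤ 1 := by
    rw [norm_mul, RCLike.norm_conj]; exact mul_le_one₀ ha (norm_nonneg _) hb
  rw [← ((Complex.hasSum_re <| Complex.hasSum_taylorSeries_neg_log h0).mul_left 3).add
    ((Complex.hasSum_re <| Complex.hasSum_taylorSeries_neg_log (hh a ha)).mul_left 2) |>.add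
    ((Complex.hasSum_re <| Complex.hasSum_taylorSeries_neg_log (hh b hb)).mul_left 2) |>.add
    ((Complex.hasSum_re <| Complex.hasSum_taylorSeries_neg_log (hh _ hab)).mul_left 2) |>.tsum_eq]
  refine tsum_nonneg fun n ↦ ?_
  simp only [← Complex.ofReal_pow, Complex.div_natCast_re, Complex.ofReal_re, mul_pow, Complex.re_ofReal_mul]
  simp only [← mul_div_assoc, ← add_div]
  refine div_nonneg ?_ n.cast_nonneg
  have e : (starRingEnd ℂ) b ^ n = (starRingEnd ℂ) (b ^ n) := by simp
  rw [e]
  have ha' : ‖a ^ n‖ ≤ 1 := by rw [norm_pow]; exact pow_le_one₀ (norm_nonneg _) ha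
  have hb' : ‖b ^ n‖ ≤ 1 := by rw [norm_pow]; exact pow_le_one₀ (norm_nonneg _) hb
  generalize a ^ n = x at *
  generalize b ^ n = y at *
  have hx2 : x.re * x.re + x.im * x.im ≤ 1 := by
    rw [← Complex.normSq_apply, Complex.normSq_eq_norm_sq]; nlinarith [norm_nonneg x]
  have hy2 : y.re * y.re + y.im * y.im ≤ 1 := by
    rw [← Complex.normSq_apply, Complex.normSq_eq_norm_sq]; nlinarith [norm_nonneg y]
  simp only [Complex.mul_re, Complex.conj_re, Complex.conj_im]
  have : 0 ≤ r ^ n := by positivity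
  have h2 : 0 ≤ 3 + 2 * x.re + 2 * y.re + 2 * (x.re * y.re - x.im * (-y.im)) := by
    nlinarith [sq_nonneg (1 + x.re + y.re), sq_nonneg (x.im + y.im)]
  calc 0 ≤ r ^ n * (3 + 2 * x.re + 2 * y.re + 2 * (x.re * y.re - x.im * (-y.im))) := mul_nonneg this h2
    _ = _ := by ring

lemma prime_cpow_split (p : Nat.Primes) (η τ : ℝ) :
    ((p:ℕ):ℂ) ^ (-(1 + η + Complex.I * τ : ℂ)) = ((((p:ℕ):ℝ) ^ (-(1+η)) : ℝ) : ℂ) * ((p:ℕ):ℂ) ^ (-(Complex.I * τ)) := by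
  have hp : ((p:ℕ):ℂ) ≠ 0 := by exact_mod_cast p.prop.ne_zero
  rw [neg_add, Complex.cpow_add _ _ hp, Complex.ofReal_cpow (Nat.cast_nonneg _)]
  push_cast; ring_nf

lemma norm_pI (p : Nat.Primes) (τ : ℝ) : ‖((p:ℕ):ℂ) ^ (-(Complex.I * τ))‖ = 1 := by
  rw [Complex.norm_natCast_cpow_of_pos p.prop.pos]; simp

lemma conj_pI (p : Nat.Primes) (τ : ℝ) : (starRingEnd ℂ) (((p:ℕ):ℂ) ^ (-(Complex.I * τ))) =
    ((p:ℕ):ℂ) ^ ((Complex.I * τ)) := by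
  have hp : ((p:ℕ):ℂ) ≠ 0 := by exact_mod_cast p.prop.ne_zero
  rw [Complex.cpow_def_of_ne_zero hp, Complex.cpow_def_of_ne_zero hp, ← Complex.exp_conj, ← Complex.natCast_log]
  congr 1
  simp only [map_mul, map_neg, Complex.conj_I, Complex.conj_ofReal]
  ring

lemma prod_ge_one (t1 t2 : PChar) {η : ℝ} (hη : 0 < η) (τ1 τ2 : ℝ) :
    1 ≤ ‖riemannZeta (1 + η)‖ ^ 3 * ‖LSeries (fun n => t1.2 n) (1 + η + Complex.I * τ1)‖ ^ 2
      * ‖LSeries (fun n => t2.2 n) (1 + η + Complex.I * τ2)‖ ^ 2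
      * ‖LSeries (fun n => pairChar t1 t2 n) (1 + η + Complex.I * (τ1 - τ2 : ℝ))‖ ^ 2 := by
  have hre : ∀ τ : ℝ, 1 < (1 + η + Complex.I * τ : ℂ).re := by intro τ; simp [hη]
  have hre0 : 1 < (1 + η : ℂ).re := by simp [hη]
  have H0 : Summable fun p : Nat.Primes ↦ -Complex.log (1 - (p : ℂ) ^ (-(1 + η : ℂ))) := by
    have := DirichletCharacter.summable_neg_log_one_sub_mul_prime_cpow (1 : DirichletCharacter ℂ 1) hre0
    refine this.congr fun p => ?_
    rw [MulChar.one_apply (isUnit_of_subsingleton _), one_mul]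
  have H1 := DirichletCharacter.summable_neg_log_one_sub_mul_prime_cpow t1.2 (hre τ1)
  have H2 := DirichletCharacter.summable_neg_log_one_sub_mul_prime_cpow t2.2 (hre τ2)
  have H3 := DirichletCharacter.summable_neg_log_one_sub_mul_prime_cpow (pairChar t1 t2) (hre (τ1 - τ2))
  have hs0 := (Complex.hasSum_re H0.hasSum).mul_left 3
  have hs1 := (Complex.hasSum_re H1.hasSum).mul_left 2
  have hs2 := (Complex.hasSum_re H2.hasSum).mul_left 2
  have hs3 := (Complex.hasSum_re H3.hasSum).mul_left 2
  have hS := ((hs0.add hs1).add hs2).add hs3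
  rw [← riemannZeta_eulerProduct_exp_log hre0, ← DirichletCharacter.LSeries_eulerProduct_exp_log t1.2 (hre τ1),
    ← DirichletCharacter.LSeries_eulerProduct_exp_log t2.2 (hre τ2),
    ← DirichletCharacter.LSeries_eulerProduct_exp_log (pairChar t1 t2) (hre (τ1 - τ2))]
  simp only [Complex.norm_exp, ← Real.exp_nat_mul, ← Real.exp_add, Real.one_le_exp_iff]
  push_cast
  rw [← Complex.ofReal_sub, ← hS.tsum_eq]
  refine tsum_nonneg fun p => ?_
  have hr1 : ((p:ℕ):ℝ) ^ (-(1+η)) < 1 := by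
    apply Real.rpow_lt_one_of_one_lt_of_neg (by exact_mod_cast p.prop.one_lt) (by linarith)
  have key := re_log_comb (r := ((p:ℕ):ℝ) ^ (-(1+η))) (by positivity) hr1
    (a := t1.2 (p:ℕ) * ((p:ℕ):ℂ) ^ (-(Complex.I * τ1))) (b := t2.2 (p:ℕ) * ((p:ℕ):ℂ) ^ (-(Complex.I * τ2)))
    (by rw [norm_mul, norm_pI, mul_one]; exact t1.2.norm_le_one _)
    (by rw [norm_mul, norm_pI, mul_one]; exact t2.2.norm_le_one _)
  have e0 : ((p:ℕ):ℂ) ^ (-(1 + η : ℂ)) = ((((p:ℕ):ℝ) ^ (-(1+η)) : ℝ) : ℂ) := by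
    rw [Complex.ofReal_cpow (Nat.cast_nonneg _)]; push_cast; rfl
  have hp : ((p:ℕ):ℂ) ≠ 0 := by exact_mod_cast p.prop.ne_zero
  rw [e0, prime_cpow_split p η τ1, prime_cpow_split p η τ2, prime_cpow_split p η (τ1 - τ2)]
  have e3 : pairChar t1 t2 (p:ℕ) * (((((p:ℕ):ℝ) ^ (-(1+η)) : ℝ) : ℂ) * ((p:ℕ):ℂ) ^ (-(Complex.I * (τ1 - τ2 : ℝ)))) =
     ((((p:ℕ):ℝ) ^ (-(1+η)) : ℝ) : ℂ) * (t1.2 (p:ℕ) * ((p:ℕ):ℂ) ^ (-(Complex.I * τ1)) *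
      (starRingEnd ℂ) (t2.2 (p:ℕ) * ((p:ℕ):ℂ) ^ (-(Complex.I * τ2)))) := by
    rw [pairChar_apply, map_mul, conj_pI, show (-(Complex.I * (τ1 - τ2 : ℝ)) : ℂ) = -(Complex.I * τ1) + Complex.I * τ2 by push_cast; ring,
      Complex.cpow_add _ _ hp]
    simp only [ev]
    ring
  rw [e3]
  have e1 : ∀ x y z : ℂ, x * (y * z) = y * (x * z) := fun x y z => by ring
  rw [e1 (t1.2 _), e1 (t2.2 _)]
  exact key
end DSR
namespace DSR
open Finset MeasureTheory LSeries

lemma zeta_near_one : ∃ η0 : ℝ, 0 < η0 ∧ ∀ η : ℝ, 0 < η → η ≤ η0 → ‖riemannZeta (1 + η)‖ ≤ 2 / η := by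
  have h := riemannZeta_residue_one
  have h1 : ∀ᶠ s in nhdsWithin (1:ℂ) {1}ᶜ, ‖(s - 1) * riemannZeta s‖ < 2 :=
    (h.norm).eventually_lt_const (by simp)
  rw [eventually_nhdsWithin_iff, Metric.eventually_nhds_iff] at h1
  obtain ⟨ε, hε, h1⟩ := h1
  refine ⟨ε / 2, by positivity, fun η h0 hη => ?_⟩
  have h2 := @h1 (1 + η) (by rw [dist_eq_norm]; simp; rw [abs_of_pos h0]; linarith) (by simp; exact h0.ne')
  rw [add_sub_cancel_left, norm_mul, Complex.norm_real, Real.norm_of_nonneg h0.le] at h2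
  rw [le_div_iff₀ h0]
  linarith

lemma char_absc {q : ℕ} [NeZero q] (χ : DirichletCharacter ℂ q) {s : ℂ} (hs : 1 < s.re) :
    abscissaOfAbsConv (fun n => χ n) < s.re := by
  rw [DirichletCharacter.absicssaOfAbsConv_eq_one (NeZero.ne q)]
  exact_mod_cast hs

lemma s_norm {u τ : ℝ} (h0 : 0 ≤ u) (h1 : u ≤ 1) (hτ : |τ| ≤ 3) : ‖(1 + u + Complex.I * τ : ℂ)‖ ≤ 5 := by
  refine (norm_add_le _ _).trans ?_
  have : ‖(1 + u : ℂ)‖ ≤ 1 + u := (norm_add_le _ _).trans (by simp [abs_of_nonneg h0])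
  have h2 : ‖Complex.I * (τ:ℂ)‖ = |τ| := by simp
  linarith

lemma L_shift : ∃ C : ℝ, 0 < C ∧ ∀ (q : ℕ) [NeZero q] (χ : DirichletCharacter ℂ q), χ ≠ 1 →
    ∀ σ η τ : ℝ, 0 < σ → σ ≤ η → η ≤ 1 → |τ| ≤ 3 →
    ‖LSeries (fun n => χ n) (1 + η + Complex.I * τ)‖ ≤ ‖LSeries (fun n => χ n) (1 + σ + Complex.I * τ)‖
      + C * (1 + Real.log q)^2 * η := by
  obtain ⟨C, hC, h⟩ := ell_bound 1
  refine ⟨C, hC, fun q _ χ hχ σ η τ h0 h1 h2 h3 => ?_⟩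
  have hder : ∀ u ∈ Set.Icc σ η, HasDerivWithinAt (fun u : ℝ => LSeries (fun n => χ n) (1 + u + Complex.I * τ))
      (-LSeries (logMul (fun n => χ n)) (1 + u + Complex.I * τ)) (Set.Icc σ η) u := by
    intro u hu
    have hu0 : 0 < u := h0.trans_le hu.1
    have e1 : HasDerivAt (LSeries (fun n => χ n)) (-LSeries (logMul (fun n => χ n)) (1 + u + Complex.I * τ))
      (1 + u + Complex.I * τ) := LSeries_hasDerivAt (char_absc χ (by simp [hu0]))
    have e2 : HasDerivAt (fun z : ℂ => 1 + z + Complex.I * τ) 1 (u:ℂ) := by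
      simpa using ((hasDerivAt_id (u:ℂ)).const_add 1).add_const (Complex.I * τ)
    have e3 := (HasDerivAt.comp (u:ℂ) e1 e2).comp_ofReal
    simpa using e3.hasDerivWithinAt
  have hbd : ∀ u ∈ Set.Icc σ η, ‖-LSeries (logMul (fun n => χ n)) (1 + u + Complex.I * τ)‖ ≤ C * (1 + Real.log q)^2 := by
    intro u hu
    have hu0 : 0 < u := h0.trans_le hu.1
    rw [norm_neg]
    exact h q χ hχ _ (by simp [hu0]) (s_norm hu0.le (hu.2.trans h2) h3)
  have := Convex.norm_image_sub_le_of_norm_hasDerivWithin_le hder hbd (convex_Icc _ _)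
      (Set.left_mem_Icc.2 h1) (Set.right_mem_Icc.2 h1)
  rw [Real.norm_eq_abs, abs_of_nonneg (by linarith)] at this
  have h5 := norm_le_norm_add_norm_sub' (LSeries (fun n => χ n) (1 + η + Complex.I * τ)) (LSeries (fun n => χ n) (1 + σ + Complex.I * τ))
  have h6 : C * (1 + Real.log q)^2 * (η - σ) ≤ C * (1 + Real.log q)^2 * η := by
    apply mul_le_mul_of_nonneg_left _ (by positivity); linarith
  linarith

lemma prim_ne_one {t : PChar} (hp : t.2.IsPrimitive) (h1 : t.1 ≠ 1) (h0 : 1 ≤ t.1) : t.2 ≠ 1 := by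
  intro h
  apply h1
  have : NeZero t.1 := ⟨by omega⟩
  have := (DirichletCharacter.isPrimitive_def t.2).1 hp
  rw [h, DirichletCharacter.conductor_one] at this
  exact this.symm

lemma one_bad : ∃ L0 : ℝ, 1 ≤ L0 ∧ ∀ 𝓛 : ℝ, L0 ≤ 𝓛 → ∀ t1 t2 : PChar, t1.2.IsPrimitive → t2.2.IsPrimitive →
    1 < t1.1 → 1 < t2.1 → 1 + Real.log t1.1 ≤ 𝓛 → 1 + Real.log t2.1 ≤ 𝓛 → t1 ≠ t2 →
    ∀ σ τ1 τ2 : ℝ, 0 < σ → σ ≤ 1 / 𝓛 ^ 11 → |τ1| ≤ 1 → |τ2| ≤ 1 →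
    ‖LSeries (fun n => t1.2 n) (1 + σ + Complex.I * τ1)‖ < 1 / 𝓛 ^ 11 →
    1 / 𝓛 ^ 11 ≤ ‖LSeries (fun n => t2.2 n) (1 + σ + Complex.I * τ2)‖ := by
  obtain ⟨C1, hC1, hS⟩ := L_shift
  obtain ⟨C0, hC0, hE⟩ := ell_bound 0
  obtain ⟨η0, hη0, hZ⟩ := zeta_near_one
  set D := 8 * (1 + C1)^4 * (4 * C0^2) with hD
  refine ⟨1 + 1 / η0 + D, by have : 0 < 1 / η0 := by positivity
                             have : 0 ≤ D := by positivity
                             linarith, fun 𝓛 hL t1 t2 p1 p2 q1 q2 l1 l2 hne σ τ1 τ2 hσ hσ2 hτ1 hτ2 b1 => ?_⟩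
  by_contra! b2
  have hη0' : 0 < 1 / η0 := by positivity
  have hD0 : 0 ≤ D := by positivity
  have hL1 : 1 ≤ 𝓛 := by linarith
  have hLp : 0 < 𝓛 := by linarith
  have : NeZero t1.1 := ⟨by omega⟩
  have : NeZero t2.1 := ⟨by omega⟩
  set η := 1 / 𝓛 ^ 11 with hη
  have hηp : 0 < η := by positivity
  have hη1 : η ≤ 1 := by rw [hη, div_le_one (by positivity)]; exact one_le_pow₀ hL1
  have hηη : η ≤ η0 := by
    have : 1 / 𝓛 ^ 11 ≤ 1 / 𝓛 := by
      apply one_div_le_one_div_of_le hLp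
      exact le_self_pow₀ hL1 (by norm_num)
    have h2 : 1 / 𝓛 ≤ η0 := by
      rw [div_le_iff₀ hLp]
      have : 1 / η0 ≤ 𝓛 := by linarith
      rw [div_le_iff₀ hη0] at this; linarith
    linarith
  have hlog1 : 0 ≤ Real.log t1.1 := Real.log_natCast_nonneg _
  have hlog2 : 0 ≤ Real.log t2.1 := Real.log_natCast_nonneg _
  have n1 := prim_ne_one p1 (by omega) (by omega)
  have n2 := prim_ne_one p2 (by omega) (by omega)
  have s1 := hS t1.1 t1.2 n1 σ η τ1 hσ hσ2 hη1 (by linarith)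
  have s2 := hS t2.1 t2.2 n2 σ η τ2 hσ hσ2 hη1 (by linarith)
  have n12 := pairChar_ne_one (by omega) (by omega) p1 p2 hne
  have hτ12 : |τ1 - τ2| ≤ 3 := (abs_sub _ _).trans (by linarith)
  have s12 := hE (t1.1 * t2.1) (pairChar t1 t2) n12 (1 + η + Complex.I * (τ1 - τ2 : ℝ)) (by simp [hηp])
    (s_norm hηp.le hη1 hτ12)
  simp only [Function.iterate_zero, id] at s12
  push_cast [Real.log_mul (by exact_mod_cast (by omega) : (t1.1:ℝ) ≠ 0) (by exact_mod_cast (by omega) : (t2.1:ℝ) ≠ 0)] at s12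
  have z := hZ η hηp hηη
  have pg := prod_ge_one t1 t2 hηp τ1 τ2
  have sq : ∀ l : ℝ, 0 ≤ l → 1 + l ≤ 𝓛 → (1+l)^2 ≤ 𝓛^2 := fun l h0 h => pow_le_pow_left₀ (by linarith) h 2
  have hL2 : 1 ≤ 𝓛^2 := one_le_pow₀ hL1
  have u1 : ‖LSeries (fun n => t1.2 n) (1 + η + Complex.I * τ1)‖ ≤ (1 + C1) * 𝓛^2 * η := by
    have := mul_le_mul_of_nonneg_right (mul_le_mul_of_nonneg_left (sq _ hlog1 l1) hC1.le) hηp.le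
    nlinarith
  have u2 : ‖LSeries (fun n => t2.2 n) (1 + η + Complex.I * τ2)‖ ≤ (1 + C1) * 𝓛^2 * η := by
    have := mul_le_mul_of_nonneg_right (mul_le_mul_of_nonneg_left (sq _ hlog2 l2) hC1.le) hηp.le
    nlinarith
  have u12 : ‖LSeries (fun n => pairChar t1 t2 n) (1 + η + Complex.I * (τ1 - τ2 : ℝ))‖ ≤ 2 * C0 * 𝓛 := by
    push_cast
    refine s12.trans ?_
    rw [pow_one]
    nlinarith
  have fin : 1 ≤ (2 / η) ^ 3 * ((1 + C1) * 𝓛^2 * η)^2 * ((1 + C1) * 𝓛^2 * η)^2 * (2 * C0 * 𝓛)^2 := by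
    refine pg.trans ?_
    gcongr
  have e : (2 / η) ^ 3 * ((1 + C1) * 𝓛^2 * η)^2 * ((1 + C1) * 𝓛^2 * η)^2 * (2 * C0 * 𝓛)^2 = D / 𝓛 := by
    rw [hD, hη]; field_simp; norm_num
  rw [e, le_div_iff₀ hLp] at fin
  linarith

/-- the twisted von Mangoldt function -/
noncomputable def chL {q : ℕ} (χ : DirichletCharacter ℂ q) (n : ℕ) : ℂ := χ n * (ArithmeticFunction.vonMangoldt n : ℂ)

lemma chL_absc {q : ℕ} (χ : DirichletCharacter ℂ q) {s : ℂ} (hs : 1 < s.re) :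
    abscissaOfAbsConv (chL χ) < s.re := by
  have : abscissaOfAbsConv (chL χ) ≤ (1:ℝ) := by
    apply abscissaOfAbsConv_le_of_forall_lt_LSeriesSummable
    intro y hy
    exact DirichletCharacter.LSeriesSummable_twist_vonMangoldt χ (by simpa using hy)
  exact lt_of_le_of_lt this (by exact_mod_cast hs)

lemma recursion {q : ℕ} [NeZero q] (χ : DirichletCharacter ℂ q) {s : ℂ} (hs : 1 < s.re) (n : ℕ) :
    LSeries (logMul^[n+1] (fun n => χ n)) s = ∑ i ∈ range (n+1), (n.choose i : ℂ) *
      LSeries (logMul^[i] (chL χ)) s * LSeries (logMul^[n-i] (fun n => χ n)) s := by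
  have hev : deriv (LSeries (fun n => χ n)) =ᶠ[nhds s] -(LSeries (chL χ) * LSeries (fun n => χ n)) := by
    have : ∀ᶠ z : ℂ in nhds s, 1 < z.re := (isOpen_lt continuous_const Complex.continuous_re).mem_nhds hs
    filter_upwards [this] with z hz
    have h1 : LSeries (chL χ) z = _ := DirichletCharacter.LSeries_twist_vonMangoldt_eq χ hz
    have h2 : LSeries (fun n => χ n) z ≠ 0 := DirichletCharacter.LSeries_ne_zero_of_one_lt_re χ hz
    simp only [Pi.neg_apply, Pi.mul_apply]
    rw [h1]; field_simp
  have h1 := hev.iteratedDeriv_eq n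
  rw [← iteratedDeriv_succ', iteratedDeriv_neg, iteratedDeriv_mul, LSeries_iteratedDeriv _ (char_absc χ hs)] at h1
  · have h2 : ((-1:ℂ))^(n+1) * LSeries (logMul^[n+1] (fun n => χ n)) s = (-1)^(n+1) * ∑ i ∈ range (n+1), (n.choose i : ℂ) *
      LSeries (logMul^[i] (chL χ)) s * LSeries (logMul^[n-i] (fun n => χ n)) s := by
      rw [h1, pow_succ, mul_neg_one, neg_mul, mul_sum]
      congr 1
      apply sum_congr rfl
      intro i hi
      rw [mem_range] at hi
      rw [LSeries_iteratedDeriv _ (char_absc χ hs), LSeries_iteratedDeriv _ (chL_absc χ hs)]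
      have : ((-1:ℂ))^n = (-1)^i * (-1)^(n-i) := by rw [← pow_add]; congr 1; omega
      rw [this]; ring
    exact mul_left_cancel₀ (by simp) h2
  · exact (LSeries_analyticOnNhd (chL χ) s (chL_absc χ hs)).contDiffAt
  · exact (LSeries_analyticOnNhd (fun n => χ n) s (char_absc χ hs)).contDiffAt

lemma good_bound (B : ℕ) : ∃ D : ℝ, 0 < D ∧ ∀ i < B, ∀ (q : ℕ) [NeZero q] (χ : DirichletCharacter ℂ q), χ ≠ 1 →
    ∀ 𝓛 : ℝ, 1 + Real.log q ≤ 𝓛 → ∀ s : ℂ, 1 < s.re → ‖s‖ ≤ 5 → 1 / 𝓛 ^ 11 ≤ ‖LSeries (fun n => χ n) s‖ →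
    ‖LSeries (logMul^[i] (chL χ)) s‖ ≤ D * 𝓛 ^ (13 * (i + 1)) := by
  induction B with
  | zero => exact ⟨1, one_pos, fun i hi => by omega⟩
  | succ B ih =>
    obtain ⟨D, hD, ih⟩ := ih
    choose C hC hE using ell_bound
    set D' := C (B+1) + ∑ i ∈ range B, (B.choose i : ℝ) * D * C (B - i) with hD'
    have hD'0 : 0 < D' := by
      have : 0 ≤ ∑ i ∈ range B, (B.choose i : ℝ) * D * C (B - i) :=
        sum_nonneg fun i _ => mul_nonneg (by positivity) (hC _).le
      linarith [hC (B+1)]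
    refine ⟨D + D', by positivity, fun i hi q _ χ hχ 𝓛 hL s hs hs5 hg => ?_⟩
    have hlog : 0 ≤ Real.log q := Real.log_natCast_nonneg _
    have hL1 : 1 ≤ 𝓛 := by linarith
    have hLp : 0 < 𝓛 := by linarith
    rcases Nat.lt_succ_iff_lt_or_eq.1 hi with hi | rfl
    · refine (ih i hi q χ hχ 𝓛 hL s hs hs5 hg).trans ?_
      gcongr; linarith
    · have r := recursion χ hs i
      rw [sum_range_succ] at r
      simp only [Nat.choose_self, Nat.cast_one, one_mul, Nat.sub_self, Function.iterate_zero, id] at r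
      have hℓ : ∀ j, ‖LSeries (logMul^[j] (fun n => χ n)) s‖ ≤ C j * 𝓛^(j+1) := by
        intro j
        refine (hE j q χ hχ s hs hs5).trans ?_
        have := (hC j).le
        gcongr
      have key : ‖LSeries (logMul^[i] (chL χ)) s‖ * ‖LSeries (fun n => χ n) s‖ ≤ D' * 𝓛^(13*i+2) := by
        rw [← norm_mul, show LSeries (logMul^[i] (chL χ)) s * LSeries (fun n => χ n) s =
          LSeries (logMul^[i+1] (fun n => χ n)) s - ∑ x ∈ range i, (i.choose x : ℂ) *
      LSeries (logMul^[x] (chL χ)) s * LSeries (logMul^[i-x] (fun n => χ n)) s by rw [r]; ring]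
        refine (norm_sub_le _ _).trans ?_
        rw [hD', add_mul, sum_mul]
        apply add_le_add
        · refine (hℓ (i+1)).trans ?_
          have := (hC (i+1)).le
          exact mul_le_mul_of_nonneg_left (pow_le_pow_right₀ hL1 (by omega)) this
        · refine (norm_sum_le _ _).trans (sum_le_sum fun x hx => ?_)
          rw [mem_range] at hx
          rw [norm_mul, norm_mul, Complex.norm_natCast]
          have a1 := ih x hx q χ hχ 𝓛 hL s hs hs5 hg
          have a2 := hℓ (i - x)
          calc (i.choose x : ℝ) * ‖LSeries (logMul^[x] (chL χ)) s‖ * ‖LSeries (logMul^[i-x] (fun n => χ n)) s‖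
              ≤ (i.choose x : ℝ) * (D * 𝓛 ^ (13 * (x + 1))) * (C (i-x) * 𝓛^(i-x+1)) := by gcongr
            _ = (i.choose x : ℝ) * D * C (i - x) * 𝓛 ^ (13 * (x+1) + (i-x+1)) := by rw [pow_add]; ring
            _ ≤ _ := by
              have := (hC (i-x)).le
              exact mul_le_mul_of_nonneg_left (pow_le_pow_right₀ hL1 (by omega)) (by positivity)
      have h11 : ‖LSeries (logMul^[i] (chL χ)) s‖ * (1 / 𝓛^11) ≤ D' * 𝓛^(13*i+2) :=
        le_trans (mul_le_mul_of_nonneg_left hg (norm_nonneg _)) key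
      rw [mul_one_div, div_le_iff₀ (by positivity)] at h11
      refine h11.trans ?_
      rw [mul_assoc, ← pow_add, show 13*i+2+11 = 13*(i+1) by ring]
      gcongr; linarith
end DSR
namespace DSR
open Finset MeasureTheory LSeries

lemma zeta_tsum {η : ℝ} (hη : 0 < η) : Summable (fun n : ℕ => 1 / (n:ℝ) ^ (1 + η)) ∧
    ∑' n : ℕ, 1 / (n:ℝ) ^ (1 + η) = ‖riemannZeta (1 + η)‖ := by
  have h0 : Summable (fun n : ℕ => 1 / (n:ℝ) ^ (1 + η)) := Real.summable_one_div_nat_rpow.2 (by linarith)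
  refine ⟨h0, ?_⟩
  rw [zeta_eq_tsum_one_div_nat_cpow (by simp [hη])]
  have : ∀ n : ℕ, 1 / (n:ℂ) ^ (1 + η : ℂ) = ((1 / (n:ℝ) ^ (1 + η) : ℝ) : ℂ) := by
    intro n
    rw [Complex.ofReal_div, Complex.ofReal_cpow (Nat.cast_nonneg _)]
    push_cast; rfl
  simp_rw [this]
  rw [← Complex.ofReal_tsum, Complex.norm_real, Real.norm_of_nonneg]
  exact tsum_nonneg fun n => by positivity

lemma chL_summable (j : ℕ) {q : ℕ} (χ : DirichletCharacter ℂ q) (s : ℂ) (hs : 1 < s.re) :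
    LSeriesSummable (logMul^[j] (chL χ)) s := by
  apply LSeriesSummable_of_abscissaOfAbsConv_lt_re
  rw [absicssaOfAbsConv_logPowMul]
  exact chL_absc χ hs

lemma wt_norm_eq (j : ℕ) (s : ℂ) (n : ℕ) (hn : 1 ≤ n) : ‖wt j s n‖ = Real.log n ^ j * (1 / (n:ℝ) ^ s.re) := by
  have h0 : 0 ≤ Real.log n := Real.log_nonneg (by exact_mod_cast hn)
  have hn' : (0:ℝ) < n := by exact_mod_cast hn
  rw [wt, norm_mul, norm_pow, Complex.norm_real, Real.norm_of_nonneg h0, Complex.norm_exp, Real.rpow_def_of_pos hn',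
    one_div, ← Real.exp_neg]
  congr 2
  simp only [Complex.mul_re, Complex.neg_re, Complex.ofReal_re, Complex.ofReal_im, mul_zero, sub_zero]
  ring

lemma triv_bound (B : ℕ) : ∃ C σ0 : ℝ, 0 < C ∧ 0 < σ0 ∧ ∀ (q : ℕ) (χ : DirichletCharacter ℂ q) (s : ℂ) (σ : ℝ),
    0 < σ → σ ≤ σ0 → s.re = 1 + σ → ‖LSeries (logMul^[B] (chL χ)) s‖ ≤ C * (1 / σ) ^ (B+2) := by
  obtain ⟨η0, hη0, hZ⟩ := zeta_near_one
  refine ⟨(B+1).factorial * 2^(B+1) * 4, η0, by positivity, hη0, fun q χ s σ h0 h1 hs => ?_⟩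
  have hz := zeta_tsum (half_pos h0)
  apply LS_partial B _ s (chL_summable B χ s (by linarith))
  intro M
  have z2 := hZ (σ/2) (by positivity) (by linarith)
  calc ‖∑ n ∈ Ico 1 M, chL χ n * wt B s n‖ ≤ ∑ n ∈ Ico 1 M, ‖chL χ n * wt B s n‖ := norm_sum_le _ _
    _ ≤ ∑ n ∈ Ico 1 M, ((B+1).factorial * (2/σ)^(B+1)) * (1 / (n:ℝ) ^ (1 + σ/2)) := by
      apply sum_le_sum
      intro n hn
      rw [mem_Ico] at hn
      have hn' : (0:ℝ) < n := by exact_mod_cast hn.1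
      have hl : 0 ≤ Real.log n := Real.log_natCast_nonneg n
      rw [norm_mul, wt_norm_eq B s n hn.1, chL, norm_mul, Complex.norm_real, Real.norm_of_nonneg ArithmeticFunction.vonMangoldt_nonneg]
      have a1 : ‖χ n‖ * ArithmeticFunction.vonMangoldt n ≤ Real.log n := by
        have := ArithmeticFunction.vonMangoldt_le_log (n := n)
        have h2 := χ.norm_le_one n
        have h3 : 0 ≤ ArithmeticFunction.vonMangoldt n := ArithmeticFunction.vonMangoldt_nonneg
        nlinarith
      have a2 : Real.log n ^ (B+1) ≤ (B+1).factorial * (2/σ)^(B+1) * (n:ℝ)^(σ/2) := by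
        have := Real.pow_div_factorial_le_exp (σ/2 * Real.log n) (by positivity) (B+1)
        rw [div_le_iff₀ (by positivity), mul_pow] at this
        rw [Real.rpow_def_of_pos hn', mul_comm (Real.log n)]
        calc Real.log n ^ (B+1) = (2/σ)^(B+1) * ((σ/2)^(B+1) * Real.log n ^ (B+1)) := by
              rw [← mul_assoc, ← mul_pow]; field_simp; simp
          _ ≤ (2/σ)^(B+1) * (Real.exp (σ/2 * Real.log n) * (B+1).factorial) := by gcongr
          _ = _ := by ring
      calc ‖χ n‖ * ArithmeticFunction.vonMangoldt n * (Real.log n ^ B * (1 / (n:ℝ)^s.re))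
          ≤ Real.log n * (Real.log n ^ B * (1 / (n:ℝ)^s.re)) := by gcongr
        _ = Real.log n ^ (B+1) * (1 / (n:ℝ)^s.re) := by ring
        _ ≤ (B+1).factorial * (2/σ)^(B+1) * (n:ℝ)^(σ/2) * (1 / (n:ℝ)^s.re) := by gcongr
        _ = _ := by
          rw [hs, show 1 + σ = (1 + σ/2) + σ/2 by ring, Real.rpow_add hn']
          field_simp
    _ = ((B+1).factorial * (2/σ)^(B+1)) * ∑ n ∈ Ico 1 M, (1 / (n:ℝ) ^ (1 + σ/2)) := by rw [mul_sum]
    _ ≤ ((B+1).factorial * (2/σ)^(B+1)) * (2 / (σ/2)) := by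
      gcongr
      refine le_trans (hz.1.sum_le_tsum _ fun n _ => by positivity) ?_
      rw [hz.2]; exact z2
    _ = _ := by rw [div_pow, one_div, inv_pow, pow_succ σ (B+1)]; field_simp; norm_num

noncomputable def HB (B : ℕ) (u : ℝ) : ℂ := ((F u * Real.exp u * (u ^ B)⁻¹ : ℝ) : ℂ)

lemma HB_contDiff (B : ℕ) : ContDiff ℝ (⊤ : ℕ∞) (HB B) := by
  apply Complex.ofRealCLM.contDiff.comp (f := fun u : ℝ => F u * Real.exp u * (u ^ B)⁻¹)
  rw [contDiff_iff_contDiffAt]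
  intro u
  rcases eq_or_ne u 0 with rfl | hu
  · have : (fun u : ℝ => F u * Real.exp u * (u ^ B)⁻¹) =ᶠ[nhds 0] fun _ => 0 := by
      filter_upwards [gt_mem_nhds (show (0:ℝ) < 1 by norm_num)] with u hu
      have : F u = 0 := by
        by_contra h
        linarith [(F_supp h).1]
      simp [this]
    exact contDiffAt_const.congr_of_eventuallyEq this
  · exact (F_contDiff.contDiffAt.mul Real.contDiff_exp.contDiffAt).mul
      ((contDiffAt_id.pow B).inv (pow_ne_zero _ hu))

lemma HB_compact (B : ℕ) : HasCompactSupport (HB B) := by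
  apply F_compact.mono
  intro u hu
  rw [Function.mem_support] at hu ⊢
  intro h
  apply hu
  simp [HB, h]

lemma SS_eq (B : ℕ) : ∃ G : ℝ → ℂ, Integrable G ∧ (∀ k : ℕ, Integrable (fun t : ℝ => |t|^k * ‖G t‖)) ∧
    ∀ R : ℕ, 3 ≤ R → ∀ t : PChar, SS R t = ((1 / LL R : ℝ) : ℂ)^B *
      ∫ x : ℝ, LSeries (logMul^[B] (chL t.2)) (1 + (1 / LL R : ℝ) + Complex.I * (-(2 * Real.pi * x * (1 / LL R)) : ℝ)) * G x := by
  obtain ⟨G, hGc, hG, hGk, hrep⟩ := fourier_repr (HB B) (HB_compact B) (HB_contDiff B)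
  refine ⟨G, hG, hGk, fun R hR t => ?_⟩
  have hLL := LL_ge hR
  have hLp : 0 < LL R := by linarith
  set σ : ℝ := 1 / LL R with hσ
  have hσp : 0 < σ := by positivity
  set s : ℝ → ℂ := fun x => 1 + (σ:ℂ) + Complex.I * (-(2 * Real.pi * x * σ) : ℝ) with hs
  have hre : ∀ x, (s x).re = 1 + σ := by intro x; simp [hs]
  have hsc : Continuous s := by rw [hs]; fun_prop
  set T : ℕ → ℝ → ℂ := fun n x => LSeries.term (logMul^[B] (chL t.2)) (s x) n * G x with hT
  have hnorm : ∀ n x, ‖T n x‖ = ‖LSeries.term (logMul^[B] (chL t.2)) (s 0) n‖ * ‖G x‖ := by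
    intro n x
    rw [hT]
    simp only
    rw [norm_mul, LSeries.norm_term_eq, LSeries.norm_term_eq, hre, hre]
  have hTc : ∀ n, Continuous (fun x => LSeries.term (logMul^[B] (chL t.2)) (s x) n) := by
    intro n
    rcases eq_or_ne n 0 with rfl | hn
    · simp [continuous_const]
    simp_rw [term_logMul B _ _ n hn, wt]
    fun_prop
  have hTi : ∀ n, Integrable (T n) := by
    intro n
    refine (hG.norm.const_mul ‖LSeries.term (logMul^[B] (chL t.2)) (s 0) n‖).mono' ?_ ?_
    · exact ((hTc n).mul hGc).aestronglyMeasurable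
    · exact Filter.Eventually.of_forall fun x => (hnorm n x).le
  have hsum : Summable fun n => ∫ x, ‖T n x‖ := by
    simp_rw [hnorm, integral_const_mul]
    exact (chL_summable B t.2 (s 0) (by rw [hre]; linarith)).norm.mul_right _
  have key := hasSum_integral_of_summable_integral_norm hTi hsum
  have hintg : ∀ n, (σ:ℂ)^B * ∫ x, T n x = (ArithmeticFunction.vonMangoldt n : ℂ) * (ev t n * nu R n) := by
    intro n
    rcases eq_or_ne n 0 with rfl | hn
    · simp [hT]
    have hn' : (0:ℝ) < n := by exact_mod_cast Nat.pos_of_ne_zero hn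
    have hu : Real.log n / LL R = σ * Real.log n := by rw [hσ]; ring
    have e1 : ∀ x, T n x = (chL t.2 n * (Real.log n : ℂ)^B * Complex.exp (-(1 + σ : ℂ) * Real.log n)) *
        (Complex.exp (2 * Real.pi * x * (σ * Real.log n : ℝ) * Complex.I) * G x) := by
      intro x
      rw [hT]
      simp only
      rw [term_logMul B _ _ n hn, wt, hs]
      simp only
      have : Complex.exp (-(1 + (σ:ℂ) + Complex.I * (-(2 * Real.pi * x * σ) : ℝ)) * Real.log n) =
        Complex.exp (-(1 + σ : ℂ) * Real.log n) * Complex.exp (2 * Real.pi * x * (σ * Real.log n : ℝ) * Complex.I) := by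
        rw [← Complex.exp_add]; congr 1; push_cast; ring
      rw [this]; ring
    simp_rw [e1]
    rw [integral_const_mul, ← hrep]
    have e2 : Complex.exp (-(1 + σ : ℂ) * Real.log n) = ((Real.exp (-(σ * Real.log n)) / n : ℝ) : ℂ) := by
      rw [show (-(1 + σ : ℂ) * Real.log n) = ((-(σ * Real.log n) - Real.log n : ℝ) : ℂ) by push_cast; ring,
        ← Complex.ofReal_exp, Real.exp_sub, Real.exp_log hn']
    rw [e2, nu, hu, HB, chL, ev]
    by_cases hF : F (σ * Real.log n) = 0
    · simp [hF]
    have hpos : 0 < σ * Real.log n := by linarith [(F_supp hF).1]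
    have e3 : (σ:ℂ)^B * (Real.log n : ℂ)^B = (((σ * Real.log n) ^ B : ℝ) : ℂ) := by push_cast; ring
    have e4 : (((σ * Real.log n) ^ B : ℝ) : ℂ) * ((Real.exp (-(σ * Real.log n)) / n : ℝ) : ℂ) *
      ((F (σ * Real.log n) * Real.exp (σ * Real.log n) * ((σ * Real.log n) ^ B)⁻¹ : ℝ) : ℂ) =
      ((F (σ * Real.log n) / n : ℝ) : ℂ) := by
      rw [← Complex.ofReal_mul, ← Complex.ofReal_mul]
      congr 1
      rw [Real.exp_neg]
      have := Real.exp_pos (σ * Real.log n)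
      generalize σ * Real.log n = u at *
      field_simp
    rw [← e4, ← e3]
    ring
  have e5 : ∀ x, ∑' n, T n x = LSeries (logMul^[B] (chL t.2)) (s x) * G x := by
    intro x
    rw [hT]; simp only
    rw [tsum_mul_right]; rfl
  simp_rw [e5] at key
  have key2 := key.mul_left ((σ:ℂ)^B)
  simp_rw [hintg] at key2
  rw [← key2.tsum_eq, SS]
  symm
  apply tsum_eq_sum
  intro n hn
  rw [mem_range, not_lt] at hn
  rw [nu_eq_zero hR (Or.inr hn)]
  simp

lemma small_cond (B : ℕ) : ∃ C : ℝ, ∃ R0 : ℕ, 0 < C ∧ 3 ≤ R0 ∧ ∀ R : ℕ, R0 ≤ R → ∀ t : PChar, 1 ≤ t.1 → t.2 ≠ 1 →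
    ∀ 𝓛 : ℝ, 1 + Real.log t.1 ≤ 𝓛 →
    (∀ τ : ℝ, |τ| ≤ 1 → 1 / 𝓛^11 ≤ ‖LSeries (fun n => t.2 n) (1 + (1 / LL R : ℝ) + Complex.I * τ)‖) →
    ‖SS R t‖ ≤ C * 𝓛 ^ (13 * (B+1)) / Real.log R ^ B := by
  obtain ⟨G, hG, hGk, hSS⟩ := SS_eq B
  obtain ⟨D, hD, hgood⟩ := good_bound (B+1)
  obtain ⟨C, σ0, hC, hσ0, htriv⟩ := triv_bound B
  have hI0 : 0 ≤ ∫ x, ‖G x‖ := integral_nonneg fun x => norm_nonneg _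
  have hI1 : 0 ≤ ∫ x, |x|^(B+2) * ‖G x‖ := integral_nonneg fun x => by positivity
  have hR0 : ∃ R0 : ℕ, 3 ≤ R0 ∧ ∀ R : ℕ, R0 ≤ R → 1 / σ0 ≤ LL R := by
    have : Filter.Tendsto (fun R : ℕ => LL R) Filter.atTop Filter.atTop :=
      (Real.tendsto_log_atTop.comp tendsto_natCast_atTop_atTop).const_mul_atTop (by norm_num)
    obtain ⟨R0, h⟩ := Filter.eventually_atTop.1 (this.eventually_ge_atTop (1/σ0))
    exact ⟨max 3 R0, le_max_left _ _, fun R hR => h R ((le_max_right _ _).trans hR)⟩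
  obtain ⟨R0, hR03, hR0⟩ := hR0
  set K := D * (∫ x, ‖G x‖) + C * (2 * Real.pi)^(B+2) * ∫ x, |x|^(B+2) * ‖G x‖ with hK
  have hK0 : 0 ≤ K := by positivity
  refine ⟨K + 1, R0, by linarith, hR03, fun R hR t ht1 htne 𝓛 hL hg => ?_⟩
  have : NeZero t.1 := ⟨by omega⟩
  have hR3 : 3 ≤ R := hR03.trans hR
  have hLL := LL_ge hR3
  have hlog := one_le_log hR3
  have hL1 : 1 ≤ 𝓛 := by linarith [Real.log_natCast_nonneg t.1]
  have hLpow : 1 ≤ 𝓛 ^ (13 * (B+1)) := one_le_pow₀ hL1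
  set σ : ℝ := 1 / LL R with hσ
  have hσp : 0 < σ := by positivity
  have hσ1 : σ ≤ 1 := by rw [hσ, div_le_one (by linarith)]; linarith
  have hσσ : σ ≤ σ0 := by
    have := hR0 R hR
    rw [hσ, div_le_iff₀ (by linarith)]
    rw [div_le_iff₀ hσ0] at this; linarith
  have hpt : ∀ x : ℝ, ‖LSeries (logMul^[B] (chL t.2)) (1 + (σ:ℂ) + Complex.I * (-(2 * Real.pi * x * σ) : ℝ)) * G x‖ ≤
      D * 𝓛 ^ (13 * (B+1)) * ‖G x‖ + C * (2 * Real.pi)^(B+2) * (|x|^(B+2) * ‖G x‖) := by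
    intro x
    rw [norm_mul, ← mul_assoc, ← add_mul]
    apply mul_le_mul_of_nonneg_right _ (norm_nonneg _)
    have habs : |-(2 * Real.pi * x * σ)| = 2 * Real.pi * |x| * σ := by
      rw [abs_neg, abs_mul, abs_mul, abs_of_pos hσp, abs_of_pos (by positivity : 0 < 2 * Real.pi)]
    rcases le_total |-(2 * Real.pi * x * σ)| 1 with h | h
    · have := hgood B (by omega) t.1 t.2 htne 𝓛 hL (1 + (σ:ℂ) + Complex.I * (-(2 * Real.pi * x * σ) : ℝ))
        (by simp [hσp]) (s_norm hσp.le hσ1 (by linarith)) (hg _ h)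
      have : 0 ≤ C * (2 * Real.pi)^(B+2) * |x|^(B+2) := by positivity
      linarith
    · have h2 := htriv t.1 t.2 (1 + (σ:ℂ) + Complex.I * (-(2 * Real.pi * x * σ) : ℝ)) σ hσp hσσ (by simp)
      have h3 : C * (1/σ)^(B+2) ≤ C * (2 * Real.pi)^(B+2) * |x|^(B+2) := by
        rw [mul_assoc, ← mul_pow]
        gcongr
        rw [div_le_iff₀ hσp, ← habs]; exact h
      have : 0 ≤ D * 𝓛 ^ (13 * (B+1)) := by positivity
      linarith
  rw [hSS R hR3 t, norm_mul, norm_pow, Complex.norm_real, Real.norm_of_nonneg hσp.le]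
  have hintg : ‖∫ x : ℝ, LSeries (logMul^[B] (chL t.2)) (1 + (σ:ℂ) + Complex.I * (-(2 * Real.pi * x * σ) : ℝ)) * G x‖ ≤
     K * 𝓛 ^ (13 * (B+1)) := by
    refine (norm_integral_le_of_norm_le (g := fun x => D * 𝓛 ^ (13 * (B+1)) * ‖G x‖ + C * (2 * Real.pi)^(B+2) * (|x|^(B+2) * ‖G x‖)) ?_ (Filter.Eventually.of_forall hpt)).trans ?_
    · exact (hG.norm.const_mul _).add ((hGk (B+2)).const_mul _)
    · rw [integral_add (hG.norm.const_mul _) ((hGk (B+2)).const_mul _), integral_const_mul, integral_const_mul, hK, add_mul]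
      have : C * (2 * Real.pi)^(B+2) * (∫ x, |x|^(B+2) * ‖G x‖) * 1 ≤ C * (2 * Real.pi)^(B+2) * (∫ x, |x|^(B+2) * ‖G x‖) * 𝓛 ^ (13 * (B+1)) := by
        gcongr
      linarith
  calc σ ^ B * _ ≤ (1 / Real.log R)^B * (K * 𝓛 ^ (13 * (B+1))) := by
        apply mul_le_mul _ hintg (norm_nonneg _) (by positivity)
        apply pow_le_pow_left₀ hσp.le
        rw [hσ]
        apply one_div_le_one_div_of_le (by linarith)
        rw [LL]; linarith
    _ ≤ (1 / Real.log R)^B * ((K+1) * 𝓛 ^ (13 * (B+1))) := by gcongr; linarith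
    _ = _ := by rw [div_pow, one_pow]; ring
end DSR
namespace DSR
open Finset MeasureTheory

lemma low_cond (D : ℕ) : ∃ ε : ℝ, 0 < ε ∧ ∀ t ∈ primChars D, t.1 ≠ 1 → ∀ σ τ : ℝ, 0 < σ → σ ≤ 1 → |τ| ≤ 1 →
    ε ≤ ‖LSeries (fun n => t.2 n) (1 + σ + Complex.I * τ)‖ := by
  have h1 : ∀ t : PChar, t ∈ primChars D → t.1 ≠ 1 → ∃ ε : ℝ, 0 < ε ∧ ∀ σ τ : ℝ, 0 < σ → σ ≤ 1 → |τ| ≤ 1 →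
    ε ≤ ‖LSeries (fun n => t.2 n) (1 + σ + Complex.I * τ)‖ := by
    intro t ht h1
    rw [mem_primChars] at ht
    have : NeZero t.1 := ⟨by omega⟩
    have hne := prim_ne_one ht.2 h1 ht.1.1
    have hcomp : IsCompact (Set.Icc (0:ℝ) 1 ×ˢ Set.Icc (-1:ℝ) 1) := isCompact_Icc.prod isCompact_Icc
    have hcont : Continuous (fun x : ℝ × ℝ => ‖DirichletCharacter.LFunction t.2 (1 + x.1 + Complex.I * x.2)‖) := by
      have := (DirichletCharacter.differentiable_LFunction hne).continuous
      fun_prop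
    obtain ⟨x, hx, hmin⟩ := hcomp.exists_isMinOn ⟨(0,0), by simp⟩ hcont.continuousOn
    refine ⟨_, norm_pos_iff.2 (DirichletCharacter.LFunction_ne_zero_of_one_le_re t.2 (s := 1 + x.1 + Complex.I * x.2) (Or.inl hne) ?_), fun σ τ h0 h1 h2 => ?_⟩
    · simp; exact hx.1.1
    · have := hmin (show (σ, τ) ∈ _ from ⟨⟨h0.le, h1⟩, abs_le.1 h2⟩)
      simp only at this
      have e : DirichletCharacter.LFunction t.2 (1 + σ + Complex.I * τ) = LSeries (fun n => t.2 n) (1 + σ + Complex.I * τ) :=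
        DirichletCharacter.LFunction_eq_LSeries t.2 (by simp [h0])
      rw [← e]
      exact this
  classical
  choose! ε hε h using h1
  have h2 : ∀ s : Finset PChar, s ⊆ primChars D → ∃ e : ℝ, 0 < e ∧ ∀ t ∈ s, t.1 ≠ 1 → e ≤ ε t := by
    intro s
    induction s using Finset.induction_on with
    | empty => intro _; exact ⟨1, one_pos, by simp⟩
    | insert a s ha ih =>
      intro hs
      obtain ⟨e, he, h3⟩ := ih ((subset_insert _ _).trans hs)
      have hac := hs (mem_insert_self a s)
      by_cases ha1 : a.1 = 1
      · refine ⟨e, he, fun t ht h1 => ?_⟩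
        rcases mem_insert.1 ht with rfl | ht
        · exact absurd ha1 h1
        · exact h3 t ht h1
      · refine ⟨min e (ε a), lt_min he (hε a hac ha1), fun t ht h1 => ?_⟩
        rcases mem_insert.1 ht with rfl | ht
        · exact min_le_right _ _
        · exact (min_le_left _ _).trans (h3 t ht h1)
  obtain ⟨e, he, h3⟩ := h2 _ (subset_refl _)
  exact ⟨e, he, fun t ht h1 σ τ h4 h5 h6 => (h3 t ht h1).trans (h t ht h1 σ τ h4 h5 h6)⟩

lemma log_tendsto : Filter.Tendsto (fun R : ℕ => Real.log R) Filter.atTop Filter.atTop :=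
  Real.tendsto_log_atTop.comp tendsto_natCast_atTop_atTop

lemma loglog_small (A k : ℕ) (c : ℝ) (hc : 0 < c) : ∀ᶠ x : ℝ in Filter.atTop, (1 + A * Real.log x) ^ k ≤ c * x := by
  have h := (Real.isLittleO_pow_log_id_atTop (n := k)).def (c := c / (1 + A)^k) (by positivity)
  filter_upwards [h, Filter.eventually_ge_atTop (Real.exp 1)] with x hx hx1
  have hx0 : 0 < x := (Real.exp_pos 1).trans_le hx1
  have hl : 1 ≤ Real.log x := by
    rw [Real.le_log_iff_exp_le hx0]; exact hx1
  simp only [id, Real.norm_eq_abs] at hx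
  rw [abs_of_pos hx0, abs_of_nonneg (by positivity)] at hx
  calc (1 + A * Real.log x)^k ≤ ((1 + A) * Real.log x)^k := by
        gcongr
        nlinarith
    _ = (1+A)^k * Real.log x ^ k := by rw [mul_pow]
    _ ≤ (1+A)^k * (c / (1 + A)^k * x) := by gcongr
    _ = c * x := by field_simp

lemma alg1 {x : ℝ} (hx0 : 0 < x) {A B C : ℕ} (hB : B = 2 * A + C + 2) : (x^A)^2 * (x / x^B) = 1 / x^(C+1) := by
  have e : x^B = (x^A)^2 * x * x^(C+1) := by rw [hB]; ring
  rw [e]; field_simp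

lemma alg2 {x c : ℝ} (hx0 : 0 < x) {C : ℕ} : 1 / x^(C+4) * (c * x^3) = c / x^(C+1) := by
  rw [show x^(C+4) = x^3 * x^(C+1) by ring]; field_simp

set_option maxHeartbeats 1000000 in
lemma bv_Lam (C D : ℕ) : ∀ᶠ R : ℕ in Filter.atTop, ∃ qs : ℕ, D < qs ∧
    ∑ t ∈ primChars (R^3) with t.1 ≠ 1 ∧ t.1 ≠ qs, 1 / √(t.1:ℝ) * ‖SS R t‖ ≤ 1 / Real.log R ^ C := by
  obtain ⟨C1, hC1, hlarge⟩ := large_cond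
  obtain ⟨A, hA⟩ : ∃ A : ℕ, A = 2 * (C + 4) := ⟨_, rfl⟩
  obtain ⟨B, hB⟩ : ∃ B : ℕ, B = 2 * A + C + 2 := ⟨_, rfl⟩
  obtain ⟨C2, R0, hC2, hR03, hsmall⟩ := small_cond B
  obtain ⟨ε, hε, hlow⟩ := low_cond D
  obtain ⟨L0, hL0, hone⟩ := one_bad
  have hA1 : (1:ℝ) ≤ A := by exact_mod_cast (by omega)
  have ev1 := log_tendsto.eventually (loglog_small A (13*(B+1)) (1/C2) (by positivity))
  have ev2 := log_tendsto.eventually (loglog_small A 11 1 (by positivity))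
  have ev3 : ∀ᶠ R : ℕ in Filter.atTop, L0 + 1/ε + 1 ≤ Real.log (Real.log R) :=
    (Real.tendsto_log_atTop.comp log_tendsto).eventually_ge_atTop _
  filter_upwards [ev1, ev2, ev3, log_tendsto.eventually_ge_atTop (C1 + 1), Filter.eventually_ge_atTop R0]
    with R h1 h2 h3 h4 hR
  have hR3 : 3 ≤ R := hR03.trans hR
  have hlog := one_le_log hR3
  set x := Real.log R with hx
  have hx0 : 0 < x := by linarith
  set 𝓛 : ℝ := 1 + A * Real.log x with hL
  have hε' : 0 < 1 / ε := by positivity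
  have hLge : 1 + L0 + 1/ε ≤ 𝓛 := by rw [hL]; nlinarith
  have hL1 : 1 ≤ 𝓛 := by linarith
  have hLL := LL_ge hR3
  have hσp : 0 < 1 / LL R := by positivity
  have hσ11 : 1 / LL R ≤ 1 / 𝓛^11 := by
    apply one_div_le_one_div_of_le (by positivity)
    rw [LL, ← hx]; linarith
  have hσ1 : 1 / LL R ≤ 1 := by rw [div_le_one (by linarith)]; linarith
  have hLε : 1 / 𝓛^11 < ε := by
    have : 1 / 𝓛^11 ≤ 1 / 𝓛 := one_div_le_one_div_of_le (by linarith) (le_self_pow₀ hL1 (by norm_num))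
    have h5 : 1 / 𝓛 < ε := by
      rw [div_lt_iff₀ (by linarith)]
      have : 1 / ε < 𝓛 := by linarith
      rw [div_lt_iff₀ hε] at this; linarith
    linarith
  have hQ0 : ∀ t : PChar, 1 ≤ t.1 → (t.1:ℝ) ≤ x^A → 1 + Real.log t.1 ≤ 𝓛 := by
    intro t ht1 ht
    have := Real.log_le_log (by exact_mod_cast ht1) ht
    rw [Real.log_pow] at this
    linarith
  -- the exceptional modulus
  have hex : ∃ qs : ℕ, D < qs ∧ ∀ t : PChar, t.2.IsPrimitive → 1 < t.1 → (t.1:ℝ) ≤ x^A → t.1 ≠ qs →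
      ∀ τ : ℝ, |τ| ≤ 1 → 1 / 𝓛^11 ≤ ‖LSeries (fun n => t.2 n) (1 + (1 / LL R : ℝ) + Complex.I * τ)‖ := by
    by_cases hb : ∃ t : PChar, t.2.IsPrimitive ∧ 1 < t.1 ∧ (t.1:ℝ) ≤ x^A ∧ ∃ τ : ℝ, |τ| ≤ 1 ∧
        ‖LSeries (fun n => t.2 n) (1 + (1 / LL R : ℝ) + Complex.I * τ)‖ < 1 / 𝓛^11
    · obtain ⟨t0, p0, q0, l0, τ0, hτ0, hb0⟩ := hb
      refine ⟨t0.1, ?_, fun t pt qt lt hne τ hτ => ?_⟩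
      · by_contra! hD
        have := hlow t0 (mem_primChars.2 ⟨⟨by omega, hD⟩, p0⟩) (by omega) (1/LL R) τ0 hσp hσ1 hτ0
        linarith
      · exact hone 𝓛 (by linarith) t0 t p0 pt q0 qt (hQ0 t0 (by omega) l0) (hQ0 t (by omega) lt)
          (fun h => hne (by rw [h])) (1/LL R) τ0 τ hσp hσ11 hτ0 hτ hb0
    · push Not at hb
      exact ⟨D+1, by omega, fun t pt qt lt _ τ hτ => hb t pt qt lt τ hτ⟩
  obtain ⟨qs, hqs, hgood⟩ := hex
  refine ⟨qs, hqs, ?_⟩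
  have hxC : 0 < x^(C+1) := by positivity
  rw [← sum_filter_add_sum_filter_not _ (fun t : PChar => (t.1:ℝ) ≤ x^A)]
  have b1 : ∑ t ∈ {t ∈ primChars (R^3) | t.1 ≠ 1 ∧ t.1 ≠ qs} with (t.1:ℝ) ≤ x^A, 1 / √(t.1:ℝ) * ‖SS R t‖ ≤ 1 / x^(C+1) := by
    calc _ ≤ ∑ t ∈ {t ∈ primChars (R^3) | t.1 ≠ 1 ∧ t.1 ≠ qs} with (t.1:ℝ) ≤ x^A, x / x^B := by
          apply sum_le_sum
          intro t ht
          rw [mem_filter, mem_filter, mem_primChars] at ht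
          obtain ⟨⟨⟨⟨ht1, _⟩, hp⟩, hn1, hnq⟩, hle⟩ := ht
          have hs := hsmall R hR t ht1 (prim_ne_one hp hn1 ht1) 𝓛 (hQ0 t ht1 hle)
            (hgood t hp (by omega) hle hnq)
          have hs2 : ‖SS R t‖ ≤ x / x^B := by
            refine hs.trans ?_
            apply div_le_div_of_nonneg_right _ (by positivity)
            rw [one_div, inv_mul_eq_div, le_div_iff₀ hC2] at h1
            linarith
          have : 1 / √(t.1:ℝ) ≤ 1 := by
            rw [div_le_one (by positivity)]
            exact Real.one_le_sqrt.2 (by exact_mod_cast ht1)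
          calc 1 / √(t.1:ℝ) * ‖SS R t‖ ≤ 1 * (x / x^B) := by gcongr
            _ = _ := one_mul _
      _ ≤ ((⌊x^A⌋₊ ^ 2 : ℕ) : ℝ) * (x / x^B) := by
          rw [sum_const, nsmul_eq_mul]
          apply mul_le_mul_of_nonneg_right _ (by positivity)
          have : ({t ∈ {t ∈ primChars (R^3) | t.1 ≠ 1 ∧ t.1 ≠ qs} | (t.1:ℝ) ≤ x^A}) ⊆ primChars ⌊x^A⌋₊ := by
            intro t ht
            rw [mem_filter, mem_filter, mem_primChars] at ht
            rw [mem_primChars]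
            exact ⟨⟨ht.1.1.1.1, Nat.le_floor ht.2⟩, ht.1.1.2⟩
          exact_mod_cast (card_le_card this).trans (card_primChars_le _)
      _ ≤ (x^A)^2 * (x / x^B) := by
          push_cast
          gcongr
          exact Nat.floor_le (by positivity)
      _ = 1 / x^(C+1) := by
          exact alg1 hx0 hB
  have b2 : ∑ t ∈ {t ∈ primChars (R^3) | t.1 ≠ 1 ∧ t.1 ≠ qs} with ¬ (t.1:ℝ) ≤ x^A, 1 / √(t.1:ℝ) * ‖SS R t‖ ≤ C1 / x^(C+1) := by
    calc _ ≤ ∑ t ∈ {t ∈ primChars (R^3) | t.1 ≠ 1 ∧ t.1 ≠ qs} with ¬ (t.1:ℝ) ≤ x^A, 1 / x^(C+4) * ‖SS R t‖ := by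
          apply sum_le_sum
          intro t ht
          rw [mem_filter, not_le] at ht
          apply mul_le_mul_of_nonneg_right _ (norm_nonneg _)
          apply one_div_le_one_div_of_le (by positivity)
          apply Real.le_sqrt_of_sq_le
          rw [← pow_mul, mul_comm _ 2, ← hA]; exact ht.2.le
      _ ≤ ∑ t ∈ primChars (R^3) with t.1 ≠ 1, 1 / x^(C+4) * ‖SS R t‖ := by
          apply sum_le_sum_of_subset_of_nonneg
          · intro t ht
            rw [mem_filter, mem_filter] at ht
            rw [mem_filter]; exact ⟨ht.1.1, ht.1.2.1⟩
          · intros; positivity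
      _ ≤ 1 / x^(C+4) * (C1 * x^3) := by
          rw [← mul_sum]
          gcongr
          exact hlarge R hR3
      _ = C1 / x^(C+1) := by
          exact alg2 hx0
  calc _ ≤ 1 / x^(C+1) + C1 / x^(C+1) := add_le_add b1 b2
    _ = (C1 + 1) / (x * x^C) := by rw [pow_succ']; ring
    _ ≤ x / (x * x^C) := by gcongr
    _ = 1 / x^C := by field_simp

/-- primes weighted by log -/
noncomputable def vp (n : ℕ) : ℝ := if n.Prime then Real.log n else 0

noncomputable def SP (R : ℕ) (t : PChar) : ℂ := ∑ n ∈ range (R^240), (vp n : ℂ) * (ev t n * (nu R n : ℂ))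

lemma vp_le (n : ℕ) : vp n ≤ ArithmeticFunction.vonMangoldt n := by
  unfold vp
  split_ifs with h
  · rw [ArithmeticFunction.vonMangoldt_apply_prime h]
  · exact ArithmeticFunction.vonMangoldt_nonneg

lemma vp_nonneg (n : ℕ) : 0 ≤ vp n := by
  unfold vp; split_ifs
  · exact Real.log_natCast_nonneg n
  · rfl

lemma pp_sum (N : ℕ) (hN : 1 ≤ N) : ∑ n ∈ range N, (ArithmeticFunction.vonMangoldt n - vp n) ≤ 2 * √(N:ℝ) * Real.log N := by
  have h := Chebyshev.abs_psi_sub_theta_le_sqrt_mul_log (x := (N:ℝ)) (by exact_mod_cast hN)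
  refine le_trans ?_ ((le_abs_self _).trans h)
  rw [Chebyshev.psi_eq_sum_Icc, Chebyshev.theta_eq_sum_Icc, sum_filter, ← sum_sub_distrib, Nat.floor_natCast]
  apply sum_le_sum_of_subset_of_nonneg
  · intro n hn; simp at hn ⊢; omega
  · intro n _ _
    exact sub_nonneg.2 (vp_le n)

lemma sum_dyadic_real (f : ℕ → ℝ) (h0 : f 0 = 0) (J : ℕ) :
    ∑ n ∈ range (2^J), f n = ∑ j ∈ range J, ∑ n ∈ Ico (2^j) (2^(j+1)), f n := by
  induction J with
  | zero => simp [h0]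
  | succ J ih =>
    rw [sum_range_succ (fun j => ∑ n ∈ Ico (2^j) (2^(j+1)), f n), ← ih,
      sum_range_add_sum_Ico _ (Nat.pow_le_pow_right (by norm_num) (by omega))]

lemma pp_nu : ∃ C : ℝ, 0 < C ∧ ∀ R : ℕ, 3 ≤ R →
    ∑ n ∈ range (R^240), (ArithmeticFunction.vonMangoldt n - vp n) * nu R n ≤ C / (R:ℝ)^58 := by
  refine ⟨4 * 481^2, by norm_num, fun R hR => ?_⟩
  have hR0 : (0:ℝ) < R := by exact_mod_cast (by omega)
  have hlog := one_le_log hR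
  have hlt : R^240 ≤ 2^(JJ R) := (Nat.lt_pow_succ_log_self (by norm_num) _).le
  have hnn : ∀ n, 0 ≤ (ArithmeticFunction.vonMangoldt n - vp n) * nu R n := fun n =>
    mul_nonneg (sub_nonneg.2 (vp_le n)) (nu_nonneg R n)
  calc _ ≤ ∑ n ∈ range (2^(JJ R)), (ArithmeticFunction.vonMangoldt n - vp n) * nu R n := by
        apply sum_le_sum_of_subset_of_nonneg
        · intro n hn; rw [mem_range] at *; omega
        · intros; exact hnn _
    _ = ∑ j ∈ range (JJ R), ∑ n ∈ Ico (2^j) (2^(j+1)), (ArithmeticFunction.vonMangoldt n - vp n) * nu R n := by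
        apply sum_dyadic_real; simp [vp]
    _ ≤ ∑ j ∈ range (JJ R), 4 * JJ R / (R:ℝ)^60 := by
        apply sum_le_sum
        intro j hj
        rw [mem_range] at hj
        rcases le_or_gt (2^(j+1)) (R^120) with h | h
        · rw [sum_eq_zero]
          · positivity
          · intro n hn
            rw [mem_Ico] at hn
            rw [nu_eq_zero hR (Or.inl (by omega)), mul_zero]
        · set N := 2^(j+1) with hN
          have hN0 : (0:ℝ) < N := by rw [hN]; positivity
          have hNr : ((R:ℝ)^60)^2 ≤ N := by rw [← pow_mul]; exact_mod_cast h.le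
          have hsq : (R:ℝ)^60 ≤ √(N:ℝ) := Real.le_sqrt_of_sq_le hNr
          have hlN : Real.log N ≤ JJ R := by
            rw [hN]; push_cast; rw [Real.log_pow]
            have : ((j+1:ℕ):ℝ) ≤ JJ R := by exact_mod_cast hj
            have h2 := Real.log_two_lt_d9
            have h3 := Real.log_two_gt_d9
            have h4 : (0:ℝ) ≤ ((j+1:ℕ):ℝ) := by positivity
            nlinarith
          calc _ ≤ ∑ n ∈ Ico (2^j) N, (ArithmeticFunction.vonMangoldt n - vp n) * (2 / N) := by
                apply sum_le_sum
                intro n hn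
                rw [mem_Ico] at hn
                apply mul_le_mul_of_nonneg_left _ (sub_nonneg.2 (vp_le n))
                refine (nu_le R n).trans ?_
                have : (0:ℝ) < n := by exact_mod_cast (lt_of_lt_of_le (by positivity) hn.1)
                rw [div_le_div_iff₀ this hN0, one_mul, hN]
                have h2 : ((2^j:ℕ):ℝ) ≤ n := by exact_mod_cast hn.1
                push_cast at h2 ⊢
                rw [pow_succ]; linarith
            _ ≤ ∑ n ∈ range N, (ArithmeticFunction.vonMangoldt n - vp n) * (2 / N) := by
                apply sum_le_sum_of_subset_of_nonneg
                · intro n hn; simp at hn ⊢; omega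
                · intro n _ _
                  exact mul_nonneg (sub_nonneg.2 (vp_le n)) (by positivity)
            _ ≤ (2 * √(N:ℝ) * Real.log N) * (2 / N) := by
                rw [← sum_mul]
                apply mul_le_mul_of_nonneg_right (pp_sum N (by rw [hN]; exact Nat.one_le_two_pow)) (by positivity)
            _ = 4 * Real.log N / √(N:ℝ) := by
                have := Real.mul_self_sqrt hN0.le
                have h2 : 0 < √(N:ℝ) := Real.sqrt_pos.2 hN0
                nth_rewrite 3 [← this]
                field_simp; ring
            _ ≤ 4 * JJ R / (R:ℝ)^60 := by gcongr
    _ = 4 * (JJ R:ℝ)^2 / (R:ℝ)^60 := by rw [sum_const, card_range, nsmul_eq_mul]; ring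
    _ ≤ 4 * (481 * R)^2 / (R:ℝ)^60 := by
        have := JJ_le hR
        have h2 : Real.log R ≤ R := (Real.log_le_sub_one_of_pos hR0).trans (by linarith)
        gcongr; linarith
    _ = _ := by field_simp

lemma bv_chars (C D : ℕ) : ∀ᶠ R : ℕ in Filter.atTop, ∃ qs : ℕ, D < qs ∧
    ∑ t ∈ primChars (R^3) with t.1 ≠ 1 ∧ t.1 ≠ qs, 1 / √(t.1:ℝ) * ‖SP R t‖ ≤ 1 / Real.log R ^ C := by
  obtain ⟨C1, hC1, hpp⟩ := pp_nu
  have hsm := (Real.isLittleO_pow_log_id_atTop (n := C+1)).def (c := 1) (by positivity)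
  filter_upwards [bv_Lam (C+1) D, log_tendsto.eventually_ge_atTop (C1 + 1), Filter.eventually_ge_atTop 3,
    tendsto_natCast_atTop_atTop.eventually hsm]
    with R ⟨qs, hqs, h⟩ hl hR hsm
  refine ⟨qs, hqs, ?_⟩
  have hR0 : (0:ℝ) < R := by exact_mod_cast (by omega)
  have hR1 : (1:ℝ) ≤ R := by exact_mod_cast (by omega)
  have hlog := one_le_log hR
  set x := Real.log R with hx
  simp only [id, Real.norm_eq_abs] at hsm
  rw [abs_of_pos hR0, abs_of_nonneg (by positivity), one_mul] at hsm
  have hd : ∀ t : PChar, ‖SP R t‖ ≤ ‖SS R t‖ + C1 / (R:ℝ)^58 := by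
    intro t
    have : ‖SS R t - SP R t‖ ≤ C1 / (R:ℝ)^58 := by
      rw [SS, SP, ← sum_sub_distrib]
      refine (norm_sum_le _ _).trans (le_trans (sum_le_sum fun n _ => ?_) (hpp R hR))
      rw [← sub_mul, ← Complex.ofReal_sub, norm_mul, norm_mul, Complex.norm_real, Complex.norm_real,
        Real.norm_of_nonneg (nu_nonneg R n), Real.norm_of_nonneg (sub_nonneg.2 (vp_le n))]
      apply mul_le_mul_of_nonneg_left _ (sub_nonneg.2 (vp_le n))
      exact mul_le_of_le_one_left (nu_nonneg R n) (ev_norm_le t n)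
    have h2 := norm_sub_norm_le (SP R t) (SS R t)
    rw [norm_sub_rev] at h2
    linarith
  have key : ∑ t ∈ primChars (R^3) with t.1 ≠ 1 ∧ t.1 ≠ qs, 1 / √(t.1:ℝ) * ‖SP R t‖ ≤
      1 / x^(C+1) + C1 / x^(C+1) := by
    calc _ ≤ ∑ t ∈ primChars (R^3) with t.1 ≠ 1 ∧ t.1 ≠ qs, (1 / √(t.1:ℝ) * ‖SS R t‖ + C1 / (R:ℝ)^58) := by
          apply sum_le_sum
          intro t ht
          rw [mem_filter, mem_primChars] at ht
          have h1 : 1 / √(t.1:ℝ) ≤ 1 := by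
            have : 1 ≤ √(t.1:ℝ) := Real.one_le_sqrt.2 (by exact_mod_cast ht.1.1.1)
            rw [div_le_one (by positivity)]
            exact this
          have h0 : 0 ≤ 1 / √(t.1:ℝ) := by positivity
          have h2 := mul_le_mul_of_nonneg_left (hd t) h0
          have h3 : 0 ≤ C1 / (R:ℝ)^58 := by positivity
          nlinarith
      _ ≤ 1 / x^(C+1) + (R:ℝ)^6 * (C1 / (R:ℝ)^58) := by
          rw [sum_add_distrib, sum_const, nsmul_eq_mul]
          apply add_le_add h
          apply mul_le_mul_of_nonneg_right _ (by positivity)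
          have := (card_filter_le (primChars (R^3)) (fun t => t.1 ≠ 1 ∧ t.1 ≠ qs)).trans (card_primChars_le (R^3))
          rw [← pow_mul] at this
          exact_mod_cast this
      _ ≤ _ := by
          gcongr
          calc (R:ℝ)^6 * (C1 / (R:ℝ)^58) = C1 / (R:ℝ)^52 := by field_simp
            _ ≤ C1 / x^(C+1) := by
              gcongr
              exact hsm.trans (le_self_pow₀ hR1 (by norm_num))
  refine key.trans ?_
  calc 1 / x^(C+1) + C1 / x^(C+1) = (C1 + 1) / (x * x^C) := by rw [pow_succ']; ring
    _ ≤ x / (x * x^C) := by gcongr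
    _ = 1 / x^C := by field_simp
end DSR
namespace DSR
open Finset

def NN (T : Finset ℕ) : ℕ := ∏ p ∈ T, p

noncomputable def GG (S : Finset ℕ) (u : ℕ) (a : ℕ → ℝ) : ℝ :=
  ∑ T ∈ S.powerset with NN T ≤ u, ∏ p ∈ T, a p

lemma NN_le_of_subset {A T : Finset ℕ} (hT : ∀ p ∈ T, 1 ≤ p) (h : A ⊆ T) : NN A ≤ NN T :=
  Finset.prod_le_prod_of_subset_of_one_le' h (fun p hp _ => hT p hp)

/-- transport along an injection -/
lemma sum_le_sum_inj {α β : Type*} [DecidableEq β] (s : Finset α) (t : Finset β) (i : α → β) (f : α → ℝ) (g : β → ℝ)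
    (hi : ∀ a ∈ s, i a ∈ t) (hinj : ∀ a ∈ s, ∀ b ∈ s, i a = i b → a = b) (hfg : ∀ a ∈ s, f a ≤ g (i a))
    (hg : ∀ b ∈ t, 0 ≤ g b) : ∑ a ∈ s, f a ≤ ∑ b ∈ t, g b := by
  calc ∑ a ∈ s, f a ≤ ∑ a ∈ s, g (i a) := sum_le_sum hfg
    _ = ∑ b ∈ s.image i, g b := by
      rw [sum_image]; exact fun a ha b hb h => hinj a ha b hb h
    _ ≤ _ := by
      apply sum_le_sum_of_subset_of_nonneg
      · intro b hb
        obtain ⟨a, ha, rfl⟩ := mem_image.1 hb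
        exact hi a ha
      · intro b hb _; exact hg b hb

lemma GG_add_le {S : Finset ℕ} (hS : ∀ p ∈ S, 1 ≤ p) (u : ℕ) (a b : ℕ → ℝ) (ha : ∀ p ∈ S, 0 ≤ a p)
    (hb : ∀ p ∈ S, 0 ≤ b p) : GG S u (fun p => a p + b p) ≤ GG S u a * GG S u b := by
  unfold GG
  rw [sum_mul_sum, ← sum_product']
  simp_rw [prod_add]
  rw [sum_sigma']
  apply sum_le_sum_inj _ _ (fun x : (_ : Finset ℕ) × Finset ℕ => (x.2, x.1 \ x.2))
  · rintro ⟨T, A⟩ h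
    simp only [mem_sigma, mem_filter, mem_powerset] at h
    obtain ⟨⟨hT, hu⟩, hA⟩ := h
    simp only [mem_product, mem_filter, mem_powerset]
    exact ⟨⟨hA.trans hT, (NN_le_of_subset (fun p hp => hS p (hT hp)) hA).trans hu⟩, sdiff_subset.trans hT,
      (NN_le_of_subset (fun p hp => hS p (hT hp)) sdiff_subset).trans hu⟩
  · rintro ⟨T, A⟩ h ⟨T', A'⟩ h' e
    simp only [mem_sigma, mem_filter, mem_powerset] at h h'
    simp only [Prod.mk.injEq] at e
    obtain ⟨rfl, e2⟩ := e
    have : T = T' := by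
      rw [← sdiff_union_of_subset h.2, ← sdiff_union_of_subset h'.2, e2]
    subst this; rfl
  · intros; exact le_rfl
  · rintro ⟨A, B⟩ h
    simp only [mem_product, mem_filter, mem_powerset] at h
    exact mul_nonneg (prod_nonneg fun p hp => ha p (h.1.1 hp)) (prod_nonneg fun p hp => hb p (h.2.1 hp))

lemma GG_nonneg {S : Finset ℕ} (u : ℕ) (a : ℕ → ℝ) (ha : ∀ p ∈ S, 0 ≤ a p) : 0 ≤ GG S u a := by
  apply sum_nonneg
  intro T hT
  rw [mem_filter, mem_powerset] at hT
  exact prod_nonneg fun p hp => ha p (hT.1 hp)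

lemma GG_mono {S : Finset ℕ} (u : ℕ) (a b : ℕ → ℝ) (ha : ∀ p ∈ S, 0 ≤ a p) (hab : ∀ p ∈ S, a p ≤ b p) :
    GG S u a ≤ GG S u b := by
  apply sum_le_sum
  intro T hT
  rw [mem_filter, mem_powerset] at hT
  exact prod_le_prod (fun p hp => ha p (hT.1 hp)) (fun p hp => hab p (hT.1 hp))

lemma GG_zero (S : Finset ℕ) (u : ℕ) : GG S u (fun _ => 0) ≤ 1 := by
  unfold GG
  have : ∀ T : Finset ℕ, ∏ p ∈ T, (0:ℝ) = if T = ∅ then 1 else 0 := by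
    intro T
    split_ifs with h
    · simp [h]
    · rw [prod_const, zero_pow (by rwa [Ne, card_eq_zero])]
  simp_rw [this]
  rw [sum_ite_eq']
  split_ifs <;> simp

lemma GG_nat_mul {S : Finset ℕ} (hS : ∀ p ∈ S, 1 ≤ p) (u : ℕ) (a : ℕ → ℝ) (ha : ∀ p ∈ S, 0 ≤ a p) (c : ℕ) :
    GG S u (fun p => c * a p) ≤ GG S u a ^ c := by
  induction c with
  | zero => simpa using GG_zero S u
  | succ c ih =>
    have : (fun p => ((c+1:ℕ):ℝ) * a p) = fun p => c * a p + a p := by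
      funext p; push_cast; ring
    rw [this, pow_succ]
    refine (GG_add_le hS u _ _ (fun p hp => mul_nonneg (by positivity) (ha p hp)) ha).trans ?_
    exact mul_le_mul_of_nonneg_right ih (GG_nonneg u a ha)

lemma NN_inj {A B : Finset ℕ} (hA : ∀ p ∈ A, p.Prime) (hB : ∀ p ∈ B, p.Prime) (h : NN A = NN B) : A = B := by
  rw [← Nat.primeFactors_prod hA, ← Nat.primeFactors_prod hB]
  exact congrArg Nat.primeFactors h

lemma NN_pos {A : Finset ℕ} (hA : ∀ p ∈ A, p.Prime) : 0 < NN A := prod_pos fun p hp => (hA p hp).pos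

lemma GG_inv_le {S : Finset ℕ} (hS : ∀ p ∈ S, p.Prime) (u W : ℕ) (hW : ∀ p ∈ S, ¬ p ∣ W) :
    GG S u (fun p => 1 / p) ≤ ∑ n ∈ Ico 1 (u+1) with n.Coprime W, 1 / (n:ℝ) := by
  unfold GG
  apply sum_le_sum_inj _ _ NN
  · intro T hT
    rw [mem_filter, mem_powerset] at hT
    rw [mem_filter, mem_Ico]
    refine ⟨⟨NN_pos fun p hp => hS p (hT.1 hp), by omega⟩, ?_⟩
    exact Nat.Coprime.prod_left fun p hp => ((hS p (hT.1 hp)).coprime_iff_not_dvd).2 (hW p (hT.1 hp))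
  · intro T hT T' hT' h
    rw [mem_filter, mem_powerset] at hT hT'
    exact NN_inj (fun p hp => hS p (hT.1 hp)) (fun p hp => hS p (hT'.1 hp)) h
  · intro T _
    unfold NN
    push_cast
    rw [prod_div_distrib, prod_const_one]
  · intros; positivity

/-- c/(p-1) products are at most const/sqrt -/
lemma small_factor (c : ℕ) (hc : 1 ≤ c) : ∃ C : ℝ, 0 < C ∧ ∀ Q : Finset ℕ, (∀ p ∈ Q, p.Prime) →
    ∏ p ∈ Q, ((c:ℝ) / ((p:ℝ) - 1)) ≤ C / √(NN Q) := by
  refine ⟨(2*c)^(4*c^2), by positivity, fun Q hQ => ?_⟩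
  have hN : (0:ℝ) < NN Q := by exact_mod_cast NN_pos hQ
  rw [le_div_iff₀ (Real.sqrt_pos.2 hN)]
  have hs : √(NN Q:ℝ) = ∏ p ∈ Q, √(p:ℝ) := by
    unfold NN; push_cast
    exact Real.sqrt_prod _ (fun p _ => by positivity)
  rw [hs, ← prod_mul_distrib]
  have hc1 : (1:ℝ) ≤ c := by exact_mod_cast hc
  have hle : ∀ p ∈ Q, (c:ℝ) / ((p:ℝ) - 1) * √(p:ℝ) ≤ if p < 4*c^2 then 2*(c:ℝ) else 1 := by
    intro p hp
    have h2 : (2:ℝ) ≤ p := by exact_mod_cast (hQ p hp).two_le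
    have hsq := Real.mul_self_sqrt (show (0:ℝ) ≤ p by linarith)
    have hs1 : 1 ≤ √(p:ℝ) := Real.one_le_sqrt.2 (by linarith)
    rw [div_mul_eq_mul_div, div_le_iff₀ (by linarith)]
    split_ifs with h
    · have h3 : √(p:ℝ) ≤ 2 * ((p:ℝ) - 1) := by nlinarith
      have := mul_le_mul_of_nonneg_left h3 (show (0:ℝ) ≤ c by linarith)
      linarith
    · have : (2*(c:ℝ)) ≤ √(p:ℝ) := by
        apply Real.le_sqrt_of_sq_le
        have : ((4*c^2:ℕ):ℝ) ≤ p := by exact_mod_cast (not_lt.1 h)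
        push_cast at this; nlinarith
      nlinarith
  calc _ ≤ ∏ p ∈ Q, (if p < 4*c^2 then 2*(c:ℝ) else 1) := by
        apply prod_le_prod _ hle
        intro p hp
        have h2 : (2:ℝ) ≤ p := by exact_mod_cast (hQ p hp).two_le
        have : (0:ℝ) ≤ (p:ℝ) - 1 := by linarith
        positivity
    _ = (2*(c:ℝ)) ^ #{p ∈ Q | p < 4*c^2} := by
        rw [prod_ite, prod_const, prod_const_one, mul_one]
    _ ≤ _ := by
        apply pow_le_pow_right₀ (by linarith)
        calc _ ≤ #(range (4*c^2)) := card_le_card (by intro p hp; rw [mem_filter] at hp; simpa using hp.2)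
          _ = _ := card_range _
end DSR
namespace DSR
open Finset DirichletCharacter

noncomputable def T0 (R : ℕ) : ℝ := ∑ n ∈ range (R^240), vp n * nu R n

lemma vpnu_coprime {R m n : ℕ} (hR : 3 ≤ R) (hm0 : 1 ≤ m) (hm : m ≤ R^120) (h : vp n * nu R n ≠ 0) : n.Coprime m := by
  have h1 : n.Prime := by
    by_contra hp
    apply h; simp [vp, hp]
  have h2 : R^120 < n := by
    by_contra hn
    apply h; rw [nu_eq_zero hR (Or.inl (by omega)), mul_zero]
  rw [h1.coprime_iff_not_dvd]
  intro hd
  have := Nat.le_of_dvd (by omega) hd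
  omega

noncomputable def toP {m : ℕ} (χ : DirichletCharacter ℂ m) : PChar := ⟨χ.conductor, χ.primitiveCharacter⟩

open Classical in
lemma toP_inj {m : ℕ} (χ χ' : DirichletCharacter ℂ m) (h : toP χ = toP χ') : χ = χ' := by
  let rec0 : PChar → DirichletCharacter ℂ m := fun t => if h : t.1 ∣ m then changeLevel h t.2 else 1
  have hr : ∀ ψ : DirichletCharacter ℂ m, rec0 (toP ψ) = ψ := by
    intro ψ
    have : (toP ψ).1 ∣ m := ψ.conductor_dvd_level
    simp only [rec0]
    rw [dif_pos this]
    exact changeLevel_primitiveCharacter ψ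
  rw [← hr χ, ← hr χ', h]

lemma toP_ev {m : ℕ} (χ : DirichletCharacter ℂ m) (n : ℕ) (hn : n.Coprime m) : ev (toP χ) n = χ (n : ZMod m) := by
  unfold ev toP
  simp only
  rw [← changeLevel_natCast χ.conductor_dvd_level χ.primitiveCharacter n hn, changeLevel_primitiveCharacter]

lemma class_diff {R m : ℕ} (hR : 3 ≤ R) (hm0 : 1 ≤ m) (hm : m ≤ R^3) (a : ℕ) (ha : a.Coprime m) :
    |∑ n ∈ range (R^240) with n ≡ a [MOD m], vp n * nu R n - T0 R / m.totient| ≤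
      1 / m.totient * ∑ t ∈ primChars (R^3) with t.1 ≠ 1 ∧ t.1 ∣ m, ‖SP R t‖ := by
  classical
  have hm' : m ≤ R^120 := hm.trans (Nat.pow_le_pow_right (by omega) (by norm_num))
  have : NeZero m := ⟨by omega⟩
  have hφ : (0:ℝ) < m.totient := by exact_mod_cast Nat.totient_pos.2 (by omega)
  set f : ℕ → ℂ := fun n => ((vp n * nu R n : ℝ) : ℂ) with hf
  have hu : IsUnit (a : ZMod m) := (ZMod.isUnit_iff_coprime a m).2 ha
  have hSP : ∀ χ : DirichletCharacter ℂ m, ∑ n ∈ range (R^240), f n * χ n = SP R (toP χ) := by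
    intro χ
    unfold SP
    apply sum_congr rfl
    intro n _
    by_cases h : vp n * nu R n = 0
    · have h' : (vp n : ℂ) * (nu R n : ℂ) = 0 := by exact_mod_cast h
      rw [hf]; simp only [h]
      rw [mul_left_comm, h']; simp
    · rw [toP_ev χ n (vpnu_coprime hR hm0 hm' h), hf]
      push_cast; ring
  have hone : ∑ n ∈ range (R^240), f n * (1 : DirichletCharacter ℂ m) n = (T0 R : ℂ) := by
    unfold T0
    push_cast
    apply sum_congr rfl
    intro n _
    by_cases h : vp n * nu R n = 0
    · have h' : (vp n : ℂ) * (nu R n : ℂ) = 0 := by exact_mod_cast h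
      rw [hf]; simp only [h]; rw [h']; simp
    · have hc := vpnu_coprime hR hm0 hm' h
      rw [MulChar.one_apply ((ZMod.isUnit_iff_coprime n m).2 hc), hf]
      push_cast; ring
  have horth : (m.totient : ℂ) * ∑ n ∈ range (R^240) with n ≡ a [MOD m], f n =
      ∑ χ : DirichletCharacter ℂ m, χ (a:ZMod m)⁻¹ * ∑ n ∈ range (R^240), f n * χ n := by
    simp_rw [mul_sum]
    rw [sum_comm, sum_filter]
    apply sum_congr rfl
    intro n _
    have h1 := sum_char_inv_mul_char_eq ℂ hu (n : ZMod m)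
    calc _ = f n * (if (a:ZMod m) = n then (m.totient : ℂ) else 0) := by
          have : (n ≡ a [MOD m]) ↔ ((a:ZMod m) = n) := by
            rw [← ZMod.natCast_eq_natCast_iff, eq_comm]
          simp only [this]; split_ifs <;> ring
      _ = _ := by
          rw [← h1, mul_sum]
          apply sum_congr rfl; intros; ring
  have hdiff : (m.totient : ℂ) * ∑ n ∈ range (R^240) with n ≡ a [MOD m], f n - T0 R =
      ∑ χ ∈ (univ : Finset (DirichletCharacter ℂ m)).erase 1, χ (a:ZMod m)⁻¹ * SP R (toP χ) := by
    rw [horth, ← add_sum_erase _ _ (mem_univ (1 : DirichletCharacter ℂ m)), hone,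
      MulChar.one_apply (by
        rw [← ZMod.coe_unitOfCoprime a ha, ZMod.inv_coe_unit]; exact Units.isUnit _), one_mul, add_sub_cancel_left]
    apply sum_congr rfl
    intro χ _
    rw [hSP]
  have hbound : ‖(m.totient : ℂ) * ∑ n ∈ range (R^240) with n ≡ a [MOD m], f n - T0 R‖ ≤
      ∑ t ∈ primChars (R^3) with t.1 ≠ 1 ∧ t.1 ∣ m, ‖SP R t‖ := by
    rw [hdiff]
    refine (norm_sum_le _ _).trans ?_
    apply sum_le_sum_inj _ _ toP
    · intro χ hχ
      have hne := ne_of_mem_erase hχ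
      rw [mem_filter, mem_primChars]
      have hd : (toP χ).1 ∣ m := χ.conductor_dvd_level
      have h0 : 0 < (toP χ).1 := Nat.pos_of_dvd_of_pos hd (by omega)
      refine ⟨⟨⟨h0, (Nat.le_of_dvd (by omega) hd).trans hm⟩, χ.primitiveCharacter_isPrimitive⟩, ?_, hd⟩
      intro h
      exact hne ((eq_one_iff_conductor_eq_one).2 h)
    · intro χ _ χ' _ h
      exact toP_inj χ χ' h
    · intro χ _
      rw [norm_mul]
      exact mul_le_of_le_one_left (norm_nonneg _) (χ.norm_le_one _)
    · intros; positivity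
  have hreal : ‖(m.totient : ℂ) * ∑ n ∈ range (R^240) with n ≡ a [MOD m], f n - T0 R‖ =
      |m.totient * (∑ n ∈ range (R^240) with n ≡ a [MOD m], vp n * nu R n - T0 R / m.totient)| := by
    rw [← Real.norm_eq_abs, ← Complex.norm_real]
    congr 1
    rw [hf]
    push_cast
    rw [mul_sub, mul_div_cancel₀]
    exact_mod_cast hφ.ne'
  rw [hreal, abs_mul, abs_of_pos hφ] at hbound
  rw [one_div, inv_mul_eq_div, le_div_iff₀ hφ, mul_comm]
  exact hbound

def SW (R M : ℕ) : Finset ℕ := {p ∈ range (R+1) | p.Prime ∧ ¬ p ∣ M}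

lemma mem_SW {R M p : ℕ} : p ∈ SW R M ↔ p ≤ R ∧ p.Prime ∧ ¬ p ∣ M := by
  simp [SW]

lemma totient_NN {T : Finset ℕ} (hT : ∀ p ∈ T, p.Prime) : ((NN T).totient : ℝ) = ∏ p ∈ T, ((p:ℝ) - 1) := by
  unfold NN
  induction T using Finset.induction_on with
  | empty => simp
  | insert a T ha ih =>
    have hp := hT a (mem_insert_self a T)
    rw [prod_insert ha, prod_insert ha, Nat.totient_mul, Nat.totient_prime hp]
    · push_cast
      rw [ih (fun p hp => hT p (mem_insert_of_mem hp)), Nat.cast_sub hp.one_le, Nat.cast_one]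
    · apply Nat.Coprime.prod_right
      intro p hp'
      exact (Nat.coprime_primes hp (hT p (mem_insert_of_mem hp'))).2 (fun h => ha (h ▸ hp'))

lemma coprime_NN {T : Finset ℕ} (hT : ∀ p ∈ T, p.Prime) (q : ℕ) (h : ∀ p ∈ T, ¬ p ∣ q) : q.Coprime (NN T) :=
  Nat.Coprime.prod_right fun p hp => (((hT p hp).coprime_iff_not_dvd).2 (h p hp)).symm

/-- inner sum in the average over moduli -/
lemma inner_sum (c W : ℕ) (hc : 1 ≤ c) (hW : 1 ≤ W) : ∃ C : ℝ, 0 < C ∧ ∀ (S : Finset ℕ) (u q : ℕ), (∀ p ∈ S, p.Prime ∧ ¬ p ∣ W) → 1 ≤ q →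
    ∑ T ∈ S.powerset with NN T ≤ u ∧ q ∣ W * NN T, (c:ℝ)^(#T) / (W * NN T).totient ≤
      C / √(q:ℝ) * GG S u (fun p => 1/p)^(2*c) := by
  obtain ⟨C, hC, hsf⟩ := small_factor c hc
  refine ⟨C * √W, by positivity, fun S u q hS hq => ?_⟩
  set Q := {p ∈ S | p ∣ q} with hQ
  have hQp : ∀ p ∈ Q, p.Prime := fun p hp => (hS p (mem_filter.1 hp).1).1
  have hSp : ∀ p ∈ S, p.Prime := fun p hp => (hS p hp).1
  have hge : ∀ p ∈ S, (2:ℝ) ≤ p := fun p hp => by exact_mod_cast (hSp p hp).two_le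
  have hterm : ∀ T ∈ S.powerset, (c:ℝ)^(#T) / (W * NN T).totient ≤ ∏ p ∈ T, ((c:ℝ) / ((p:ℝ) - 1)) := by
    intro T hT
    rw [mem_powerset] at hT
    have hTp : ∀ p ∈ T, p.Prime := fun p hp => hSp p (hT hp)
    have hco := coprime_NN hTp W (fun p hp => (hS p (hT hp)).2)
    rw [Nat.totient_mul hco, prod_div_distrib, prod_const, ← totient_NN hTp]
    have h1 : (0:ℝ) < (NN T).totient := by exact_mod_cast Nat.totient_pos.2 (NN_pos hTp)
    have h2 : (1:ℝ) ≤ W.totient := by exact_mod_cast Nat.totient_pos.2 (by omega)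
    push_cast
    gcongr
    nlinarith
  have hpos : ∀ p ∈ S, 0 ≤ (c:ℝ) / ((p:ℝ) - 1) := fun p hp => by
    have := hge p hp
    exact div_nonneg (by positivity) (by linarith)
  have hGnn : 0 ≤ GG S u (fun p => (1:ℝ)/p) := GG_nonneg _ _ (fun p _ => by positivity)
  have key : ∀ T ∈ S.powerset, q ∣ W * NN T → Q ⊆ T ∧ q ∣ W * NN Q := by
    intro T hT hd
    rw [mem_powerset] at hT
    have hQT : Q ⊆ T := by
      intro p hp
      rw [hQ, mem_filter] at hp
      have hpp := hS p hp.1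
      rcases (hpp.1.dvd_mul).1 (hp.2.trans hd) with h | h
      · exact absurd h hpp.2
      · obtain ⟨p', hp', hd'⟩ := (hpp.1.prime.dvd_finsetProd_iff _).1 h
        rw [(Nat.prime_dvd_prime_iff_eq hpp.1 (hSp p' (hT hp'))).1 hd']
        exact hp'
    refine ⟨hQT, ?_⟩
    have hco : q.Coprime (NN (T \ Q)) := by
      apply coprime_NN (fun p hp => hSp p (hT (mem_sdiff.1 hp).1))
      intro p hp hd
      rw [mem_sdiff] at hp
      exact hp.2 (mem_filter.2 ⟨hT hp.1, hd⟩)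
    apply hco.dvd_of_dvd_mul_right
    have : NN T = NN Q * NN (T \ Q) := by
      unfold NN; rw [mul_comm, prod_sdiff hQT]
    rwa [this, ← mul_assoc] at hd
  rcases (filter (fun T => NN T ≤ u ∧ q ∣ W * NN T) S.powerset).eq_empty_or_nonempty with he | ⟨T1, hT1⟩
  · rw [he, sum_empty]; positivity
  rw [mem_filter] at hT1
  have hqQ := Nat.le_of_dvd (Nat.mul_pos (by omega) (NN_pos hQp)) (key T1 hT1.1 hT1.2.2).2
  have hQb : ∏ p ∈ Q, ((c:ℝ) / ((p:ℝ) - 1)) ≤ C * √W / √(q:ℝ) := by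
    refine (hsf Q hQp).trans ?_
    have hN : (0:ℝ) < NN Q := by exact_mod_cast NN_pos hQp
    have hq0 : (0:ℝ) < q := by exact_mod_cast hq
    rw [div_le_div_iff₀ (Real.sqrt_pos.2 hN) (Real.sqrt_pos.2 hq0), mul_assoc, ← Real.sqrt_mul (by positivity)]
    gcongr
    exact_mod_cast hqQ
  have hG : GG S u (fun p => (c:ℝ) / ((p:ℝ) - 1)) ≤ GG S u (fun p => 1/p)^(2*c) := by
    refine le_trans (GG_mono u _ (fun p => ((2*c:ℕ):ℝ) * (1/p)) hpos ?_)
      (GG_nat_mul (fun p hp => (hSp p hp).one_le) u _ (fun p _ => by positivity) (2*c))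
    intro p hp
    have := hge p hp
    push_cast
    rw [mul_one_div, div_le_div_iff₀ (by linarith) (by linarith)]
    have : (0:ℝ) ≤ c := by positivity
    nlinarith
  calc _ ≤ ∑ T ∈ S.powerset with NN T ≤ u, (∏ p ∈ Q, ((c:ℝ) / ((p:ℝ) - 1))) * ∏ p ∈ T, ((c:ℝ) / ((p:ℝ) - 1)) := by
        apply sum_le_sum_inj _ _ (fun T => T \ Q)
        · intro T hT
          rw [mem_filter] at hT ⊢
          rw [mem_powerset] at hT ⊢
          exact ⟨sdiff_subset.trans hT.1, (NN_le_of_subset (fun p hp => (hSp p (hT.1 hp)).one_le) sdiff_subset).trans hT.2.1⟩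
        · intro T hT T' hT' h
          rw [mem_filter] at hT hT'
          have h1 := (key T hT.1 hT.2.2).1
          have h2 := (key T' hT'.1 hT'.2.2).1
          rw [← sdiff_union_of_subset h1, ← sdiff_union_of_subset h2, h]
        · intro T hT
          rw [mem_filter] at hT
          refine (hterm T hT.1).trans (le_of_eq ?_)
          rw [mul_comm, prod_sdiff (key T hT.1 hT.2.2).1]
        · intro T hT
          rw [mem_filter, mem_powerset] at hT
          exact mul_nonneg (prod_nonneg fun p hp => hpos p (mem_filter.1 hp).1) (prod_nonneg fun p hp => hpos p (hT.1 hp))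
    _ = (∏ p ∈ Q, ((c:ℝ) / ((p:ℝ) - 1))) * GG S u (fun p => (c:ℝ) / ((p:ℝ) - 1)) := by
        rw [GG, mul_sum]
    _ ≤ _ := mul_le_mul hQb hG (GG_nonneg u _ hpos) (by positivity)

lemma GG_log {S : Finset ℕ} (hS : ∀ p ∈ S, p.Prime) {R : ℕ} (hR : 3 ≤ R) :
    GG S (R^2) (fun p => 1/p) ≤ 4 * Real.log R := by
  have hlog := one_le_log hR
  have hR0 : (0:ℝ) < R := by exact_mod_cast (by omega)
  calc _ ≤ ∑ n ∈ (Ico 1 (R^2+1) : Finset ℕ) with n.Coprime 1, 1 / (n:ℝ) :=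
        GG_inv_le hS _ 1 (fun p hp h => (hS p hp).one_lt.ne' (Nat.dvd_one.1 h))
    _ ≤ ∑ n ∈ (Ico 1 (R^3) : Finset ℕ), 1 / (n:ℝ) := by
        apply sum_le_sum_of_subset_of_nonneg
        · intro n hn
          rw [mem_filter, mem_Ico] at hn
          rw [mem_Ico]
          have : R^2 + 1 ≤ R^3 := by nlinarith [Nat.pow_le_pow_left hR 2]
          omega
        · intros; positivity
    _ ≤ 1 + Real.log (R^3 : ℕ) := inv_sum_log _
    _ ≤ _ := by push_cast; rw [Real.log_pow]; push_cast; linarith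

lemma bv_main (W c C : ℕ) (hc : 1 ≤ c) (hW : 1 ≤ W) : ∀ᶠ R : ℕ in Filter.atTop, ∃ E : ℕ, (E = 1 ∨ E.Prime ∧ ¬ E ∣ W) ∧
    ∀ a : Finset ℕ → ℕ, (∀ T ∈ (SW R (W*E)).powerset, (a T).Coprime (W * NN T)) →
    ∑ T ∈ (SW R (W*E)).powerset with NN T ≤ R^2, (c:ℝ)^(#T) *
      |∑ n ∈ range (R^240) with n ≡ a T [MOD W * NN T], vp n * nu R n - T0 R / (W * NN T).totient| ≤ 1 / Real.log R ^ C := by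
  obtain ⟨C1, hC1, hinner⟩ := inner_sum c W hc hW
  filter_upwards [bv_chars (C + 2*c + 1) W, Filter.eventually_ge_atTop 3, Filter.eventually_ge_atTop W,
    log_tendsto.eventually_ge_atTop (C1 * 4^(2*c))] with R ⟨qs, hqs, h⟩ hR hRW hl
  have hlog := one_le_log hR
  have hE : ∃ E : ℕ, (E = 1 ∨ E.Prime ∧ ¬ E ∣ W) ∧ ∀ T ∈ (SW R (W*E)).powerset, ¬ qs ∣ W * NN T := by
    by_cases hp : ∃ p : ℕ, p.Prime ∧ p ∣ qs ∧ ¬ p ∣ W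
    · obtain ⟨p, hp, hpq, hpW⟩ := hp
      refine ⟨p, Or.inr ⟨hp, hpW⟩, fun T hT hd => ?_⟩
      rw [mem_powerset] at hT
      rcases (hp.dvd_mul).1 (hpq.trans hd) with h | h
      · exact hpW h
      · obtain ⟨p', hp', hd'⟩ := (hp.prime.dvd_finsetProd_iff _).1 h
        have h2 := mem_SW.1 (hT hp')
        have := (Nat.prime_dvd_prime_iff_eq hp h2.2.1).1 hd'
        exact h2.2.2 (this ▸ dvd_mul_left p W)
    · push Not at hp
      refine ⟨1, Or.inl rfl, fun T hT hd => ?_⟩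
      rw [mem_powerset] at hT
      have hco : qs.Coprime (NN T) := by
        apply coprime_NN (fun p hp => (mem_SW.1 (hT hp)).2.1)
        intro p hpT hd
        have h2 := mem_SW.1 (hT hpT)
        exact h2.2.2 (by rw [mul_one]; exact hp p h2.2.1 hd)
      have := Nat.le_of_dvd (by omega) (hco.dvd_of_dvd_mul_right hd)
      omega
  obtain ⟨E, hE1, hE2⟩ := hE
  refine ⟨E, hE1, fun a ha => ?_⟩
  set S := SW R (W*E) with hS
  have hSp : ∀ p ∈ S, p.Prime ∧ ¬ p ∣ W := fun p hp =>
    ⟨(mem_SW.1 hp).2.1, fun h => (mem_SW.1 hp).2.2 (h.trans (dvd_mul_right W E))⟩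
  have hG := GG_log (fun p hp => (hSp p hp).1) hR
  have hGnn : 0 ≤ GG S (R^2) (fun p => (1:ℝ)/p) := GG_nonneg _ _ (fun p _ => by positivity)
  calc _ ≤ ∑ T ∈ S.powerset with NN T ≤ R^2, (c:ℝ)^(#T) *
        (1 / (W * NN T).totient * ∑ t ∈ primChars (R^3) with t.1 ≠ 1 ∧ t.1 ∣ W * NN T, ‖SP R t‖) := by
        apply sum_le_sum
        intro T hT
        rw [mem_filter] at hT
        gcongr
        have hN := NN_pos (fun p hp => (hSp p (mem_powerset.1 hT.1 hp)).1)
        refine class_diff hR (Nat.mul_pos (by omega) hN) ?_ _ (ha T hT.1)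
        calc W * NN T ≤ R * R^2 := Nat.mul_le_mul hRW hT.2
          _ = R^3 := by ring
    _ = ∑ T ∈ S.powerset with NN T ≤ R^2, ∑ t ∈ primChars (R^3) with t.1 ≠ 1,
        if t.1 ∣ W * NN T then ‖SP R t‖ * ((c:ℝ)^(#T) / (W * NN T).totient) else 0 := by
        apply sum_congr rfl
        intro T _
        rw [← sum_filter, filter_filter, ← mul_assoc, mul_sum]
        apply sum_congr rfl
        intro t _
        ring
    _ = ∑ t ∈ primChars (R^3) with t.1 ≠ 1, ‖SP R t‖ * ∑ T ∈ S.powerset with NN T ≤ R^2 ∧ t.1 ∣ W * NN T,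
        (c:ℝ)^(#T) / (W * NN T).totient := by
        rw [sum_comm]
        apply sum_congr rfl
        intro t _
        rw [← sum_filter, filter_filter, mul_sum]
    _ = ∑ t ∈ primChars (R^3) with t.1 ≠ 1 ∧ t.1 ≠ qs, ‖SP R t‖ * ∑ T ∈ S.powerset with NN T ≤ R^2 ∧ t.1 ∣ W * NN T,
        (c:ℝ)^(#T) / (W * NN T).totient := by
        symm
        apply sum_subset
        · intro t ht
          rw [mem_filter] at ht ⊢
          exact ⟨ht.1, ht.2.1⟩
        · intro t ht ht'
          rw [mem_filter] at ht ht'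
          have : t.1 = qs := by
            by_contra hne
            exact ht' ⟨ht.1, ht.2, hne⟩
          rw [this, filter_eq_empty_iff.2, sum_empty, mul_zero]
          intro T hT hd
          exact hE2 T hT hd.2
    _ ≤ ∑ t ∈ primChars (R^3) with t.1 ≠ 1 ∧ t.1 ≠ qs, ‖SP R t‖ * (C1 / √(t.1:ℝ) * (4 * Real.log R)^(2*c)) := by
        apply sum_le_sum
        intro t ht
        rw [mem_filter, mem_primChars] at ht
        apply mul_le_mul_of_nonneg_left _ (norm_nonneg _)
        refine (hinner S (R^2) t.1 hSp ht.1.1.1).trans ?_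
        exact mul_le_mul_of_nonneg_left (pow_le_pow_left₀ hGnn hG _) (by positivity)
    _ = (C1 * (4 * Real.log R)^(2*c)) * ∑ t ∈ primChars (R^3) with t.1 ≠ 1 ∧ t.1 ≠ qs, 1 / √(t.1:ℝ) * ‖SP R t‖ := by
        rw [mul_sum]
        apply sum_congr rfl
        intros; ring
    _ ≤ (C1 * (4 * Real.log R)^(2*c)) * (1 / Real.log R ^ (C + 2*c + 1)) := by gcongr
    _ = (C1 * 4^(2*c)) / (Real.log R * Real.log R ^ C) := by
        rw [mul_pow, pow_add, pow_add, pow_one]; field_simp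
    _ ≤ Real.log R / (Real.log R * Real.log R ^ C) := by gcongr
    _ = _ := by field_simp

end DSR
namespace DSR
open Finset

section sieve
variable {α : Type*} [DecidableEq α]

def th (β : α → ℝ) (ω : Finset α) (x : α) : ℝ := if x ∈ ω then -1 else β x

def fU (U : Finset α) (β : α → ℝ) (y : Finset α → ℝ) (ω : Finset α) : ℝ :=
  ∑ r ∈ U.powerset, y r * ∏ x ∈ r, th β ω x

lemma fU_congr {U : Finset α} (β : α → ℝ) (y : Finset α → ℝ) {ω ω' : Finset α} (h : ∀ x ∈ U, (x ∈ ω ↔ x ∈ ω')) :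
    fU U β y ω = fU U β y ω' := by
  apply sum_congr rfl
  intro r hr
  rw [mem_powerset] at hr
  congr 1
  apply prod_congr rfl
  intro x hx
  unfold th
  simp only [h x (hr hx)]

lemma fU_insert {U : Finset α} (β : α → ℝ) (y : Finset α → ℝ) (ω : Finset α) {a : α} (ha : a ∉ U) :
    fU (insert a U) β y ω = fU U β (fun r => y r + th β ω a * y (insert a r)) ω := by
  unfold fU
  rw [sum_powerset_insert ha, ← sum_add_distrib]
  apply sum_congr rfl
  intro r hr
  rw [mem_powerset] at hr
  rw [prod_insert (fun h => ha (hr h))]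
  ring

lemma fU_lin (U : Finset α) (β : α → ℝ) (y z : Finset α → ℝ) (c : ℝ) (ω : Finset α) :
    fU U β (fun r => y r + c * z r) ω = fU U β y ω + c * fU U β z ω := by
  unfold fU
  rw [mul_sum, ← sum_add_distrib]
  apply sum_congr rfl
  intros; ring

lemma orth (U : Finset α) (β : α → ℝ) (y : Finset α → ℝ) :
    ∑ ω ∈ U.powerset, (∏ x ∈ ω, β x) * fU U β y ω ^ 2 =
      (∏ x ∈ U, (1 + β x)) * ∑ r ∈ U.powerset, (∏ x ∈ r, β x) * y r ^ 2 := by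
  induction U using Finset.induction_on generalizing y with
  | empty => simp [fU]
  | insert a U ha ih =>
    rw [sum_powerset_insert ha, sum_powerset_insert ha, prod_insert ha]
    have e1 : ∀ ω ∈ U.powerset, (∏ x ∈ ω, β x) * fU (insert a U) β y ω ^ 2 =
        (∏ x ∈ ω, β x) * (fU U β y ω + β a * fU U β (fun r => y (insert a r)) ω)^2 := by
      intro ω hω
      have : a ∉ ω := fun h => ha (mem_powerset.1 hω h)
      rw [fU_insert β y ω ha, fU_lin, th, if_neg this]
    have e2 : ∀ ω ∈ U.powerset, (∏ x ∈ insert a ω, β x) * fU (insert a U) β y (insert a ω) ^ 2 =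
        β a * (∏ x ∈ ω, β x) * (fU U β y ω - fU U β (fun r => y (insert a r)) ω)^2 := by
      intro ω hω
      have hn : a ∉ ω := fun h => ha (mem_powerset.1 hω h)
      rw [fU_insert β y _ ha, fU_lin, th, if_pos (mem_insert_self _ _), prod_insert hn]
      have hc : ∀ x ∈ U, (x ∈ insert a ω ↔ x ∈ ω) := by
        intro x hx
        rw [mem_insert]
        constructor
        · rintro (rfl | h)
          · exact absurd hx ha
          · exact h
        · exact Or.inr
      rw [fU_congr β y hc, fU_congr β _ hc]
      ring
    have e3 : ∀ r ∈ U.powerset, (∏ x ∈ insert a r, β x) * y (insert a r) ^ 2 =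
        β a * ((∏ x ∈ r, β x) * y (insert a r) ^ 2) := by
      intro r hr
      rw [prod_insert (fun h => ha (mem_powerset.1 hr h))]; ring
    rw [sum_congr rfl e1, sum_congr rfl e2, sum_congr rfl e3, ← mul_sum, ← sum_add_distrib]
    have h0 := ih y
    have h1 := ih (fun r => y (insert a r))
    calc _ = (1 + β a) * (∑ ω ∈ U.powerset, (∏ x ∈ ω, β x) * fU U β y ω ^ 2 +
          β a * ∑ ω ∈ U.powerset, (∏ x ∈ ω, β x) * fU U β (fun r => y (insert a r)) ω ^ 2) := by
          rw [mul_sum, ← sum_add_distrib, mul_sum]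
          apply sum_congr rfl
          intros; ring
      _ = _ := by rw [h0, h1]; ring

lemma fU_union (U V : Finset α) (hd : Disjoint U V) (β : α → ℝ) (y : Finset α → ℝ) (ω : Finset α) (hω : Disjoint V ω) :
    fU (U ∪ V) β y ω = fU U β (fun r => ∑ s ∈ V.powerset, (∏ x ∈ s, β x) * y (r ∪ s)) ω := by
  induction V using Finset.induction_on generalizing y with
  | empty => simp
  | insert a V ha ih =>
    rw [disjoint_insert_left] at hω
    rw [disjoint_insert_right] at hd
    rw [union_insert, fU_insert β y ω (by simp [ha, hd.1]), ih hd.2 _ hω.2, th, if_neg hω.1]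
    congr 1
    funext r
    rw [sum_powerset_insert ha, ← sum_add_distrib]
    apply sum_congr rfl
    intro s hs
    rw [prod_insert (fun h => ha (mem_powerset.1 hs h)), union_insert]
    ring

lemma pair_bound (U : Finset α) (β : α → ℝ) (hβ : ∀ x ∈ U, 0 ≤ β x) (y : Finset α → ℝ)
    (hy0 : ∀ r, 0 ≤ y r) (hmono : ∀ r s, r ⊆ s → y s ≤ y r) {a b : α} (ha : a ∈ U) (hb : b ∈ U) (hab : a ≠ b) :
    ∑ ω ∈ U.powerset with a ∈ ω ∧ b ∈ ω, (∏ x ∈ ω, β x) * fU U β y ω ^ 2 ≤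
      β a * β b * ((∏ x ∈ U, (1 + β x)) * ∑ r ∈ U.powerset, (∏ x ∈ r, β x) * y r ^ 2) := by
  obtain ⟨V, haV, hbV, rfl⟩ : ∃ V : Finset α, a ∉ insert b V ∧ b ∉ V ∧ U = insert a (insert b V) := by
    refine ⟨(U.erase a).erase b, ?_, by simp, ?_⟩
    · simp [hab]
    · rw [insert_erase (mem_erase.2 ⟨hab.symm, hb⟩), insert_erase ha]
  have haV' : a ∉ V := fun h => haV (mem_insert_of_mem h)
  have hβV : ∀ r ⊆ V, 0 ≤ ∏ x ∈ r, β x := fun r hr => prod_nonneg fun x hx =>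
    hβ x (mem_insert_of_mem (mem_insert_of_mem (hr hx)))
  set z : Finset α → ℝ := fun r => (y r - y (insert b r)) - (y (insert a r) - y (insert a (insert b r))) with hz
  have hz2 : ∀ r, z r ^ 2 ≤ y r ^ 2 := by
    intro r
    have h1 := hmono r (insert b r) (subset_insert _ _)
    have h2 := hmono r (insert a r) (subset_insert _ _)
    have h3 := hmono (insert b r) (insert a (insert b r)) (subset_insert _ _)
    have h4 := hmono (insert a r) (insert a (insert b r)) (insert_subset_insert _ (subset_insert _ _))
    have h5 := hy0 (insert a (insert b r))
    rw [sq_le_sq, abs_of_nonneg (hy0 r), abs_le, hz]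
    simp only
    constructor <;> linarith
  have e : ∑ ω ∈ (insert a (insert b V)).powerset with a ∈ ω ∧ b ∈ ω, (∏ x ∈ ω, β x) * fU (insert a (insert b V)) β y ω ^ 2 =
      β a * β b * ∑ ω ∈ V.powerset, (∏ x ∈ ω, β x) * fU V β z ω ^ 2 := by
    rw [sum_filter, sum_powerset_insert haV, sum_powerset_insert hbV, sum_powerset_insert hbV]
    rw [sum_eq_zero, sum_eq_zero, sum_eq_zero, zero_add, zero_add, zero_add, mul_sum]
    · apply sum_congr rfl
      intro ω hω
      rw [mem_powerset] at hω
      have h1 : b ∉ ω := fun h => hbV (hω h)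
      have h2 : a ∉ insert b ω := fun h => haV (insert_subset_insert _ hω h)
      rw [if_pos (by simp), prod_insert h2, prod_insert h1, fU_insert β y _ haV, fU_insert β _ _ hbV]
      have hc : ∀ x ∈ V, (x ∈ insert a (insert b ω) ↔ x ∈ ω) := by
        intro x hx
        have h3 : x ≠ a := fun h => haV' (h ▸ hx)
        have h4 : x ≠ b := fun h => hbV (h ▸ hx)
        simp [h3, h4]
      rw [fU_congr β _ hc]
      have : (fun r => y r + th β (insert a (insert b ω)) a * y (insert a r) + th β (insert a (insert b ω)) b *
          (y (insert b r) + th β (insert a (insert b ω)) a * y (insert a (insert b r)))) = z := by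
        funext r
        rw [hz]
        simp [th]; ring
      rw [this]; ring
    · intro ω hω
      rw [mem_powerset] at hω
      have h1 : b ∉ ω := fun h => hbV (hω h)
      rw [if_neg]; simp [h1, hab.symm]
    · intro ω hω
      rw [mem_powerset] at hω
      have h1 : a ∉ ω := fun h => haV' (hω h)
      rw [if_neg]; simp [h1, hab]
    · intro ω hω
      rw [mem_powerset] at hω
      have h1 : b ∉ ω := fun h => hbV (hω h)
      rw [if_neg]; simp [h1]
  rw [e, orth]
  have hβa := hβ a (mem_insert_self _ _)
  have hβb := hβ b (mem_insert_of_mem (mem_insert_self _ _))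
  apply mul_le_mul_of_nonneg_left _ (mul_nonneg hβa hβb)
  have hsub : V ⊆ insert a (insert b V) := (subset_insert _ _).trans (subset_insert _ _)
  apply mul_le_mul
  · rw [prod_insert haV, prod_insert hbV, ← mul_assoc]
    apply le_mul_of_one_le_left
    · exact prod_nonneg fun x hx => by linarith [hβ x (hsub hx)]
    · nlinarith
  · calc _ ≤ ∑ r ∈ V.powerset, (∏ x ∈ r, β x) * y r ^ 2 := by
          apply sum_le_sum
          intro r hr
          exact mul_le_mul_of_nonneg_left (hz2 r) (hβV r (mem_powerset.1 hr))
      _ ≤ _ := by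
          apply sum_le_sum_of_subset_of_nonneg (powerset_mono.2 hsub)
          intro r hr _
          rw [mem_powerset] at hr
          exact mul_nonneg (prod_nonneg fun x hx => hβ x (hr hx)) (sq_nonneg _)
  · apply sum_nonneg
    intro r hr
    exact mul_nonneg (hβV r (mem_powerset.1 hr)) (sq_nonneg _)
  · exact prod_nonneg fun x hx => by linarith [hβ x hx]

def lam (U : Finset α) (β : α → ℝ) (y : Finset α → ℝ) (d : Finset α) : ℝ :=
  (∏ x ∈ d, (-(1 + β x))) * ∑ r ∈ U.powerset with d ⊆ r, y r * ∏ x ∈ r \ d, β x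

lemma fU_lam (U : Finset α) (β : α → ℝ) (y : Finset α → ℝ) (ω : Finset α) :
    fU U β y ω = ∑ d ∈ U.powerset, lam U β y d * (if d ⊆ ω then 1 else 0) := by
  unfold fU
  have hth : ∀ r : Finset α, ∏ x ∈ r, th β ω x = ∑ d ∈ r.powerset, (∏ x ∈ d, (-(1 + β x))) * (∏ x ∈ r \ d, β x) *
      (if d ⊆ ω then 1 else 0) := by
    intro r
    have : ∀ x ∈ r, th β ω x = (-(1 + β x)) * (if x ∈ ω then 1 else 0) + β x := by
      intro x _
      unfold th
      split_ifs <;> ring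
    rw [prod_congr rfl this, prod_add]
    apply sum_congr rfl
    intro d _
    rw [prod_mul_distrib]
    have : ∏ x ∈ d, (if x ∈ ω then (1:ℝ) else 0) = if d ⊆ ω then 1 else 0 := by
      split_ifs with h
      · exact prod_eq_one fun x hx => if_pos (h hx)
      · rw [not_subset] at h
        obtain ⟨x, hx, hx'⟩ := h
        exact prod_eq_zero hx (if_neg hx')
    rw [this]; ring
  simp_rw [hth, mul_sum]
  rw [sum_comm' (s' := fun d => {r ∈ U.powerset | d ⊆ r}) (t' := U.powerset)]
  · apply sum_congr rfl
    intro d _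
    rw [lam, mul_sum, sum_mul]
    apply sum_congr rfl
    intros; ring
  · intro r d
    simp only [mem_powerset, mem_filter]
    constructor
    · rintro ⟨h1, h2⟩; exact ⟨⟨h1, h2⟩, h2.trans h1⟩
    · rintro ⟨⟨h1, h2⟩, h3⟩; exact ⟨h1, h2⟩

end sieve
end DSR
namespace DSR
open Finset

section conf
variable {ι : Type*} [Fintype ι] [DecidableEq ι]

def UU (ι : Type*) [Fintype ι] [DecidableEq ι] (S : Finset ℕ) : Finset (ℕ × ι) := S ×ˢ univ

lemma mem_UU {S : Finset ℕ} {x : ℕ × ι} : x ∈ UU ι S ↔ x.1 ∈ S := by simp [UU]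

def ok (D : Finset (ℕ × ι)) : Prop := ∀ x ∈ D, ∀ y ∈ D, x.1 = y.1 → x = y

instance (D : Finset (ℕ × ι)) : Decidable (ok D) := by unfold ok; infer_instance

def om (S : Finset ℕ) (φ : S → Option ι) : Finset (ℕ × ι) :=
  {x ∈ UU ι S | ∃ h : x.1 ∈ S, φ ⟨x.1, h⟩ = some x.2}

lemma mem_om {S : Finset ℕ} {φ : S → Option ι} (p : S) (i : ι) : ((p:ℕ), i) ∈ om S φ ↔ φ p = some i := by
  simp [om, mem_UU]

lemma om_sub (S : Finset ℕ) (φ : S → Option ι) : om S φ ⊆ UU ι S := filter_subset _ _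

lemma om_ok (S : Finset ℕ) (φ : S → Option ι) : ok (om S φ) := by
  rintro ⟨p, i⟩ hx ⟨q, j⟩ hy h
  simp only at h
  subst h
  have hp : p ∈ S := mem_UU.1 (om_sub S φ hx)
  have h1 := (mem_om ⟨p, hp⟩ i).1 hx
  have h2 := (mem_om ⟨p, hp⟩ j).1 hy
  rw [h1] at h2
  rw [Option.some.inj h2]

lemma om_inj (S : Finset ℕ) (φ ψ : S → Option ι) (h : om S φ = om S ψ) : φ = ψ := by
  funext p
  apply Option.ext
  intro i
  rw [← mem_om, ← mem_om, h]

lemma om_surj (S : Finset ℕ) (ω : Finset (ℕ × ι)) (h : ω ⊆ UU ι S) (hok : ok ω) : ∃ φ, om S φ = ω := by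
  classical
  refine ⟨fun p => if hp : ∃ i, ((p:ℕ), i) ∈ ω then some hp.choose else none, ?_⟩
  ext ⟨p, i⟩
  constructor
  · intro hx
    have hp : p ∈ S := mem_UU.1 (om_sub S _ hx)
    have h1 := (mem_om ⟨p, hp⟩ i).1 hx
    simp only at h1
    split_ifs at h1 with h2
    rw [Option.some.injEq] at h1
    rw [← h1]
    exact h2.choose_spec
  · intro hx
    have hp : p ∈ S := mem_UU.1 (h hx)
    apply (mem_om ⟨p, hp⟩ i).2
    have h2 : ∃ i, (p, i) ∈ ω := ⟨i, hx⟩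
    simp only
    rw [dif_pos h2]
    have := hok _ h2.choose_spec _ hx rfl
    rw [Prod.mk.injEq] at this
    rw [this.2]

lemma prod_UU {S : Finset ℕ} {D : Finset (ℕ × ι)} (hD : D ⊆ UU ι S) (F : ℕ × ι → ℝ) :
    ∏ x ∈ D, F x = ∏ p : S, ∏ i : ι, (if ((p:ℕ), i) ∈ D then F ((p:ℕ), i) else 1) := by
  rw [prod_coe_sort S (fun p => ∏ i : ι, (if (p, i) ∈ D then F (p, i) else 1)),
    ← prod_product' S univ (fun p i => if (p, i) ∈ D then F (p, i) else 1)]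
  rw [← prod_filter (s := S ×ˢ univ) (fun x => x ∈ D)]
  congr 1
  ext x
  rw [mem_filter]
  exact ⟨fun h => ⟨hD h, h⟩, fun h => h.2⟩

def wO (κ : ℕ × ι → ℝ) (p : ℕ) : Option ι → ℝ
  | none => 1
  | some i => κ (p, i)

lemma om_weight (S : Finset ℕ) (φ : S → Option ι) (κ : ℕ × ι → ℝ) : ∏ x ∈ om S φ, κ x = ∏ p : S, wO κ p (φ p) := by
  rw [prod_UU (om_sub S φ)]
  apply prod_congr rfl
  intro p _
  simp_rw [mem_om]
  cases h : φ p with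
  | none => simp [wO]
  | some i => simp [wO]

lemma sum_ok_phi (S : Finset ℕ) (κ : ℕ × ι → ℝ) (H : Finset (ℕ × ι) → ℝ) :
    ∑ ω ∈ (UU ι S).powerset with ok ω, (∏ x ∈ ω, κ x) * H ω = ∑ φ : S → Option ι, (∏ p : S, wO κ p (φ p)) * H (om S φ) := by
  symm
  apply sum_bij (fun φ _ => om S φ)
  · intro φ _
    rw [mem_filter, mem_powerset]
    exact ⟨om_sub S φ, om_ok S φ⟩
  · intro φ _ ψ _ h
    exact om_inj S φ ψ h
  · intro ω hω
    rw [mem_filter, mem_powerset] at hω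
    obtain ⟨φ, hφ⟩ := om_surj S ω hω.1 hω.2
    exact ⟨φ, mem_univ _, hφ⟩
  · intro φ _
    rw [om_weight]

noncomputable def Zk (S : Finset ℕ) (κ : ℕ × ι → ℝ) : ℝ := ∏ p ∈ S, (1 + ∑ i, κ (p, i))

lemma prob (S : Finset ℕ) (κ : ℕ × ι → ℝ) (hκ : ∀ x, 0 ≤ κ x) (D : Finset (ℕ × ι)) (hD : D ⊆ UU ι S) :
    ∑ ω ∈ (UU ι S).powerset with ok ω, (∏ x ∈ ω, κ x) * (if D ⊆ ω then 1 else 0) =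
      if ok D then Zk S κ * ∏ x ∈ D, (κ x / (1 + ∑ i, κ (x.1, i))) else 0 := by
  classical
  rw [sum_ok_phi]
  have hind : ∀ φ : S → Option ι, (if D ⊆ om S φ then (1:ℝ) else 0) =
      ∏ p : S, if (∀ i, ((p:ℕ), i) ∈ D → φ p = some i) then 1 else 0 := by
    intro φ
    by_cases h : D ⊆ om S φ
    · rw [if_pos h]
      symm
      apply prod_eq_one
      intro p _
      rw [if_pos]
      intro i hi
      exact (mem_om p i).1 (h hi)
    · rw [if_neg h]
      rw [not_subset] at h
      obtain ⟨⟨p, i⟩, hx, hx'⟩ := h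
      have hp : p ∈ S := mem_UU.1 (hD hx)
      symm
      apply prod_eq_zero (mem_univ (⟨p, hp⟩ : S))
      rw [if_neg]
      intro h
      exact hx' ((mem_om ⟨p, hp⟩ i).2 (h i hx))
  simp_rw [hind, ← prod_mul_distrib]
  have hswap : ∑ φ : S → Option ι, ∏ p : S, (wO κ p (φ p) * if (∀ i, ((p:ℕ), i) ∈ D → φ p = some i) then 1 else 0) =
      ∏ p : S, ∑ o : Option ι, (wO κ p o * if (∀ i, ((p:ℕ), i) ∈ D → o = some i) then 1 else 0) := by
    rw [prod_univ_sum, Fintype.piFinset_univ]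
  rw [hswap]
  have hz : ∀ p : ℕ, 0 < 1 + ∑ i, κ (p, i) := fun p => by
    have : 0 ≤ ∑ i, κ (p, i) := sum_nonneg fun i _ => hκ _
    linarith
  split_ifs with hok
  · rw [prod_UU hD, Zk, ← prod_coe_sort S (fun p => 1 + ∑ i, κ (p, i)), ← prod_mul_distrib]
    apply prod_congr rfl
    intro p _
    rw [Fintype.sum_option]
    by_cases he : ∃ i, ((p:ℕ), i) ∈ D
    · obtain ⟨i, hi⟩ := he
      have huniq : ∀ j, ((p:ℕ), j) ∈ D ↔ j = i := by
        intro j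
        constructor
        · intro hj
          have := hok _ hj _ hi rfl
          rw [Prod.mk.injEq] at this
          exact this.2
        · rintro rfl; exact hi
      simp only [huniq]
      have := (hz p).ne'
      simp [wO]
      field_simp
    · push Not at he
      simp [he, wO]
  · unfold ok at hok
    push Not at hok
    obtain ⟨⟨p, i⟩, hx, ⟨q, j⟩, hy, h1, h2⟩ := hok
    simp only at h1
    subst h1
    have hp : p ∈ S := mem_UU.1 (hD hx)
    apply prod_eq_zero (mem_univ (⟨p, hp⟩ : S))
    apply sum_eq_zero
    intro o _
    rw [if_neg, mul_zero]
    intro h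
    have h3 := (h i hx).symm.trans (h j hy)
    exact h2 (by rw [Option.some.inj h3])

end conf
end DSR
namespace DSR
open Finset
set_option linter.unusedSectionVars false
section quadr

variable {ι : Type*} [Fintype ι] [DecidableEq ι]

def ND (D : Finset (ℕ × ι)) : ℕ := ∏ x ∈ D, x.1

noncomputable def EK (S : Finset ℕ) (κ : ℕ × ι → ℝ) (H : Finset (ℕ × ι) → ℝ) : ℝ :=
  (∑ ω ∈ (UU ι S).powerset with ok ω, (∏ x ∈ ω, κ x) * H ω) / Zk S κ

noncomputable def PP (κ : ℕ × ι → ℝ) (D : Finset (ℕ × ι)) : ℝ :=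
  if ok D then ∏ x ∈ D, (κ x / (1 + ∑ i, κ (x.1, i))) else 0

lemma Zk_pos (S : Finset ℕ) (κ : ℕ × ι → ℝ) (hκ : ∀ x, 0 ≤ κ x) : 0 < Zk S κ := by
  apply prod_pos
  intro p _
  have := sum_nonneg (fun i (_ : i ∈ (univ : Finset ι)) => hκ (p, i))
  linarith

lemma EK_ind (S : Finset ℕ) (κ : ℕ × ι → ℝ) (hκ : ∀ x, 0 ≤ κ x) (D : Finset (ℕ × ι)) (hD : D ⊆ UU ι S) :
    EK S κ (fun ω => if D ⊆ ω then 1 else 0) = PP κ D := by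
  have := Zk_pos S κ hκ
  unfold EK PP
  rw [prob S κ hκ D hD]
  split_ifs
  · field_simp
  · simp

lemma sq_ind {U : Finset (ℕ × ι)} (l : Finset (ℕ × ι) → ℝ) (ω : Finset (ℕ × ι)) :
    (∑ d ∈ U.powerset, l d * (if d ⊆ ω then 1 else 0)) ^ 2 =
      ∑ d ∈ U.powerset, ∑ d' ∈ U.powerset, l d * l d' * (if d ∪ d' ⊆ ω then 1 else 0) := by
  rw [sq, sum_mul_sum]
  apply sum_congr rfl
  intro d _
  apply sum_congr rfl
  intro d' _
  by_cases h1 : d ⊆ ω <;> by_cases h2 : d' ⊆ ω <;> simp [h1, h2, union_subset_iff]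

lemma quad (S : Finset ℕ) (κ : ℕ × ι → ℝ) (hκ : ∀ x, 0 ≤ κ x) (l : Finset (ℕ × ι) → ℝ) (f : Finset (ℕ × ι) → ℝ)
    (hf : ∀ ω, f ω = ∑ d ∈ (UU ι S).powerset, l d * (if d ⊆ ω then 1 else 0))
    (I : Finset ℕ) (w : ℕ → ℝ) (Om : ℕ → Finset (ℕ × ι)) (T : ℝ) :
    |∑ n ∈ I, w n * f (Om n) ^ 2 - T * EK S κ (fun ω => f ω ^ 2)| ≤
      ∑ d ∈ (UU ι S).powerset, ∑ d' ∈ (UU ι S).powerset, |l d| * |l d'| *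
        |∑ n ∈ I, w n * (if d ∪ d' ⊆ Om n then 1 else 0) - T * PP κ (d ∪ d')| := by
  have h1 : ∑ n ∈ I, w n * f (Om n) ^ 2 = ∑ d ∈ (UU ι S).powerset, ∑ d' ∈ (UU ι S).powerset, l d * l d' *
      ∑ n ∈ I, w n * (if d ∪ d' ⊆ Om n then 1 else 0) := by
    simp_rw [hf, sq_ind, mul_sum]
    rw [sum_comm]
    apply sum_congr rfl
    intro d _
    rw [sum_comm]
    apply sum_congr rfl
    intro d' _
    apply sum_congr rfl
    intros; ring
  have h2 : EK S κ (fun ω => f ω ^ 2) = ∑ d ∈ (UU ι S).powerset, ∑ d' ∈ (UU ι S).powerset, l d * l d' *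
      PP κ (d ∪ d') := by
    have : ∀ d ∈ (UU ι S).powerset, ∀ d' ∈ (UU ι S).powerset, PP κ (d ∪ d') = EK S κ (fun ω => if d ∪ d' ⊆ ω then 1 else 0) := by
      intro d hd d' hd'
      rw [EK_ind S κ hκ]
      exact union_subset (mem_powerset.1 hd) (mem_powerset.1 hd')
    rw [sum_congr rfl fun d hd => sum_congr rfl fun d' hd' => by rw [this d hd d' hd']]
    unfold EK
    simp_rw [hf, sq_ind, mul_sum, ← mul_div_assoc, ← sum_div, mul_sum]
    congr 1
    rw [sum_comm]
    apply sum_congr rfl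
    intro d _
    rw [sum_comm]
    apply sum_congr rfl
    intro d' _
    apply sum_congr rfl
    intros; ring
  rw [h1, h2, mul_sum, ← sum_sub_distrib]
  refine (abs_sum_le_sum_abs _ _).trans (sum_le_sum fun d _ => ?_)
  rw [mul_sum, ← sum_sub_distrib]
  refine (abs_sum_le_sum_abs _ _).trans (sum_le_sum fun d' _ => ?_)
  rw [← abs_mul, ← abs_mul]
  apply le_of_eq
  congr 1; ring

lemma ok_card {D : Finset (ℕ × ι)} (h : ok D) : #(D.image Prod.fst) = #D := by
  apply card_image_of_injOn
  intro x hx y hy hxy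
  exact h x hx y hy hxy

lemma ok_ND {D : Finset (ℕ × ι)} (h : ok D) : ND D = NN (D.image Prod.fst) := by
  unfold ND NN
  rw [prod_image]
  intro x hx y hy hxy
  exact h x hx y hy hxy

lemma quad_err [Nonempty ι] (S : Finset ℕ) (hS : ∀ p ∈ S, 1 ≤ p) (l e : Finset (ℕ × ι) → ℝ) (L : ℝ) (hL : 0 ≤ L) (R : ℕ)
    (hl : ∀ d ⊆ UU ι S, |l d| ≤ L * 2 ^ #d) (hl0 : ∀ d ⊆ UU ι S, R < ND d → l d = 0)
    (he : ∀ D, 0 ≤ e D) (he0 : ∀ D, ¬ ok D → e D = 0) :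
    ∃ σ : Finset ℕ → Finset (ℕ × ι), (∀ T ∈ S.powerset, σ T ⊆ UU ι S ∧ ok (σ T) ∧ (σ T).image Prod.fst = T) ∧
    ∑ d ∈ (UU ι S).powerset, ∑ d' ∈ (UU ι S).powerset, |l d| * |l d'| * e (d ∪ d') ≤
      L ^ 2 * ∑ T ∈ S.powerset with NN T ≤ R ^ 2, ((4 ^ (Fintype.card ι + 1) : ℕ) : ℝ) ^ #T * e (σ T) := by
  classical
  have hex : ∀ T ∈ S.powerset, ∃ s : Finset (ℕ × ι), (s ⊆ UU ι S ∧ ok s ∧ s.image Prod.fst = T) ∧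
      ∀ D ⊆ UU ι S, ok D → D.image Prod.fst = T → e D ≤ e s := by
    intro T hT
    rw [mem_powerset] at hT
    let i0 : ι := Classical.arbitrary ι
    have hne : ({s ∈ (UU ι S).powerset | ok s ∧ s.image Prod.fst = T} : Finset (Finset (ℕ × ι))).Nonempty := by
      refine ⟨T.image (fun p => (p, i0)), ?_⟩
      rw [mem_filter, mem_powerset]
      refine ⟨?_, ?_, ?_⟩
      · intro x hx
        rw [mem_image] at hx
        obtain ⟨p, hp, rfl⟩ := hx
        exact mem_UU.2 (hT hp)
      · intro x hx y hy h
        rw [mem_image] at hx hy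
        obtain ⟨p, hp, rfl⟩ := hx
        obtain ⟨q, hq, rfl⟩ := hy
        simp only at h
        rw [h]
      · rw [image_image]
        ext x; simp
    obtain ⟨s, hs, hmax⟩ := exists_max_image _ e hne
    rw [mem_filter, mem_powerset] at hs
    refine ⟨s, ⟨hs.1, hs.2.1, hs.2.2⟩, ?_⟩
    intro D hD h1 h2
    exact hmax D (by rw [mem_filter, mem_powerset]; exact ⟨hD, h1, h2⟩)
  choose! σ hσ hmax using hex
  refine ⟨σ, hσ, ?_⟩
  rw [← sum_product' (UU ι S).powerset (UU ι S).powerset (fun d d' => |l d| * |l d'| * e (d ∪ d'))]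
  obtain ⟨G, hG⟩ : ∃ G : Finset (Finset (ℕ × ι) × Finset (ℕ × ι)),
      G = {q ∈ (UU ι S).powerset ×ˢ (UU ι S).powerset | ok (q.1 ∪ q.2) ∧ ND q.1 ≤ R ∧ ND q.2 ≤ R} := ⟨_, rfl⟩
  have hsub : ∑ q ∈ (UU ι S).powerset ×ˢ (UU ι S).powerset, |l q.1| * |l q.2| * e (q.1 ∪ q.2) =
      ∑ q ∈ G, |l q.1| * |l q.2| * e (q.1 ∪ q.2) := by
    rw [hG]
    symm
    apply sum_subset (filter_subset _ _)
    intro q hq hn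
    rw [mem_filter, not_and] at hn
    have := hn hq
    rw [mem_product, mem_powerset, mem_powerset] at hq
    by_cases h1 : ok (q.1 ∪ q.2)
    · by_cases h2 : ND q.1 ≤ R
      · rw [hl0 q.2 hq.2 (by by_contra h; exact this ⟨h1, h2, by omega⟩)]; simp
      · rw [hl0 q.1 hq.1 (by omega)]; simp
    · rw [he0 _ h1]; simp
  rw [hsub, mul_sum]
  have hGm : ∀ q ∈ G, (q.1 ∪ q.2).image Prod.fst ∈ ({T ∈ S.powerset | NN T ≤ R ^ 2} : Finset (Finset ℕ)) := by
    intro q hq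
    rw [hG, mem_filter, mem_product, mem_powerset, mem_powerset] at hq
    obtain ⟨⟨h1, h2⟩, h3, h4, h5⟩ := hq
    rw [mem_filter, mem_powerset]
    refine ⟨?_, ?_⟩
    · intro p hp
      rw [mem_image] at hp
      obtain ⟨x, hx, rfl⟩ := hp
      exact mem_UU.1 (union_subset h1 h2 hx)
    · rw [← ok_ND h3]
      have : ND (q.1 ∪ q.2) * ND (q.1 ∩ q.2) = ND q.1 * ND q.2 := prod_union_inter
      have h6 : 1 ≤ ND (q.1 ∩ q.2) := by
        apply Nat.one_le_iff_ne_zero.2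
        unfold ND
        rw [prod_ne_zero_iff]
        intro x hx
        have := hS x.1 (mem_UU.1 (h1 (mem_inter.1 hx).1))
        omega
      calc ND (q.1 ∪ q.2) ≤ ND (q.1 ∪ q.2) * ND (q.1 ∩ q.2) := Nat.le_mul_of_pos_right _ h6
        _ = _ := this
        _ ≤ R * R := Nat.mul_le_mul h4 h5
        _ = R ^ 2 := by ring
  rw [← sum_fiberwise_of_maps_to hGm]
  apply sum_le_sum
  intro T hT
  rw [mem_filter] at hT
  have hTS := hT.1
  have hb : ∀ q ∈ G.filter (fun q => (q.1 ∪ q.2).image Prod.fst = T), |l q.1| * |l q.2| * e (q.1 ∪ q.2) ≤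
      L ^ 2 * 4 ^ #T * e (σ T) := by
    intro q hq
    rw [mem_filter, hG, mem_filter, mem_product, mem_powerset, mem_powerset] at hq
    obtain ⟨⟨⟨h1, h2⟩, h3, h4, h5⟩, h6⟩ := hq
    have hc : #(q.1 ∪ q.2) = #T := by rw [← h6, ok_card h3]
    have c1 : |l q.1| ≤ L * 2 ^ #T := (hl _ h1).trans (mul_le_mul_of_nonneg_left
      (pow_le_pow_right₀ (by norm_num) (by rw [← hc]; exact card_le_card subset_union_left)) hL)
    have c2 : |l q.2| ≤ L * 2 ^ #T := (hl _ h2).trans (mul_le_mul_of_nonneg_left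
      (pow_le_pow_right₀ (by norm_num) (by rw [← hc]; exact card_le_card subset_union_right)) hL)
    have c3 := hmax T hTS (q.1 ∪ q.2) (union_subset h1 h2) h3 h6
    calc |l q.1| * |l q.2| * e (q.1 ∪ q.2) ≤ (L * 2 ^ #T) * (L * 2 ^ #T) * e (σ T) := by
          apply mul_le_mul _ c3 (he _) (by positivity)
          apply mul_le_mul c1 c2 (abs_nonneg _) (by positivity)
      _ = L ^ 2 * (2 ^ #T * 2 ^ #T) * e (σ T) := by ring
      _ = _ := by rw [← mul_pow]; norm_num
  have hcard : #(G.filter (fun q => (q.1 ∪ q.2).image Prod.fst = T)) ≤ (4 ^ Fintype.card ι) ^ #T := by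
    have hs : G.filter (fun q => (q.1 ∪ q.2).image Prod.fst = T) ⊆ (T ×ˢ (univ : Finset ι)).powerset ×ˢ (T ×ˢ (univ : Finset ι)).powerset := by
      intro q hq
      rw [mem_filter] at hq
      rw [mem_product, mem_powerset, mem_powerset]
      constructor
      · intro x hx
        rw [mem_product, ← hq.2]
        exact ⟨mem_image_of_mem _ (mem_union_left _ hx), mem_univ _⟩
      · intro x hx
        rw [mem_product, ← hq.2]
        exact ⟨mem_image_of_mem _ (mem_union_right _ hx), mem_univ _⟩
    refine (card_le_card hs).trans (le_of_eq ?_)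
    rw [card_product, card_powerset, card_product, card_univ, ← mul_pow, mul_comm #T, pow_mul]; norm_num
  refine (sum_le_card_nsmul _ _ _ hb).trans ?_
  rw [nsmul_eq_mul]
  calc (#(G.filter (fun q => (q.1 ∪ q.2).image Prod.fst = T)) : ℝ) * (L ^ 2 * 4 ^ #T * e (σ T))
      ≤ (4 ^ Fintype.card ι) ^ #T * (L ^ 2 * 4 ^ #T * e (σ T)) := by
        apply mul_le_mul_of_nonneg_right _ (by have := he (σ T); positivity)
        exact_mod_cast hcard
    _ = _ := by push_cast; rw [pow_succ 4, mul_pow]; ring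

end quadr
end DSR
namespace DSR
open Finset
section expec

variable {ι : Type*} [Fintype ι] [DecidableEq ι]

lemma one_add_pow_le (k : ℕ) (b : ℝ) (hb : 0 ≤ b) (hkb : (k:ℝ) ^ 2 * b ^ 2 ≤ 1) :
    (1 + b) ^ k ≤ (1 + k * b) * (1 + (k:ℝ) ^ 2 * b ^ 2) := by
  have hx0 : 0 ≤ k * b := by positivity
  have hx : k * b ≤ 1 := by nlinarith
  have h1 : (1 + b) ^ k ≤ Real.exp (k * b) := by
    rw [Real.exp_nat_mul]
    apply pow_le_pow_left₀ (by positivity)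
    linarith [Real.add_one_le_exp b]
  have h2 : Real.exp (k * b) ≤ 1 + k * b + (k * b) ^ 2 := by
    have := Real.abs_exp_sub_one_sub_id_le (x := k * b) (by rw [abs_of_nonneg hx0]; exact hx)
    have := (abs_le.1 this).2
    linarith
  have h3 : (1 + k * b) * (1 + (k:ℝ) ^ 2 * b ^ 2) = 1 + k * b + (k * b) ^ 2 + (k * b) ^ 3 := by ring
  have : 0 ≤ (k * b) ^ 3 := by positivity
  linarith

lemma S1_upper (S : Finset ℕ) (b : ℕ → ℝ) (hb : ∀ p, 0 ≤ b p) (hb2 : (Fintype.card ι : ℝ) ^ 2 * ∑ p ∈ S, b p ^ 2 ≤ 1 / 2)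
    (y : Finset (ℕ × ι) → ℝ) :
    EK S (fun x => b x.1) (fun ω => fU (UU ι S) (fun x => b x.1) y ω ^ 2) ≤
      2 * ∑ r ∈ (UU ι S).powerset, (∏ x ∈ r, b x.1) * y r ^ 2 := by
  obtain ⟨k, hk⟩ : ∃ k : ℕ, k = Fintype.card ι := ⟨_, rfl⟩
  rw [← hk] at hb2
  have hZ := Zk_pos S (fun x : ℕ × ι => b x.1) (fun x => hb _)
  have hP : ∏ x ∈ UU ι S, (1 + b x.1) ≤ 2 * Zk S (fun x : ℕ × ι => b x.1) := by
    unfold UU Zk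
    rw [prod_product]
    simp only [prod_const, sum_const, card_univ, nsmul_eq_mul, ← hk]
    have hle : ∀ p ∈ S, (k:ℝ) ^ 2 * b p ^ 2 ≤ 1 := by
      intro p hp
      have := single_le_sum (f := fun p => b p ^ 2) (fun p _ => sq_nonneg _) hp
      have h2 : (k:ℝ) ^ 2 * b p ^ 2 ≤ (k:ℝ) ^ 2 * ∑ p ∈ S, b p ^ 2 := mul_le_mul_of_nonneg_left this (by positivity)
      linarith
    calc ∏ p ∈ S, (1 + b p) ^ k ≤ ∏ p ∈ S, ((1 + k * b p) * (1 + (k:ℝ) ^ 2 * b p ^ 2)) := by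
          apply prod_le_prod
          · intro p _; have := hb p; positivity
          · intro p hp; exact one_add_pow_le k (b p) (hb p) (hle p hp)
      _ = (∏ p ∈ S, (1 + k * b p)) * ∏ p ∈ S, (1 + (k:ℝ) ^ 2 * b p ^ 2) := prod_mul_distrib
      _ ≤ (∏ p ∈ S, (1 + k * b p)) * 2 := by
          apply mul_le_mul_of_nonneg_left _ (prod_nonneg fun p _ => by have := hb p; positivity)
          calc ∏ p ∈ S, (1 + (k:ℝ) ^ 2 * b p ^ 2) ≤ ∏ p ∈ S, Real.exp ((k:ℝ) ^ 2 * b p ^ 2) := by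
                apply prod_le_prod
                · intros; positivity
                · intro p _; linarith [Real.add_one_le_exp ((k:ℝ) ^ 2 * b p ^ 2)]
            _ = Real.exp ((k:ℝ) ^ 2 * ∑ p ∈ S, b p ^ 2) := by rw [← Real.exp_sum, mul_sum]
            _ ≤ Real.exp (1 / 2) := Real.exp_le_exp.2 hb2
            _ ≤ 2 := by
                have h := Real.abs_exp_sub_one_sub_id_le (x := (1/2:ℝ)) (by rw [abs_of_nonneg] <;> norm_num)
                have := (abs_le.1 h).2
                norm_num at this ⊢; linarith
      _ = _ := by ring
  unfold EK
  rw [div_le_iff₀ hZ]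
  calc _ ≤ ∑ ω ∈ (UU ι S).powerset, (∏ x ∈ ω, b x.1) * fU (UU ι S) (fun x => b x.1) y ω ^ 2 := by
        apply sum_le_sum_of_subset_of_nonneg (filter_subset _ _)
        intro ω _ _
        exact mul_nonneg (prod_nonneg fun x _ => hb _) (sq_nonneg _)
    _ = _ := orth _ _ _
    _ ≤ (2 * Zk S (fun x : ℕ × ι => b x.1)) * ∑ r ∈ (UU ι S).powerset, (∏ x ∈ r, b x.1) * y r ^ 2 := by
        apply mul_le_mul_of_nonneg_right hP
        exact sum_nonneg fun r _ => mul_nonneg (prod_nonneg fun x _ => hb _) (sq_nonneg _)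
    _ = _ := by ring

def UM (S : Finset ℕ) (m : ι) : Finset (ℕ × ι) := S ×ˢ univ.erase m
def VM (S : Finset ℕ) (m : ι) : Finset (ℕ × ι) := S ×ˢ {m}

lemma UM_VM (S : Finset ℕ) (m : ι) : UU ι S = UM S m ∪ VM S m := by
  ext x; simp only [UU, UM, VM, mem_union, mem_product, mem_univ, mem_erase, mem_singleton]; tauto

lemma UM_VM_disj (S : Finset ℕ) (m : ι) : Disjoint (UM S m) (VM S m) := by
  rw [disjoint_left]; intro x; simp only [UM, VM, mem_product, mem_univ, mem_erase, mem_singleton]; tauto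

def kap (b : ℕ → ℝ) (m : ι) (x : ℕ × ι) : ℝ := if x.2 = m then 0 else b x.1

lemma kap_nonneg (b : ℕ → ℝ) (hb : ∀ p, 0 ≤ b p) (m : ι) (x : ℕ × ι) : 0 ≤ kap b m x := by
  unfold kap; split_ifs <;> simp [hb]

lemma kap_sum (b : ℕ → ℝ) (m : ι) (p : ℕ) : ∑ i, kap b m (p, i) = ((Fintype.card ι - 1 : ℕ) : ℝ) * b p := by
  unfold kap
  simp only
  rw [← add_sum_erase _ _ (mem_univ m)]
  rw [if_pos rfl, zero_add, sum_congr rfl (fun i hi => by rw [if_neg (ne_of_mem_erase hi)]), sum_const,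
    card_erase_of_mem (mem_univ m), card_univ, nsmul_eq_mul]

noncomputable def YM (S : Finset ℕ) (b : ℕ → ℝ) (y : Finset (ℕ × ι) → ℝ) (m : ι) (r : Finset (ℕ × ι)) : ℝ :=
  ∑ s ∈ (VM S m).powerset, (∏ x ∈ s, b x.1) * y (r ∪ s)

lemma S2_lower (S : Finset ℕ) (b : ℕ → ℝ) (hb : ∀ p, 0 ≤ b p) (hb2 : (Fintype.card ι : ℝ) ^ 2 * ∑ p ∈ S, b p ^ 2 ≤ 1 / 2)
    (y : Finset (ℕ × ι) → ℝ) (hy0 : ∀ r, 0 ≤ y r) (hmono : ∀ r s, r ⊆ s → y s ≤ y r) (m : ι) :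
    (1 / 2) * ∑ r ∈ (UM S m).powerset, (∏ x ∈ r, b x.1) * YM S b y m r ^ 2 ≤
    EK S (kap b m) (fun ω => fU (UU ι S) (fun x => b x.1) y ω ^ 2) := by
  have hZ := Zk_pos S (kap b m) (kap_nonneg b hb m)
  have hP : Zk S (kap b m) ≤ ∏ x ∈ UM S m, (1 + b x.1) := by
    unfold UM Zk
    rw [prod_product]
    simp only [kap_sum, prod_const, card_erase_of_mem (mem_univ m), card_univ]
    apply prod_le_prod
    · intro p _; have := hb p; positivity
    · intro p _; exact one_add_mul_le_pow (by linarith [hb p]) _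
  obtain ⟨f, hf⟩ : ∃ f : Finset (ℕ × ι) → ℝ, f = fun ω => (∏ x ∈ ω, b x.1) * fU (UM S m) (fun x => b x.1) (YM S b y m) ω ^ 2 := ⟨_, rfl⟩
  have hf0 : ∀ ω, 0 ≤ f ω := by
    intro ω; rw [hf]; exact mul_nonneg (prod_nonneg fun x _ => hb _) (sq_nonneg _)
  have hUsub : UM S m ⊆ UU ι S := by rw [UM_VM S m]; exact subset_union_left
  have hEK : ∑ ω ∈ (UU ι S).powerset with ok ω, (∏ x ∈ ω, kap b m x) * fU (UU ι S) (fun x => b x.1) y ω ^ 2 =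
      ∑ ω ∈ (UM S m).powerset with ok ω, f ω := by
    symm
    rw [← sum_subset (s₁ := {ω ∈ (UM S m).powerset | ok ω}) (s₂ := {ω ∈ (UU ι S).powerset | ok ω})]
    · apply sum_congr rfl
      intro ω hω
      rw [mem_filter, mem_powerset] at hω
      have hd : Disjoint (VM S m) ω := (disjoint_of_subset_left hω.1 (UM_VM_disj S m)).symm
      rw [UM_VM S m, fU_union _ _ (UM_VM_disj S m) _ _ _ hd, hf]
      simp only
      congr 1
      apply prod_congr rfl
      intro x hx
      have := hω.1 hx
      unfold UM at this
      rw [mem_product, mem_erase] at this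
      unfold kap
      rw [if_neg this.2.1]
    · exact filter_subset_filter _ (powerset_mono.2 hUsub)
    · intro ω hω hn
      rw [mem_filter, mem_powerset] at hω hn
      have : ¬ ω ⊆ UM S m := fun h => hn ⟨h, hω.2⟩
      rw [not_subset] at this
      obtain ⟨x, hx, hxn⟩ := this
      have hx1 := hω.1 hx
      rw [UM_VM S m, mem_union] at hx1
      have hx2 : x ∈ VM S m := by tauto
      unfold VM at hx2
      rw [mem_product, mem_singleton] at hx2
      rw [prod_eq_zero hx (by unfold kap; rw [if_pos hx2.2]), zero_mul]
  obtain ⟨M, hM⟩ : ∃ M : ℝ, M = (∏ x ∈ UM S m, (1 + b x.1)) * ∑ r ∈ (UM S m).powerset, (∏ x ∈ r, b x.1) * YM S b y m r ^ 2 := ⟨_, rfl⟩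
  have hM0 : 0 ≤ M := by
    rw [hM]; apply mul_nonneg (prod_nonneg fun x _ => by have := hb x.1; positivity)
    exact sum_nonneg fun r _ => mul_nonneg (prod_nonneg fun x _ => hb _) (sq_nonneg _)
  have hall : ∑ ω ∈ (UM S m).powerset, f ω = M := by rw [hM, ← orth, hf]
  have hY0 : ∀ r, 0 ≤ YM S b y m r := fun r => sum_nonneg fun s _ => mul_nonneg (prod_nonneg fun x _ => hb _) (hy0 _)
  have hYm : ∀ r s, r ⊆ s → YM S b y m s ≤ YM S b y m r := by
    intro r s hrs
    apply sum_le_sum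
    intro t _
    exact mul_le_mul_of_nonneg_left (hmono _ _ (union_subset_union hrs subset_rfl)) (prod_nonneg fun x _ => hb _)
  have hbad : ∑ ω ∈ (UM S m).powerset with ¬ ok ω, f ω ≤ M / 2 := by
    obtain ⟨Q, hQ⟩ : ∃ Q : Finset ((ℕ × ι) × (ℕ × ι)), Q = {q ∈ UM S m ×ˢ UM S m | q.1.1 = q.2.1 ∧ q.1 ≠ q.2} := ⟨_, rfl⟩
    have h1 : ∑ ω ∈ (UM S m).powerset with ¬ ok ω, f ω ≤ ∑ q ∈ Q, ∑ ω ∈ (UM S m).powerset with q.1 ∈ ω ∧ q.2 ∈ ω, f ω := by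
      rw [sum_filter]
      simp_rw [sum_filter]
      rw [sum_comm]
      apply sum_le_sum
      intro ω hω
      rw [mem_powerset] at hω
      have hnn : ∀ q ∈ Q, 0 ≤ (if q.1 ∈ ω ∧ q.2 ∈ ω then f ω else 0) := by
        intro q _; split_ifs <;> simp [hf0]
      by_cases h : ok ω
      swap
      · rw [if_pos h]
        unfold ok at h
        push Not at h
        obtain ⟨x, hx, z, hz, h2, h3⟩ := h
        have hq : ((x, z) : (ℕ × ι) × (ℕ × ι)) ∈ Q := by
          rw [hQ, mem_filter, mem_product]
          exact ⟨⟨hω hx, hω hz⟩, h2, h3⟩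
        have := single_le_sum hnn hq
        simpa [hx, hz] using this
      · rw [if_neg (not_not.2 h)]
        exact sum_nonneg hnn
    have h2 : ∑ q ∈ Q, ∑ ω ∈ (UM S m).powerset with q.1 ∈ ω ∧ q.2 ∈ ω, f ω ≤ ∑ q ∈ Q, b q.1.1 * b q.2.1 * M := by
      apply sum_le_sum
      intro q hq
      rw [hQ, mem_filter, mem_product] at hq
      rw [hM, hf]
      exact pair_bound (UM S m) (fun x => b x.1) (fun x _ => hb _) (YM S b y m) hY0 hYm hq.1.1 hq.1.2 hq.2.2
    have h3 : ∑ q ∈ Q, b q.1.1 * b q.2.1 ≤ (Fintype.card ι : ℝ) ^ 2 * ∑ p ∈ S, b p ^ 2 := by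
      calc ∑ q ∈ Q, b q.1.1 * b q.2.1 ≤ ∑ q ∈ S ×ˢ ((univ : Finset ι) ×ˢ (univ : Finset ι)), b q.1 ^ 2 := by
            apply sum_le_sum_inj Q _ (fun q => (q.1.1, (q.1.2, q.2.2)))
            · intro q hq
              rw [hQ, mem_filter, mem_product] at hq
              simp only [mem_product, mem_univ, and_true]
              exact mem_UU.1 (hUsub hq.1.1)
            · intro q hq q' hq' h
              rw [hQ, mem_filter] at hq hq'
              simp only [Prod.mk.injEq] at h
              ext <;> simp_all
            · intro q hq
              rw [hQ, mem_filter] at hq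
              simp only
              rw [← hq.2.1, sq]
            · intro q _ ; positivity
        _ = _ := by
          rw [sum_product, mul_sum]
          apply sum_congr rfl
          intro p _
          simp only [sum_const, card_product, card_univ, nsmul_eq_mul]
          push_cast
          ring
    calc _ ≤ _ := h1
      _ ≤ _ := h2
      _ = (∑ q ∈ Q, b q.1.1 * b q.2.1) * M := by rw [sum_mul]
      _ ≤ (1 / 2) * M := mul_le_mul_of_nonneg_right (h3.trans hb2) hM0
      _ = _ := by ring
  have hsplit := sum_filter_add_sum_filter_not (UM S m).powerset (fun ω => ok ω) f
  unfold EK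
  rw [hEK, le_div_iff₀ hZ]
  calc _ ≤ (1 / 2) * (∑ r ∈ (UM S m).powerset, (∏ x ∈ r, b x.1) * YM S b y m r ^ 2) * ∏ x ∈ UM S m, (1 + b x.1) := by
        apply mul_le_mul_of_nonneg_left hP
        apply mul_nonneg (by norm_num)
        exact sum_nonneg fun r _ => mul_nonneg (prod_nonneg fun x _ => hb _) (sq_nonneg _)
    _ = M / 2 := by rw [hM]; ring
    _ ≤ _ := by linarith

end expec
end DSR
namespace DSR
open Finset
set_option linter.unusedSectionVars false
section comps

variable {ι : Type*} [Fintype ι] [DecidableEq ι]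

def comp (r : Finset (ℕ × ι)) (i : ι) : Finset ℕ := (r.filter (fun x => x.2 = i)).image Prod.fst

lemma mem_comp {r : Finset (ℕ × ι)} {i : ι} {p : ℕ} : p ∈ comp r i ↔ (p, i) ∈ r := by
  unfold comp
  rw [mem_image]
  constructor
  · rintro ⟨⟨q, j⟩, hx, rfl⟩
    rw [mem_filter] at hx
    obtain ⟨h1, h2⟩ := hx
    simp only at h2
    subst h2
    exact h1
  · intro h
    exact ⟨(p, i), by rw [mem_filter]; exact ⟨h, rfl⟩, rfl⟩

lemma comp_prod {M : Type*} [CommMonoid M] (r : Finset (ℕ × ι)) (h : ℕ → M) :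
    ∏ x ∈ r, h x.1 = ∏ i, ∏ p ∈ comp r i, h p := by
  rw [← prod_fiberwise r Prod.snd]
  apply prod_congr rfl
  intro i _
  unfold comp
  rw [prod_image]
  rintro ⟨p, a⟩ hx ⟨q, b⟩ hy hxy
  simp only [coe_filter, Set.mem_ofPred_eq] at hx hy hxy
  rw [hxy, hx.2, hy.2]

lemma ND_comp (r : Finset (ℕ × ι)) : ND r = ∏ i, NN (comp r i) := comp_prod r (fun p => p)

lemma comp_sub {S : Finset ℕ} {r : Finset (ℕ × ι)} (h : r ⊆ UU ι S) (i : ι) : comp r i ⊆ S := by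
  intro p hp
  exact mem_UU.1 (h (mem_comp.1 hp))

lemma comp_mono {r s : Finset (ℕ × ι)} (h : r ⊆ s) (i : ι) : comp r i ⊆ comp s i := by
  intro p hp
  exact mem_comp.2 (h (mem_comp.1 hp))

lemma sum_comp (S : Finset ℕ) (G : ι → Finset ℕ → ℝ) :
    ∑ r ∈ (UU ι S).powerset, ∏ i, G i (comp r i) = ∏ i, ∑ T ∈ S.powerset, G i T := by
  rw [prod_univ_sum]
  apply sum_bij (fun r _ => fun i => comp r i)
  · intro r hr
    rw [mem_powerset] at hr
    rw [Fintype.mem_piFinset]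
    intro i
    rw [mem_powerset]
    exact comp_sub hr i
  · intro r _ s _ h
    ext ⟨p, i⟩
    rw [← mem_comp, ← mem_comp, congrFun h i]
  · intro τ hτ
    rw [Fintype.mem_piFinset] at hτ
    refine ⟨(UU ι S).filter (fun x => x.1 ∈ τ x.2), mem_powerset.2 (filter_subset _ _), ?_⟩
    funext i
    ext p
    rw [mem_comp, mem_filter, mem_UU]
    constructor
    · intro h; exact h.2
    · intro h; exact ⟨mem_powerset.1 (hτ i) h, h⟩
  · intros; rfl

noncomputable def yy (S : Finset ℕ) (g : ℕ → ℝ) (R : ℕ) (r : Finset (ℕ × ι)) : ℝ :=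
  if r ⊆ UU ι S ∧ ND r ≤ R then ∏ i, g (NN (comp r i)) else 0

noncomputable def gam (S : Finset ℕ) (b : ℕ → ℝ) (g : ℕ → ℝ) : ℝ := ∑ T ∈ S.powerset, (∏ p ∈ T, b p) * g (NN T)

variable {S : Finset ℕ} {b : ℕ → ℝ} {g : ℕ → ℝ} {R : ℕ}

lemma yy_nonneg (hg : ∀ n, 0 ≤ g n) (r : Finset (ℕ × ι)) : 0 ≤ yy S g R r := by
  unfold yy; split_ifs
  · exact prod_nonneg fun i _ => hg _
  · exact le_rfl

lemma yy_le (hg : ∀ n, 0 ≤ g n) (r : Finset (ℕ × ι)) : yy S g R r ≤ ∏ i, g (NN (comp r i)) := by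
  unfold yy; split_ifs
  · exact le_rfl
  · exact prod_nonneg fun i _ => hg _

lemma ND_mono (hS : ∀ p ∈ S, 1 ≤ p) {r s : Finset (ℕ × ι)} (hs : s ⊆ UU ι S) (h : r ⊆ s) : ND r ≤ ND s :=
  Finset.prod_le_prod_of_subset_of_one_le' h (fun x hx _ => hS x.1 (mem_UU.1 (hs hx)))

lemma yy_mono (hS : ∀ p ∈ S, 1 ≤ p) (hg : ∀ n, 0 ≤ g n) (hga : Antitone g) (r s : Finset (ℕ × ι)) (h : r ⊆ s) :
    yy S g R s ≤ yy S g R r := by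
  by_cases hs : s ⊆ UU ι S ∧ ND s ≤ R
  · have hr : r ⊆ UU ι S ∧ ND r ≤ R := ⟨h.trans hs.1, (ND_mono hS hs.1 h).trans hs.2⟩
    unfold yy
    rw [if_pos hs, if_pos hr]
    apply prod_le_prod (fun i _ => hg _)
    intro i _
    apply hga
    exact NN_le_of_subset (fun p hp => hS p (comp_sub hs.1 i hp)) (comp_mono h i)
  · rw [yy, if_neg hs]
    exact yy_nonneg hg r

lemma S1_main (hb : ∀ p, 0 ≤ b p) (hg : ∀ n, 0 ≤ g n) :
    ∑ r ∈ (UU ι S).powerset, (∏ x ∈ r, b x.1) * yy S g R r ^ 2 ≤ gam S b (fun n => g n ^ 2) ^ Fintype.card ι := by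
  have h : gam S b (fun n => g n ^ 2) ^ Fintype.card ι = ∏ i : ι, ∑ T ∈ S.powerset, (∏ p ∈ T, b p) * g (NN T) ^ 2 := by
    rw [prod_const, card_univ]; rfl
  rw [h, ← sum_comp S (fun _ T => (∏ p ∈ T, b p) * g (NN T) ^ 2)]
  apply sum_le_sum
  intro r _
  rw [prod_mul_distrib, ← comp_prod r b, prod_pow]
  exact mul_le_mul_of_nonneg_left (pow_le_pow_left₀ (yy_nonneg hg r) (yy_le hg r) 2) (prod_nonneg fun x _ => hb _)

lemma gam_nonneg (hb : ∀ p, 0 ≤ b p) (hg : ∀ n, 0 ≤ g n) : 0 ≤ gam S b g :=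
  sum_nonneg fun T _ => mul_nonneg (prod_nonneg fun x _ => hb _) (hg _)

lemma lam_bound (hS : ∀ p ∈ S, 1 ≤ p) (hb : ∀ p, 0 ≤ b p) (hb1 : ∀ p ∈ S, b p ≤ 1) (hg : ∀ n, 0 ≤ g n) (hga : Antitone g)
    (d : Finset (ℕ × ι)) (hd : d ⊆ UU ι S) :
    |lam (UU ι S) (fun x => b x.1) (yy S g R) d| ≤ gam S b g ^ Fintype.card ι * 2 ^ #d := by
  unfold lam
  rw [abs_mul, abs_prod, mul_comm]
  have h1 : ∏ x ∈ d, |(-(1 + b x.1))| ≤ 2 ^ #d := by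
    rw [← prod_const]
    apply prod_le_prod (fun _ _ => abs_nonneg _)
    intro x hx
    have := hb x.1
    have := hb1 x.1 (mem_UU.1 (hd hx))
    rw [abs_neg, abs_of_nonneg (by linarith)]; linarith
  have hnn : ∀ r : Finset (ℕ × ι), 0 ≤ (∏ x ∈ r, b x.1) := fun r => prod_nonneg fun x _ => hb _
  apply mul_le_mul _ h1 (prod_nonneg fun _ _ => abs_nonneg _) (pow_nonneg (gam_nonneg hb hg) _)
  rw [abs_of_nonneg (sum_nonneg fun r _ => mul_nonneg (yy_nonneg hg r) (hnn _))]
  have h : gam S b g ^ Fintype.card ι = ∏ i : ι, ∑ T ∈ S.powerset, (∏ p ∈ T, b p) * g (NN T) := by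
    rw [prod_const, card_univ]; rfl
  rw [h, ← sum_comp S (fun _ T => (∏ p ∈ T, b p) * g (NN T))]
  apply sum_le_sum_inj _ _ (fun r => r \ d)
  · intro r hr
    rw [mem_filter, mem_powerset] at hr
    exact mem_powerset.2 (sdiff_subset.trans hr.1)
  · intro r hr s hs h
    rw [mem_filter] at hr hs
    rw [← sdiff_union_of_subset hr.2, h, sdiff_union_of_subset hs.2]
  · intro r hr
    rw [prod_mul_distrib, ← comp_prod _ b, mul_comm]
    apply mul_le_mul_of_nonneg_left _ (hnn _)
    exact (yy_mono hS hg hga _ _ sdiff_subset).trans (yy_le hg _)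
  · intro r _
    exact prod_nonneg fun i _ => mul_nonneg (prod_nonneg fun x _ => hb _) (hg _)

lemma lam_zero (hS : ∀ p ∈ S, 1 ≤ p) (d : Finset (ℕ × ι)) (h : R < ND d) :
    lam (UU ι S) (fun x => b x.1) (yy S g R) d = 0 := by
  unfold lam
  rw [sum_eq_zero, mul_zero]
  intro r hr
  rw [mem_filter, mem_powerset] at hr
  have := ND_mono hS hr.1 hr.2
  rw [yy, if_neg (by omega), zero_mul]

lemma YM_eq (hS : ∀ p ∈ S, 1 ≤ p) (Zz B : ℕ) (hZB : Zz * B ≤ R) (hgz : ∀ n, Zz < n → g n = 0) (m : ι)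
    (r : Finset (ℕ × ι)) (hr : r ⊆ UM S m) (hrB : ND r ≤ B) :
    YM S b (yy S g R) m r = (∏ i ∈ univ.erase m, g (NN (comp r i))) * gam S b g := by
  unfold YM gam
  rw [mul_sum]
  have hUsub : UM S m ⊆ UU ι S := by rw [UM_VM S m]; exact subset_union_left
  have hVsub : VM S m ⊆ UU ι S := by rw [UM_VM S m]; exact subset_union_right
  symm
  apply sum_bij (fun T _ => T ×ˢ ({m} : Finset ι))
  · intro T hT
    rw [mem_powerset] at hT ⊢
    exact product_subset_product hT subset_rfl
  · intro T _ T' _ h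
    ext p
    have : (p, m) ∈ T ×ˢ ({m} : Finset ι) ↔ (p, m) ∈ T' ×ˢ ({m} : Finset ι) := by rw [h]
    simpa using this
  · intro s hs
    rw [mem_powerset] at hs
    refine ⟨comp s m, mem_powerset.2 (comp_sub (hs.trans hVsub) m), ?_⟩
    ext ⟨p, i⟩
    rw [mem_product, mem_comp, mem_singleton]
    constructor
    · rintro ⟨h1, h2⟩
      simp only at h1 h2
      rw [h2]; exact h1
    · intro h
      have := hs h
      unfold VM at this
      rw [mem_product, mem_singleton] at this
      have h2 : i = m := this.2
      subst h2
      exact ⟨h, rfl⟩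
  · intro T hT
    rw [mem_powerset] at hT
    have hcomp : ∀ i, comp (r ∪ T ×ˢ ({m} : Finset ι)) i = if i = m then T else comp r i := by
      intro i
      ext p
      rw [mem_comp, mem_union, mem_product, mem_singleton]
      split_ifs with h
      · subst h
        constructor
        · rintro (h1 | h1)
          · have := hr h1
            unfold UM at this
            simp at this
          · exact h1.1
        · intro h1; exact Or.inr ⟨h1, rfl⟩
      · rw [mem_comp]
        simp [h]
    have hND : ND (r ∪ T ×ˢ ({m} : Finset ι)) = ND r * NN T := by
      unfold ND NN
      rw [prod_union, prod_product]
      · simp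
      · exact disjoint_of_subset_left hr (disjoint_of_subset_right (product_subset_product hT subset_rfl) (UM_VM_disj S m))
    have hprod : ∏ i, g (NN (comp (r ∪ T ×ˢ ({m} : Finset ι)) i)) = g (NN T) * ∏ i ∈ univ.erase m, g (NN (comp r i)) := by
      rw [← mul_prod_erase univ _ (mem_univ m)]
      simp only [hcomp]
      rw [if_pos trivial]
      congr 1
      apply prod_congr rfl
      intro i hi
      rw [if_neg (ne_of_mem_erase hi)]
    have hbp : ∏ x ∈ T ×ˢ ({m} : Finset ι), b x.1 = ∏ p ∈ T, b p := by
      rw [prod_product]; simp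
    rw [hbp, yy, hprod]
    split_ifs with hc
    · ring
    · have hn : R < ND (r ∪ T ×ˢ ({m} : Finset ι)) := by
        by_contra hh
        exact hc ⟨union_subset (hr.trans hUsub) ((product_subset_product hT subset_rfl).trans hVsub), by omega⟩
      have : Zz < NN T := by
        by_contra hh
        rw [hND] at hn
        have : ND r * NN T ≤ B * Zz := Nat.mul_le_mul hrB (by omega)
        rw [mul_comm] at hZB
        omega
      rw [hgz _ this]; ring

lemma S2_main (hS : ∀ p ∈ S, 1 ≤ p) (hb : ∀ p, 0 ≤ b p) (hg : ∀ n, 0 ≤ g n) (Zz B : ℕ) (hB : 1 < B) (hZB : Zz * B ≤ R)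
    (hgz : ∀ n, Zz < n → g n = 0) (m : ι) (hgam : 0 < gam S b (fun n => g n ^ 2))
    (hdel : (Fintype.card ι : ℝ) * gam S b (fun n => g n ^ 2 * Real.log n) ≤ (1 / 2) * gam S b (fun n => g n ^ 2) * Real.log B) :
    (1 / 2) * gam S b g ^ 2 * gam S b (fun n => g n ^ 2) ^ (Fintype.card ι - 1) ≤
      ∑ r ∈ (UM S m).powerset, (∏ x ∈ r, b x.1) * YM S b (yy S g R) m r ^ 2 := by
  have hlB : 0 < Real.log B := Real.log_pos (by exact_mod_cast hB)
  have hUsub : UM S m ⊆ UU ι S := by rw [UM_VM S m]; exact subset_union_left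
  obtain ⟨G2, hG2⟩ : ∃ x, x = gam S b (fun n => g n ^ 2) := ⟨_, rfl⟩
  obtain ⟨D2, hD2⟩ : ∃ x, x = gam S b (fun n => g n ^ 2 * Real.log n) := ⟨_, rfl⟩
  rw [← hG2, ← hD2] at hdel
  rw [← hG2] at hgam ⊢
  obtain ⟨G, hG⟩ : ∃ G : ι → Finset ℕ → ℝ, G = fun i T => if i = m then (if T = ∅ then 1 else 0) else (∏ p ∈ T, b p) * g (NN T) ^ 2 := ⟨_, rfl⟩
  have hGn : ∀ i T, 0 ≤ G i T := by
    intro i T; rw [hG]; simp only; split_ifs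
    · norm_num
    · norm_num
    · exact mul_nonneg (prod_nonneg fun x _ => hb _) (sq_nonneg _)
  have hNN1 : ∀ r ∈ (UU ι S).powerset, ∀ i, 1 ≤ NN (comp r i) := by
    intro r hr i
    rw [mem_powerset] at hr
    apply Nat.one_le_iff_ne_zero.2
    unfold NN
    rw [prod_ne_zero_iff]
    intro p hp
    have := hS p (comp_sub hr i hp)
    omega
  have hlog : ∀ r ∈ (UU ι S).powerset, Real.log (ND r) = ∑ i, Real.log (NN (comp r i)) := by
    intro r hr
    rw [ND_comp]
    push_cast
    rw [Real.log_prod]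
    intro i _
    have := hNN1 r hr i
    positivity
  have hempty : ∀ r : Finset (ℕ × ι), r ⊆ UU ι S → (r ⊆ UM S m ↔ comp r m = ∅) := by
    intro r hr
    constructor
    · intro h
      rw [eq_empty_iff_forall_notMem]
      intro p hp
      have := h (mem_comp.1 hp)
      unfold UM at this
      simp at this
    · intro h x hx
      unfold UM
      rw [mem_product, mem_erase]
      refine ⟨mem_UU.1 (hr hx), ?_, mem_univ _⟩
      rintro rfl
      have : x.1 ∈ comp r x.2 := mem_comp.2 hx
      rw [h] at this
      simp at this
  have hsumG : ∀ i, ∑ T ∈ S.powerset, G i T = if i = m then 1 else G2 := by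
    intro i
    rw [hG]; simp only
    split_ifs with h
    · rw [sum_ite_eq']
      simp
    · rw [hG2]; rfl
  have htot : ∑ r ∈ (UU ι S).powerset, ∏ i, G i (comp r i) = G2 ^ (Fintype.card ι - 1) := by
    rw [sum_comp]
    simp only [hsumG]
    rw [← mul_prod_erase univ _ (mem_univ m), if_pos rfl, one_mul, prod_congr rfl (fun i hi => by rw [if_neg (ne_of_mem_erase hi)]),
      prod_const, card_erase_of_mem (mem_univ m), card_univ]
  have hlogj : ∀ j, G2 * ∑ r ∈ (UU ι S).powerset, (∏ i, G i (comp r i)) * Real.log (NN (comp r j)) ≤ D2 * G2 ^ (Fintype.card ι - 1) := by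
    intro j
    have e1 : ∀ r : Finset (ℕ × ι), (∏ i, G i (comp r i)) * Real.log (NN (comp r j)) =
        ∏ i, (G i (comp r i) * (if i = j then Real.log (NN (comp r i)) else 1)) := by
      intro r
      rw [prod_mul_distrib]
      congr 1
      rw [prod_ite_eq' univ j (fun i => Real.log (NN (comp r i)))]
      simp
    simp_rw [e1]
    rw [sum_comp S (fun i T => G i T * (if i = j then Real.log (NN T) else 1))]
    have hD0 : 0 ≤ D2 := by
      rw [hD2]; apply gam_nonneg hb
      intro n; exact mul_nonneg (sq_nonneg _) (Real.log_natCast_nonneg n)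
    by_cases hjm : j = m
    · rw [prod_eq_zero (mem_univ j)]
      · rw [mul_zero]; positivity
      · rw [sum_eq_zero]
        intro T _
        rw [hG]; simp only
        rw [if_pos hjm]
        split_ifs with h1
        · simp [h1, NN]
        · simp
    · apply le_of_eq
      rw [← htot, sum_comp, ← mul_prod_erase univ _ (mem_univ j), ← mul_prod_erase univ (fun i => ∑ T ∈ S.powerset, G i T) (mem_univ j)]
      have e2 : ∑ T ∈ S.powerset, G j T * (if j = j then Real.log (NN T) else 1) = D2 := by
        rw [hD2]; unfold gam
        apply sum_congr rfl
        intro T _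
        rw [if_pos rfl, hG]; simp only
        rw [if_neg hjm]; ring
      rw [e2, hsumG j, if_neg hjm]
      have e3 : ∏ i ∈ univ.erase j, ∑ T ∈ S.powerset, G i T * (if i = j then Real.log (NN T) else 1) =
          ∏ i ∈ univ.erase j, ∑ T ∈ S.powerset, G i T := by
        apply prod_congr rfl
        intro i hi
        simp only [if_neg (ne_of_mem_erase hi), mul_one]
      rw [e3]; ring
  -- pointwise
  have hpt : ∀ r ∈ (UU ι S).powerset, gam S b g ^ 2 * ((∏ i, G i (comp r i)) * (1 - Real.log (ND r) / Real.log B)) ≤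
      if r ⊆ UM S m then (∏ x ∈ r, b x.1) * YM S b (yy S g R) m r ^ 2 else 0 := by
    intro r hr
    have hr' := mem_powerset.1 hr
    split_ifs with h
    · have hc := (hempty r hr').1 h
      have hprod : ∏ i, G i (comp r i) = (∏ x ∈ r, b x.1) * (∏ i ∈ univ.erase m, g (NN (comp r i))) ^ 2 := by
        rw [comp_prod r b, ← mul_prod_erase univ _ (mem_univ m), ← mul_prod_erase univ (fun i => ∏ p ∈ comp r i, b p) (mem_univ m), hc, hG]
        simp only [if_true, prod_empty, one_mul]
        rw [← prod_pow, ← prod_mul_distrib]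
        apply prod_congr rfl
        intro i hi
        rw [if_neg (ne_of_mem_erase hi)]
      have hp0 : 0 ≤ ∏ i, G i (comp r i) := prod_nonneg fun i _ => hGn _ _
      by_cases hBr : ND r ≤ B
      · rw [YM_eq hS Zz B hZB hgz m r h hBr]
        have : (∏ x ∈ r, b x.1) * ((∏ i ∈ univ.erase m, g (NN (comp r i))) * gam S b g) ^ 2 = gam S b g ^ 2 * ∏ i, G i (comp r i) := by
          rw [hprod]; ring
        rw [this]
        apply mul_le_mul_of_nonneg_left _ (sq_nonneg _)
        have h1 : 0 ≤ Real.log (ND r) / Real.log B := div_nonneg (Real.log_natCast_nonneg _) hlB.le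
        nlinarith
      · have h1 : 1 ≤ Real.log (ND r) / Real.log B := by
          rw [le_div_iff₀ hlB, one_mul]
          apply Real.log_le_log
          · exact_mod_cast (by omega : 0 < B)
          · exact_mod_cast (by omega : B ≤ ND r)
        have h2 : gam S b g ^ 2 * ((∏ i, G i (comp r i)) * (1 - Real.log (ND r) / Real.log B)) ≤ 0 := by
          apply mul_nonpos_of_nonneg_of_nonpos (sq_nonneg _)
          exact mul_nonpos_of_nonneg_of_nonpos hp0 (by linarith)
        refine h2.trans ?_
        exact mul_nonneg (prod_nonneg fun x _ => hb _) (sq_nonneg _)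
    · have hc : comp r m ≠ ∅ := fun h' => h ((hempty r hr').2 h')
      rw [prod_eq_zero (mem_univ m)]
      · simp
      · rw [hG]; simp [hc]
  have hR : ∑ r ∈ (UM S m).powerset, (∏ x ∈ r, b x.1) * YM S b (yy S g R) m r ^ 2 =
      ∑ r ∈ (UU ι S).powerset, if r ⊆ UM S m then (∏ x ∈ r, b x.1) * YM S b (yy S g R) m r ^ 2 else 0 := by
    rw [← sum_filter]
    apply sum_congr _ (fun _ _ => rfl)
    ext r
    rw [mem_filter, mem_powerset, mem_powerset]
    exact ⟨fun h => ⟨h.trans hUsub, h⟩, fun h => h.2⟩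
  rw [hR]
  refine le_trans ?_ (sum_le_sum hpt)
  rw [← mul_sum, mul_comm (1 / 2 : ℝ), mul_assoc]
  apply mul_le_mul_of_nonneg_left _ (sq_nonneg _)
  have e4 : ∑ r ∈ (UU ι S).powerset, (∏ i, G i (comp r i)) * (1 - Real.log (ND r) / Real.log B) =
      G2 ^ (Fintype.card ι - 1) - (∑ j, ∑ r ∈ (UU ι S).powerset, (∏ i, G i (comp r i)) * Real.log (NN (comp r j))) / Real.log B := by
    rw [← htot, sum_comm, sum_div, ← sum_sub_distrib]
    apply sum_congr rfl
    intro r hr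
    rw [hlog r hr, ← mul_sum]; ring
  rw [e4]
  obtain ⟨X, hX⟩ : ∃ X, X = ∑ j, ∑ r ∈ (UU ι S).powerset, (∏ i, G i (comp r i)) * Real.log (NN (comp r j)) := ⟨_, rfl⟩
  have h5 : G2 * X ≤ Fintype.card ι * (D2 * G2 ^ (Fintype.card ι - 1)) := by
    rw [hX, mul_sum]
    refine (sum_le_sum fun j _ => hlogj j).trans ?_
    simp
  rw [← hX]
  have h6 : X / Real.log B ≤ (1 / 2) * G2 ^ (Fintype.card ι - 1) := by
    rw [div_le_iff₀ hlB]
    have hpos : 0 ≤ G2 ^ (Fintype.card ι - 1) := by positivity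
    have : G2 * X ≤ G2 * ((1 / 2) * G2 ^ (Fintype.card ι - 1) * Real.log B) := by
      nlinarith [mul_le_mul_of_nonneg_right hdel hpos]
    exact le_of_mul_le_mul_left this hgam
  linarith

end comps
end DSR
namespace DSR
open Finset

/-- coprime harmonic sum -/
noncomputable def AC (W u : ℕ) : ℝ := ∑ n ∈ Ico 1 (u+1) with n.Coprime W, 1 / (n:ℝ)

lemma AC_mono (W : ℕ) {u v : ℕ} (h : u ≤ v) : AC W u ≤ AC W v := by
  apply sum_le_sum_of_subset_of_nonneg
  · exact filter_subset_filter _ (Ico_subset_Ico le_rfl (by omega))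
  · intros; positivity

lemma AC_step (W m : ℕ) : AC W ((m+1) * W) = AC W (m * W) + ∑ n ∈ Ico (m * W + 1) (m * W + 1 + W) with n.Coprime W, 1 / (n:ℝ) := by
  unfold AC
  rw [sum_filter, sum_filter, sum_filter, sum_Ico_consecutive _ (by omega : 1 ≤ m * W + 1) (by omega : m * W + 1 ≤ m * W + 1 + W)]
  congr 2
  ring

lemma block_card (W m : ℕ) : #{n ∈ Ico (m * W + 1) (m * W + 1 + W) | n.Coprime W} = W.totient := by
  rw [← Nat.filter_coprime_Ico_eq_totient W (m * W + 1)]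
  congr 1
  ext n
  simp only [mem_filter, Nat.coprime_comm]

lemma AC_lower (W : ℕ) (hW : 1 ≤ W) (m : ℕ) : (W.totient : ℝ) / W * ∑ j ∈ range m, 1 / ((j:ℝ) + 1) ≤ AC W (m * W) := by
  induction m with
  | zero => simp [AC]
  | succ m ih =>
    rw [sum_range_succ, AC_step, mul_add]
    apply add_le_add ih
    have hW0 : (0:ℝ) < W := by exact_mod_cast hW
    have : ∀ n ∈ Ico (m * W + 1) (m * W + 1 + W) |>.filter (fun n => n.Coprime W), 1 / (((m:ℝ) + 1) * W) ≤ 1 / (n:ℝ) := by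
      intro n hn
      rw [mem_filter, mem_Ico] at hn
      have h0 : 0 < n := by omega
      apply one_div_le_one_div_of_le (by exact_mod_cast h0)
      have : n ≤ (m + 1) * W := by nlinarith [hn.1.2]
      exact_mod_cast this
    refine le_trans ?_ (card_nsmul_le_sum _ _ _ this)
    rw [block_card, nsmul_eq_mul]
    apply le_of_eq; field_simp

lemma AC_upper (W : ℕ) (hW : 1 ≤ W) (m : ℕ) : AC W ((m+1) * W) ≤ W.totient + (W.totient : ℝ) / W * ∑ j ∈ range m, 1 / ((j:ℝ) + 1) := by
  have hW0 : (0:ℝ) < W := by exact_mod_cast hW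
  induction m with
  | zero =>
    rw [AC_step]
    have h0 : AC W (0 * W) = 0 := by simp [AC]
    rw [h0, range_zero, sum_empty, mul_zero, zero_add, add_zero]
    have : ∀ n ∈ Ico (0 * W + 1) (0 * W + 1 + W) |>.filter (fun n => n.Coprime W), 1 / (n:ℝ) ≤ 1 := by
      intro n hn
      rw [mem_filter, mem_Ico] at hn
      have h0 : 1 ≤ n := by omega
      rw [div_le_one (by exact_mod_cast h0)]
      exact_mod_cast h0
    refine (sum_le_card_nsmul _ _ _ this).trans ?_
    rw [block_card, nsmul_eq_mul, mul_one]
  | succ m ih =>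
    rw [AC_step, sum_range_succ, mul_add, ← add_assoc]
    apply add_le_add ih
    have : ∀ n ∈ Ico ((m+1) * W + 1) ((m+1) * W + 1 + W) |>.filter (fun n => n.Coprime W), 1 / (n:ℝ) ≤ 1 / (((m:ℝ) + 1) * W) := by
      intro n hn
      rw [mem_filter, mem_Ico] at hn
      apply one_div_le_one_div_of_le (by positivity)
      have : (m + 1) * W ≤ n := by omega
      exact_mod_cast this
    refine (sum_le_card_nsmul _ _ _ this).trans ?_
    rw [block_card, nsmul_eq_mul]
    apply le_of_eq; field_simp

lemma harm_eq (m : ℕ) : ∑ j ∈ range m, 1 / ((j:ℝ) + 1) = ((harmonic m : ℚ) : ℝ) := by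
  unfold harmonic
  push_cast
  apply sum_congr rfl
  intros; rw [one_div]

lemma AC_lower' (W : ℕ) (hW : 1 ≤ W) (u : ℕ) (hu : 2 * ((W:ℝ) + 1) ≤ Real.log u) : (W.totient : ℝ) / W / 2 * Real.log u ≤ AC W u := by
  have hW0 : (0:ℝ) < W := by exact_mod_cast hW
  have hu0 : (0:ℝ) < u := by
    rcases Nat.eq_zero_or_pos u with h | h
    · rw [h] at hu; simp at hu; linarith
    · exact_mod_cast h
  obtain ⟨m, hm⟩ : ∃ m, m = u / W := ⟨_, rfl⟩
  have h1 : m * W ≤ u := by rw [hm]; exact Nat.div_mul_le_self u W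
  have h2 : u < (m + 1) * W := by rw [hm]; rw [mul_comm]; exact Nat.lt_mul_div_succ u hW
  refine le_trans ?_ (AC_mono W h1)
  refine le_trans ?_ (AC_lower W hW m)
  rw [div_mul_eq_mul_div, mul_div_assoc]
  apply mul_le_mul_of_nonneg_left _ (by positivity)
  rw [harm_eq]
  refine le_trans ?_ (log_add_one_le_harmonic m)
  have h3 : Real.log u ≤ Real.log ((m + 1 : ℕ):ℝ) + Real.log W := by
    rw [← Real.log_mul (by positivity) (by positivity)]
    apply Real.log_le_log hu0
    exact_mod_cast h2.le
  have h4 : Real.log W ≤ W - 1 := Real.log_le_sub_one_of_pos hW0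
  linarith

lemma AC_upper' (W : ℕ) (hW : 1 ≤ W) (u : ℕ) (hu : 2 * ((W:ℝ) + 1) ≤ Real.log u) : AC W u ≤ 2 * ((W.totient : ℝ) / W) * Real.log u := by
  have hW0 : (0:ℝ) < W := by exact_mod_cast hW
  have hu0 : 0 < u := by
    rcases Nat.eq_zero_or_pos u with h | h
    · rw [h] at hu; simp at hu; linarith
    · exact h
  obtain ⟨m, hm⟩ : ∃ m, m = u / W := ⟨_, rfl⟩
  have h2 : u < (m + 1) * W := by rw [hm]; rw [mul_comm]; exact Nat.lt_mul_div_succ u hW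
  refine (AC_mono W h2.le).trans ((AC_upper W hW m).trans ?_)
  rw [harm_eq]
  have h3 : ((harmonic m : ℚ) : ℝ) ≤ 1 + Real.log u := by
    refine (harmonic_le_one_add_log m).trans ?_
    rcases Nat.eq_zero_or_pos m with h | h
    · rw [h]; simp; exact Real.log_natCast_nonneg u
    · have : m ≤ u := by rw [hm]; exact Nat.div_le_self u W
      have := Real.log_le_log (by exact_mod_cast h) (by exact_mod_cast this : (m:ℝ) ≤ u)
      linarith
  have h5 : (W.totient : ℝ) = (W.totient : ℝ) / W * W := by field_simp
  have ht : 0 ≤ (W.totient : ℝ) / W := by positivity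
  calc (W.totient : ℝ) + (W.totient : ℝ) / W * ((harmonic m : ℚ) : ℝ) ≤ (W.totient : ℝ) / W * W + (W.totient : ℝ) / W * (1 + Real.log u) :=
        add_le_add h5.le (mul_le_mul_of_nonneg_left h3 ht)
    _ = (W.totient : ℝ) / W * (W + 1 + Real.log u) := by ring
    _ ≤ (W.totient : ℝ) / W * (2 * Real.log u) := by
        apply mul_le_mul_of_nonneg_left _ ht; linarith
    _ = _ := by ring

lemma AC_E (W E u : ℕ) (hE : E = 1 ∨ E.Prime ∧ ¬ E ∣ W) : (1 / 2) * AC W u ≤ AC (W * E) u := by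
  have hA0 : 0 ≤ AC W u := sum_nonneg fun _ _ => by positivity
  rcases hE with rfl | ⟨hE, hEW⟩
  · rw [mul_one]; linarith
  have h1 : AC W u = AC (W * E) u + ∑ n ∈ Ico 1 (u+1) with (n.Coprime W ∧ E ∣ n), 1 / (n:ℝ) := by
    unfold AC
    rw [← sum_filter_add_sum_filter_not ((Ico 1 (u+1)).filter (fun n => n.Coprime W)) (fun n => E ∣ n), add_comm, filter_filter, filter_filter]
    congr 2
    ext n
    simp only [mem_filter]
    rw [Nat.coprime_mul_iff_right, Nat.coprime_comm (m := E), hE.coprime_iff_not_dvd]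
  have h2 : ∑ n ∈ Ico 1 (u+1) with (n.Coprime W ∧ E ∣ n), 1 / (n:ℝ) ≤ (1 / 2) * AC W u := by
    unfold AC
    rw [mul_sum]
    have hE2 := hE.two_le
    apply sum_le_sum_inj _ _ (fun n => n / E)
    · intro n hn
      rw [mem_filter, mem_Ico] at hn ⊢
      obtain ⟨m, rfl⟩ := hn.2.2
      rw [Nat.mul_div_cancel_left _ hE.pos]
      refine ⟨⟨?_, ?_⟩, ?_⟩
      · apply Nat.one_le_iff_ne_zero.2; rintro rfl; simp at hn
      · nlinarith [hn.1.2]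
      · exact (Nat.coprime_mul_iff_left.1 hn.2.1).2
    · intro a ha b hb h
      rw [mem_filter] at ha hb
      obtain ⟨x, rfl⟩ := ha.2.2
      obtain ⟨y, rfl⟩ := hb.2.2
      rw [Nat.mul_div_cancel_left _ hE.pos, Nat.mul_div_cancel_left _ hE.pos] at h
      rw [h]
    · intro n hn
      rw [mem_filter, mem_Ico] at hn
      obtain ⟨m, rfl⟩ := hn.2.2
      rw [Nat.mul_div_cancel_left _ hE.pos]
      have hm : 1 ≤ m := by apply Nat.one_le_iff_ne_zero.2; rintro rfl; simp at hn
      push_cast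
      rw [← one_div_mul_one_div]
      apply mul_le_mul_of_nonneg_right _ (by positivity)
      apply one_div_le_one_div_of_le (by norm_num)
      exact_mod_cast hE2
    · intros; positivity
  linarith

lemma AC_le_GG (R M u : ℕ) (hu : u ≤ R) : AC M u ≤ 2 * GG (SW R M) u (fun p => 1 / p) := by
  have hex : ∀ n ∈ Ico 1 (u+1), ∃ q : ℕ × ℕ, q.2 ^ 2 * q.1 = n ∧ Squarefree q.1 := by
    intro n hn
    obtain ⟨a, b, h⟩ := Nat.sq_mul_squarefree n
    exact ⟨(a, b), h⟩
  choose! q hq1 hq2 using hex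
  have hpos : ∀ n ∈ Ico 1 (u+1), 1 ≤ (q n).1 ∧ 1 ≤ (q n).2 ∧ (q n).1 ≤ u ∧ (q n).2 ≤ u := by
    intro n hn
    have := hq1 n hn
    rw [mem_Ico] at hn
    have h1 : 1 ≤ (q n).1 := by apply Nat.one_le_iff_ne_zero.2; intro h; rw [h] at this; simp at this; omega
    have h2 : 1 ≤ (q n).2 := by apply Nat.one_le_iff_ne_zero.2; intro h; rw [h] at this; simp at this; omega
    refine ⟨h1, h2, ?_, ?_⟩
    · nlinarith [Nat.pow_le_pow_left h2 2]
    · nlinarith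
  have h1 : AC M u ≤ ∑ x ∈ Ico 1 (u+1) ×ˢ ((SW R M).powerset.filter (fun T => NN T ≤ u)), (1 / (x.1:ℝ) ^ 2) * ∏ p ∈ x.2, (1 / (p:ℝ)) := by
    unfold AC
    apply sum_le_sum_inj _ _ (fun n => ((q n).2, (q n).1.primeFactors))
    · intro n hn
      rw [mem_filter] at hn
      obtain ⟨a1, a2, a3, a4⟩ := hpos n hn.1
      have hN : NN (q n).1.primeFactors = (q n).1 := Nat.prod_primeFactors_of_squarefree (hq2 n hn.1)
      rw [mem_product, mem_filter, mem_powerset, mem_Ico]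
      simp only
      refine ⟨⟨a2, by omega⟩, ?_, by rw [hN]; exact a3⟩
      intro p hp
      rw [Nat.mem_primeFactors] at hp
      rw [mem_SW]
      refine ⟨(Nat.le_of_dvd a1 hp.2.1).trans (a3.trans hu), hp.1, ?_⟩
      intro hpM
      have hpn : p ∣ n := by rw [← hq1 n hn.1]; exact hp.2.1.mul_left _
      exact Nat.not_coprime_of_dvd_of_dvd hp.1.one_lt hpn hpM hn.2
    · intro a ha b hb h
      rw [mem_filter] at ha hb
      rw [Prod.mk.injEq] at h
      have e1 : (q a).1 = (q b).1 := by
        rw [← Nat.prod_primeFactors_of_squarefree (hq2 a ha.1), ← Nat.prod_primeFactors_of_squarefree (hq2 b hb.1), h.2]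
      rw [← hq1 a ha.1, ← hq1 b hb.1, h.1, e1]
    · intro n hn
      rw [mem_filter] at hn
      have hN : NN (q n).1.primeFactors = (q n).1 := Nat.prod_primeFactors_of_squarefree (hq2 n hn.1)
      simp only
      rw [prod_div_distrib, prod_const_one, one_div_mul_one_div]
      apply le_of_eq
      congr 1
      rw [← Nat.cast_prod]
      unfold NN at hN
      rw [hN]
      exact_mod_cast (hq1 n hn.1).symm
    · intro x _
      exact mul_nonneg (by positivity) (prod_nonneg fun p _ => by positivity)
  refine h1.trans ?_
  rw [sum_product]
  simp only
  simp_rw [← mul_sum]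
  rw [← sum_mul]
  apply mul_le_mul_of_nonneg_right _ (GG_nonneg _ _ fun p _ => by positivity)
  have : Ico 1 (u+1) = Ioo 0 (u+1) := by ext; simp; omega
  rw [this]
  have := sum_Ioo_inv_sq_le (α := ℝ) 0 (u+1)
  simp only [one_div]
  simpa using this

end DSR
namespace DSR
open Finset

noncomputable def bb (k p : ℕ) : ℝ := if 2 * k < p then 1 / ((p:ℝ) - k) else 0

lemma bb_nonneg (k p : ℕ) : 0 ≤ bb k p := by
  unfold bb; split_ifs with h
  · have : (2 * k : ℝ) < p := by exact_mod_cast h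
    have : (0:ℝ) ≤ k := by positivity
    apply one_div_nonneg.2; linarith
  · exact le_rfl

lemma bb_pos_eq {k p : ℕ} (h : 2 * k < p) : bb k p = 1 / ((p:ℝ) - k) := if_pos h

lemma bb_le_one {k : ℕ} (hk : 1 ≤ k) (p : ℕ) : bb k p ≤ 1 := by
  unfold bb; split_ifs with h
  · have h1 : ((2 * k : ℕ) : ℝ) < p := by exact_mod_cast h
    have h2 : (1:ℝ) ≤ k := by exact_mod_cast hk
    push_cast at h1
    rw [div_le_one (by linarith)]; linarith
  · norm_num

lemma bb_le_two (k p : ℕ) : bb k p ≤ 2 / p := by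
  unfold bb; split_ifs with h
  · have h1 : ((2 * k : ℕ) : ℝ) < p := by exact_mod_cast h
    have h2 : (0:ℝ) ≤ k := by positivity
    push_cast at h1
    rw [div_le_div_iff₀ (by linarith) (by linarith)]; linarith
  · positivity

lemma SW_large {k R W E p : ℕ} (hW : ∀ p, p.Prime → p ≤ 16 * k ^ 2 → p ∣ W) (hp : p ∈ SW R (W * E)) : 16 * k ^ 2 < p := by
  rw [mem_SW] at hp
  by_contra h
  exact hp.2.2 ((hW p hp.2.1 (by omega)).mul_right E)

lemma bb_sq {k : ℕ} (hk : 1 ≤ k) (R W E : ℕ) (hW : ∀ p, p.Prime → p ≤ 16 * k ^ 2 → p ∣ W) :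
    (k:ℝ) ^ 2 * ∑ p ∈ SW R (W * E), bb k p ^ 2 ≤ 1 / 2 := by
  have hk2 : (1:ℝ) ≤ (k:ℝ) ^ 2 := by
    have : (1:ℝ) ≤ k := by exact_mod_cast hk
    nlinarith
  have h1 : ∑ p ∈ SW R (W * E), bb k p ^ 2 ≤ ∑ p ∈ Ioo (16 * k ^ 2) (R + 1), 4 * ((p:ℝ) ^ 2)⁻¹ := by
    calc ∑ p ∈ SW R (W * E), bb k p ^ 2 ≤ ∑ p ∈ SW R (W * E), 4 * ((p:ℝ) ^ 2)⁻¹ := by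
          apply sum_le_sum
          intro p _
          calc bb k p ^ 2 ≤ (2 / p) ^ 2 := pow_le_pow_left₀ (bb_nonneg k p) (bb_le_two k p) 2
            _ = _ := by rw [div_pow]; ring
      _ ≤ _ := by
          apply sum_le_sum_of_subset_of_nonneg
          · intro p hp
            rw [mem_Ioo]
            exact ⟨SW_large hW hp, by have := (mem_SW.1 hp).1; omega⟩
          · intros; positivity
  rw [← mul_sum] at h1
  have h2 := sum_Ioo_inv_sq_le (α := ℝ) (16 * k ^ 2) (R + 1)
  push_cast at h2
  have h3 : (2:ℝ) / (16 * k ^ 2 + 1) ≤ 1 / (8 * k ^ 2) := by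
    rw [div_le_div_iff₀ (by positivity) (by positivity)]; linarith
  calc (k:ℝ) ^ 2 * ∑ p ∈ SW R (W * E), bb k p ^ 2 ≤ (k:ℝ) ^ 2 * (4 * (1 / (8 * k ^ 2))) := by
        apply mul_le_mul_of_nonneg_left _ (by positivity); linarith
    _ = 1 / 2 := by field_simp; norm_num

lemma GG_bb_lower {k : ℕ} (hk : 1 ≤ k) (R W E u : ℕ) (hW1 : 1 ≤ W) (hW : ∀ p, p.Prime → p ≤ 16 * k ^ 2 → p ∣ W) (hE : E = 1 ∨ E.Prime ∧ ¬ E ∣ W)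
    (hu : u ≤ R) (hlog : 2 * ((W:ℝ) + 1) ≤ Real.log u) :
    (W.totient : ℝ) / W / 8 * Real.log u ≤ GG (SW R (W * E)) u (bb k) := by
  have h1 := AC_lower' W hW1 u hlog
  have h2 := AC_E W E u hE
  have h3 := AC_le_GG R (W * E) u hu
  have h4 : GG (SW R (W * E)) u (fun p => 1 / p) ≤ GG (SW R (W * E)) u (bb k) := by
    apply GG_mono _ _ _ (fun p _ => by positivity)
    intro p hp
    have h := SW_large hW hp
    have h5 : 2 * k < p := by nlinarith
    have h1 : ((2 * k : ℕ) : ℝ) < p := by exact_mod_cast h5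
    have h2 : (0:ℝ) ≤ k := by positivity
    push_cast at h1
    rw [bb_pos_eq h5]
    apply one_div_le_one_div_of_le <;> linarith
  linarith

lemma GG_bb_upper {k : ℕ} (hk : 1 ≤ k) (R W E u : ℕ) (hW1 : 1 ≤ W) (hW : ∀ p, p.Prime → p ≤ 16 * k ^ 2 → p ∣ W)
    (hlog : 2 * ((W:ℝ) + 1) ≤ Real.log u) :
    GG (SW R (W * E)) u (bb k) ≤ 4 * ((W.totient : ℝ) / W) * Real.log u := by
  have h1 := AC_upper' W hW1 u hlog
  have hpr : ∀ p ∈ SW R (W * E), p.Prime := fun p hp => (mem_SW.1 hp).2.1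
  have h2 : GG (SW R (W * E)) u (fun p => 1 / p) ≤ AC W u := by
    apply GG_inv_le hpr
    intro p hp h
    exact (mem_SW.1 hp).2.2 (h.mul_right E)
  have hk1 : (1:ℝ) ≤ k := by exact_mod_cast hk
  have h3 : GG (SW R (W * E)) u (bb k) ≤ GG (SW R (W * E)) u (fun p => 1 / p + (k:ℝ) ^ 2 * bb k p ^ 2) := by
    apply GG_mono _ _ _ (fun p _ => bb_nonneg k p)
    intro p hp
    have h := SW_large hW hp
    have h5 : 2 * k < p := by nlinarith
    have h6 : ((2 * k : ℕ) : ℝ) < p := by exact_mod_cast h5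
    push_cast at h6
    rw [bb_pos_eq h5]
    have hx : (0:ℝ) < (p:ℝ) - k := by linarith
    have hp0 : (0:ℝ) < p := by linarith
    have : 1 / ((p:ℝ) - k) - 1 / p = k / (p * (p - k)) := by field_simp; ring
    have h7 : (k:ℝ) / (p * (p - k)) ≤ (k:ℝ) ^ 2 * (1 / ((p:ℝ) - k)) ^ 2 := by
      rw [div_pow, one_pow, mul_one_div, div_le_div_iff₀ (by positivity) (by positivity)]
      have : k * ((p:ℝ) - k) ≤ k ^ 2 * p := by
        nlinarith [mul_nonneg (mul_nonneg (by linarith : (0:ℝ) ≤ k) hp0.le) (sub_nonneg.2 hk1), sq_nonneg (k:ℝ)]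
      nlinarith [mul_le_mul_of_nonneg_right this hx.le]
    linarith
  have h4 := GG_add_le (S := SW R (W * E)) (fun p hp => (hpr p hp).one_le) u (fun p => 1 / (p:ℝ)) (fun p => (k:ℝ) ^ 2 * bb k p ^ 2)
    (fun p _ => by positivity) (fun p _ => by positivity)
  have h5 : GG (SW R (W * E)) u (fun p => (k:ℝ) ^ 2 * bb k p ^ 2) ≤ 2 := by
    calc GG (SW R (W * E)) u (fun p => (k:ℝ) ^ 2 * bb k p ^ 2) ≤ ∑ T ∈ (SW R (W * E)).powerset, ∏ p ∈ T, ((k:ℝ) ^ 2 * bb k p ^ 2) := by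
          apply sum_le_sum_of_subset_of_nonneg (filter_subset _ _)
          intro T _ _
          exact prod_nonneg fun p _ => by positivity
      _ = ∏ p ∈ SW R (W * E), (1 + (k:ℝ) ^ 2 * bb k p ^ 2) := by rw [prod_one_add]
      _ ≤ ∏ p ∈ SW R (W * E), Real.exp ((k:ℝ) ^ 2 * bb k p ^ 2) := by
                apply prod_le_prod
                · intros; positivity
                · intro p _; linarith [Real.add_one_le_exp ((k:ℝ) ^ 2 * bb k p ^ 2)]
      _ = Real.exp ((k:ℝ) ^ 2 * ∑ p ∈ SW R (W * E), bb k p ^ 2) := by rw [← Real.exp_sum, mul_sum]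
      _ ≤ Real.exp (1 / 2) := Real.exp_le_exp.2 (bb_sq hk R W E hW)
      _ ≤ 2 := by
                have h := Real.abs_exp_sub_one_sub_id_le (x := (1/2:ℝ)) (by rw [abs_of_nonneg] <;> norm_num)
                have := (abs_le.1 h).2
                norm_num at this ⊢; linarith
  have h6 : 0 ≤ GG (SW R (W * E)) u (fun p => 1 / (p:ℝ)) := GG_nonneg _ _ fun p _ => by positivity
  calc _ ≤ _ := h3
    _ ≤ _ := h4
    _ ≤ GG (SW R (W * E)) u (fun p => 1 / (p:ℝ)) * 2 := mul_le_mul_of_nonneg_left h5 h6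
    _ ≤ _ := by linarith

noncomputable def gg (J z n : ℕ) : ℝ := ∑ j ∈ range (J+1), (1 / 2 : ℝ) ^ j * (if n ≤ z ^ (2 ^ j) then 1 else 0)

lemma gg_nonneg (J z n : ℕ) : 0 ≤ gg J z n := sum_nonneg fun j _ => mul_nonneg (by positivity) (by split_ifs <;> norm_num)

lemma gg_anti (J z : ℕ) : Antitone (gg J z) := by
  intro a b hab
  apply sum_le_sum
  intro j _
  apply mul_le_mul_of_nonneg_left _ (by positivity)
  split_ifs with h1 h2
  · exact le_rfl
  · omega
  · norm_num
  · exact le_rfl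

lemma gg_zero (J z n : ℕ) (hz : 1 ≤ z) (h : z ^ (2 ^ J) < n) : gg J z n = 0 := by
  apply sum_eq_zero
  intro j hj
  rw [mem_range] at hj
  have : z ^ (2 ^ j) ≤ z ^ (2 ^ J) := Nat.pow_le_pow_right hz (Nat.pow_le_pow_right (by norm_num) (by omega))
  rw [if_neg (by omega), mul_zero]

lemma two_adic_sq (N : ℕ) (e : ℕ → ℝ) (he : ∀ j, e j = 0 ∨ e j = 1) :
    (∑ j ∈ range N, (1 / 2 : ℝ) ^ j * e j) ^ 2 ≤ 4 * ∑ j ∈ range N, (1 / 4 : ℝ) ^ j * e j := by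
  induction N generalizing e with
  | zero => simp
  | succ N ih =>
    have hX2 : ∑ j ∈ range (N+1), (1 / 2 : ℝ) ^ j * e j ≤ 2 := by
      refine le_trans (sum_le_sum fun j _ => ?_) (sum_geometric_two_le (N+1))
      rcases he j with h | h <;> rw [h]
      · rw [mul_zero]; positivity
      · rw [mul_one]
    have hX0 : 0 ≤ ∑ j ∈ range (N+1), (1 / 2 : ℝ) ^ j * e j := by
      apply sum_nonneg; intro j _
      rcases he j with h | h <;> rw [h] <;> positivity
    have hY0 : 0 ≤ ∑ j ∈ range N, (1 / 4 : ℝ) ^ (j+1) * e (j+1) := by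
      apply sum_nonneg; intro j _
      rcases he (j+1) with h | h <;> rw [h] <;> positivity
    rw [sum_range_succ' (fun j => (1 / 4 : ℝ) ^ j * e j)]
    rcases he 0 with h | h
    · rw [sum_range_succ' (fun j => (1 / 2 : ℝ) ^ j * e j), h]
      have := ih (fun j => e (j+1)) (fun j => he _)
      have e1 : ∑ j ∈ range N, (1 / 2 : ℝ) ^ (j+1) * e (j+1) = (1/2) * ∑ j ∈ range N, (1 / 2 : ℝ) ^ j * e (j+1) := by
        rw [mul_sum]; apply sum_congr rfl; intros; ring
      have e2 : ∑ j ∈ range N, (1 / 4 : ℝ) ^ (j+1) * e (j+1) = (1/4) * ∑ j ∈ range N, (1 / 4 : ℝ) ^ j * e (j+1) := by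
        rw [mul_sum]; apply sum_congr rfl; intros; ring
      rw [e1, e2]
      simp only [mul_zero, add_zero]
      nlinarith
    · rw [h]
      simp only [pow_zero, mul_one]
      nlinarith

lemma gg_sq (J z n : ℕ) : gg J z n ^ 2 ≤ 4 * ∑ j ∈ range (J+1), (1 / 4 : ℝ) ^ j * (if n ≤ z ^ (2 ^ j) then 1 else 0) := by
  apply two_adic_sq
  intro j; split_ifs <;> simp

lemma gam_sum (S : Finset ℕ) (b : ℕ → ℝ) (s : Finset ℕ) (c : ℕ → ℝ) (u : ℕ → ℕ) :
    gam S b (fun n => ∑ j ∈ s, c j * (if n ≤ u j then 1 else 0)) = ∑ j ∈ s, c j * GG S (u j) b := by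
  unfold gam GG
  simp_rw [mul_sum]
  rw [sum_comm]
  apply sum_congr rfl
  intro j _
  rw [sum_filter]
  apply sum_congr rfl
  intro T _
  split_ifs <;> ring

lemma gam_mono {S : Finset ℕ} {b g h : ℕ → ℝ} (hb : ∀ p, 0 ≤ b p) (hgh : ∀ T ∈ S.powerset, g (NN T) ≤ h (NN T)) : gam S b g ≤ gam S b h :=
  sum_le_sum fun T hT => mul_le_mul_of_nonneg_left (hgh T hT) (prod_nonneg fun p _ => hb p)

lemma gam_bounds {k : ℕ} (hk : 1 ≤ k) (R W E J z : ℕ) (hW1 : 1 ≤ W) (hW : ∀ p, p.Prime → p ≤ 16 * k ^ 2 → p ∣ W) (hE : E = 1 ∨ E.Prime ∧ ¬ E ∣ W)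
    (hz : 2 * ((W:ℝ) + 1) ≤ Real.log z) (hR : z ^ (2 ^ J) ≤ R) (θ : ℝ) (hθ : θ = (W.totient : ℝ) / W) :
    (J + 1) * (θ / 8 * Real.log z) ≤ gam (SW R (W * E)) (bb k) (gg J z) ∧
    gam (SW R (W * E)) (bb k) (gg J z) ≤ (J + 1) * (4 * θ * Real.log z) ∧
    θ / 8 * Real.log z ≤ gam (SW R (W * E)) (bb k) (fun n => gg J z n ^ 2) ∧
    gam (SW R (W * E)) (bb k) (fun n => gg J z n ^ 2) ≤ 32 * θ * Real.log z ∧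
    gam (SW R (W * E)) (bb k) (fun n => gg J z n ^ 2 * Real.log n) ≤ 16 * (J + 1) * θ * Real.log z ^ 2 := by
  have hb := bb_nonneg k
  have hlz : 0 ≤ Real.log z := Real.log_natCast_nonneg z
  have hW0 : (0:ℝ) < W := by exact_mod_cast hW1
  have hθ0 : 0 ≤ θ := by rw [hθ]; positivity
  have hz1 : 1 ≤ z := by
    apply Nat.one_le_iff_ne_zero.2; rintro rfl; simp at hz; linarith
  have hlog : ∀ j : ℕ, Real.log ((z ^ 2 ^ j : ℕ) : ℝ) = 2 ^ j * Real.log z := by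
    intro j; push_cast; rw [Real.log_pow]; push_cast; ring
  have hlogge : ∀ j : ℕ, 2 * ((W:ℝ) + 1) ≤ Real.log ((z ^ 2 ^ j : ℕ) : ℝ) := by
    intro j; rw [hlog]
    have : (1:ℝ) ≤ 2 ^ j := one_le_pow₀ (by norm_num)
    nlinarith
  have hlow : ∀ j ∈ range (J+1), θ / 8 * (2 ^ j * Real.log z) ≤ GG (SW R (W * E)) (z ^ 2 ^ j) (bb k) := by
    intro j hj
    rw [mem_range] at hj
    have : z ^ (2 ^ j) ≤ z ^ (2 ^ J) := Nat.pow_le_pow_right hz1 (Nat.pow_le_pow_right (by norm_num) (by omega))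
    have := GG_bb_lower hk R W E (z ^ 2 ^ j) hW1 hW hE (this.trans hR) (hlogge j)
    rwa [hlog, ← hθ] at this
  have hup : ∀ j ∈ range (J+1), GG (SW R (W * E)) (z ^ 2 ^ j) (bb k) ≤ 4 * θ * (2 ^ j * Real.log z) := by
    intro j hj
    have := GG_bb_upper hk R W E (z ^ 2 ^ j) hW1 hW (hlogge j)
    rwa [hlog, ← hθ] at this
  have e12 : ∀ j : ℕ, (1 / 2 : ℝ) ^ j * 2 ^ j = 1 := by intro j; rw [← mul_pow]; norm_num
  have e42 : ∀ j : ℕ, (1 / 4 : ℝ) ^ j * 2 ^ j = (1 / 2) ^ j := by intro j; rw [← mul_pow]; norm_num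
  have e44 : ∀ j : ℕ, (1 / 4 : ℝ) ^ j * 2 ^ j * 2 ^ j = 1 := by intro j; rw [e42, e12]
  have hG : gam (SW R (W * E)) (bb k) (gg J z) = ∑ j ∈ range (J+1), (1 / 2 : ℝ) ^ j * GG (SW R (W * E)) (z ^ 2 ^ j) (bb k) :=
    gam_sum _ _ _ _ _
  refine ⟨?_, ?_, ?_, ?_, ?_⟩
  · rw [hG]
    have : ∑ j ∈ range (J+1), θ / 8 * Real.log z = (J + 1) * (θ / 8 * Real.log z) := by
      rw [sum_const, card_range, nsmul_eq_mul]; push_cast; ring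
    rw [← this]
    apply sum_le_sum
    intro j hj
    calc θ / 8 * Real.log z = ((1 / 2 : ℝ) ^ j * 2 ^ j) * (θ / 8 * Real.log z) := by rw [e12, one_mul]
      _ = (1 / 2 : ℝ) ^ j * (θ / 8 * (2 ^ j * Real.log z)) := by ring
      _ ≤ _ := mul_le_mul_of_nonneg_left (hlow j hj) (by positivity)
  · rw [hG]
    have : ∑ j ∈ range (J+1), 4 * θ * Real.log z = (J + 1) * (4 * θ * Real.log z) := by
      rw [sum_const, card_range, nsmul_eq_mul]; push_cast; ring
    rw [← this]
    apply sum_le_sum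
    intro j hj
    calc _ ≤ (1 / 2 : ℝ) ^ j * (4 * θ * (2 ^ j * Real.log z)) := mul_le_mul_of_nonneg_left (hup j hj) (by positivity)
      _ = ((1 / 2 : ℝ) ^ j * 2 ^ j) * (4 * θ * Real.log z) := by ring
      _ = _ := by rw [e12, one_mul]
  · have h0 := hlow 0 (by simp)
    simp only [pow_zero, pow_one, one_mul] at h0
    refine h0.trans ?_
    have e0 : GG (SW R (W * E)) z (bb k) = gam (SW R (W * E)) (bb k) (fun n => ∑ j ∈ range 1, (1:ℝ) * (if n ≤ z then 1 else 0)) := by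
      rw [gam_sum (SW R (W * E)) (bb k) (range 1) (fun _ => 1) (fun _ => z)]; simp
    rw [e0]
    apply gam_mono hb
    intro T _
    simp only [sum_range_one, one_mul]
    split_ifs with h
    · have : 1 ≤ gg J z (NN T) := by
        unfold gg
        rw [sum_range_succ']
        simp only [pow_zero, one_mul, pow_one, if_pos h]
        have : 0 ≤ ∑ j ∈ range J, (1 / 2 : ℝ) ^ (j+1) * (if NN T ≤ z ^ (2 ^ (j+1)) then 1 else 0) :=
          sum_nonneg fun j _ => mul_nonneg (by positivity) (by split_ifs <;> norm_num)
        linarith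
      nlinarith
    · positivity
  · calc gam (SW R (W * E)) (bb k) (fun n => gg J z n ^ 2) ≤
        gam (SW R (W * E)) (bb k) (fun n => ∑ j ∈ range (J+1), (4 * (1 / 4 : ℝ) ^ j) * (if n ≤ z ^ (2 ^ j) then 1 else 0)) := by
          apply gam_mono hb
          intro T _
          refine (gg_sq J z _).trans (le_of_eq ?_)
          rw [mul_sum]; apply sum_congr rfl; intros; ring
      _ = ∑ j ∈ range (J+1), (4 * (1 / 4 : ℝ) ^ j) * GG (SW R (W * E)) (z ^ 2 ^ j) (bb k) := gam_sum _ _ _ _ _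
      _ ≤ ∑ j ∈ range (J+1), (4 * (1 / 4 : ℝ) ^ j) * (4 * θ * (2 ^ j * Real.log z)) :=
          sum_le_sum fun j hj => mul_le_mul_of_nonneg_left (hup j hj) (by positivity)
      _ = 16 * θ * Real.log z * ∑ j ∈ range (J+1), (1 / 2 : ℝ) ^ j := by
          rw [mul_sum]; apply sum_congr rfl; intro j _; rw [← e42]; ring
      _ ≤ 16 * θ * Real.log z * 2 := mul_le_mul_of_nonneg_left (sum_geometric_two_le _) (by positivity)
      _ = _ := by ring
  · calc gam (SW R (W * E)) (bb k) (fun n => gg J z n ^ 2 * Real.log n) ≤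
        gam (SW R (W * E)) (bb k) (fun n => ∑ j ∈ range (J+1), (4 * (1 / 4 : ℝ) ^ j * (2 ^ j * Real.log z)) * (if n ≤ z ^ (2 ^ j) then 1 else 0)) := by
          apply gam_mono hb
          intro T hT
          have hNT : 0 < NN T := NN_pos fun p hp => (mem_SW.1 (mem_powerset.1 hT hp)).2.1
          refine (mul_le_mul_of_nonneg_right (gg_sq J z _) (Real.log_natCast_nonneg _)).trans ?_
          rw [mul_sum, sum_mul]
          apply sum_le_sum
          intro j _
          split_ifs with h
          · have : Real.log (NN T) ≤ 2 ^ j * Real.log z := by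
              rw [← hlog]
              exact Real.log_le_log (by exact_mod_cast hNT) (by exact_mod_cast h)
            simp only [mul_one]
            exact mul_le_mul_of_nonneg_left this (by positivity)
          · simp
      _ = ∑ j ∈ range (J+1), (4 * (1 / 4 : ℝ) ^ j * (2 ^ j * Real.log z)) * GG (SW R (W * E)) (z ^ 2 ^ j) (bb k) := gam_sum _ _ _ _ _
      _ ≤ ∑ j ∈ range (J+1), (4 * (1 / 4 : ℝ) ^ j * (2 ^ j * Real.log z)) * (4 * θ * (2 ^ j * Real.log z)) :=
          sum_le_sum fun j hj => mul_le_mul_of_nonneg_left (hup j hj) (by positivity)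
      _ = ∑ j ∈ range (J+1), 16 * θ * Real.log z ^ 2 := by
          apply sum_congr rfl; intro j _
          calc _ = ((1 / 4 : ℝ) ^ j * 2 ^ j * 2 ^ j) * (16 * θ * Real.log z ^ 2) := by ring
            _ = _ := by rw [e44, one_mul]
      _ = _ := by rw [sum_const, card_range, nsmul_eq_mul]; push_cast; ring

end DSR
namespace DSR
open Finset
open ArithmeticFunction (vonMangoldt)

lemma log_fact (N : ℕ) : ∑ n ∈ Ioc 0 N, vonMangoldt n * ((N / n : ℕ) : ℝ) = Real.log (N.factorial) := by
  have h := ArithmeticFunction.sum_Ioc_mul_zeta_eq_sum (vonMangoldt) N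
  rw [ArithmeticFunction.vonMangoldt_mul_zeta] at h
  rw [← h]
  induction N with
  | zero => simp
  | succ N ih =>
    have : Ioc 0 (N+1) = insert (N+1) (Ioc 0 N) := by ext; simp; omega
    rw [this, sum_insert (by simp), ih (ArithmeticFunction.sum_Ioc_mul_zeta_eq_sum (vonMangoldt) N ▸ by rw [ArithmeticFunction.vonMangoldt_mul_zeta]), Nat.factorial_succ]
    push_cast
    rw [Real.log_mul (by positivity) (by positivity)]
    simp [ArithmeticFunction.log_apply]

lemma mertens_lower {N : ℕ} (hN : 1 ≤ N) : Real.log N - 1 ≤ ∑ n ∈ Ioc 0 N, vonMangoldt n / n := by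
  have hN0 : (0:ℝ) < N := by exact_mod_cast hN
  have h1 : Real.log (N.factorial) ≤ N * ∑ n ∈ Ioc 0 N, vonMangoldt n / n := by
    rw [← log_fact, mul_sum]
    refine sum_le_sum fun n hn => ?_
    have : ((N / n : ℕ) : ℝ) ≤ (N:ℝ) / n := Nat.cast_div_le
    calc _ ≤ vonMangoldt n * ((N:ℝ)/n) := mul_le_mul_of_nonneg_left this ArithmeticFunction.vonMangoldt_nonneg
      _ = _ := by ring
  have h2 : N * Real.log N - N ≤ Real.log (N.factorial) := by
    have := Real.pow_div_factorial_le_exp (x := N) hN0.le N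
    have h3 := Real.log_le_log (by positivity) this
    rw [Real.log_exp, Real.log_div (by positivity) (by positivity), Real.log_pow] at h3
    linarith
  have h3 : N * (Real.log N - 1) ≤ N * ∑ n ∈ Ioc 0 N, vonMangoldt n / n := by linarith
  exact le_of_mul_le_mul_left h3 hN0

lemma mertens_upper {N : ℕ} (hN : 1 ≤ N) : ∑ n ∈ Ioc 0 N, vonMangoldt n / n ≤ Real.log N + 6 := by
  have hN0 : (0:ℝ) < N := by exact_mod_cast hN
  have hpsi : ∑ n ∈ Ioc 0 N, vonMangoldt n ≤ 6 * N := by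
    have := Chebyshev.psi_le_const_mul_self (x := N) hN0.le
    rw [Chebyshev.psi, Nat.floor_natCast] at this
    have h4 : Real.log 4 ≤ 2 := by
      rw [show (4:ℝ) = 2^2 by norm_num, Real.log_pow]; push_cast; linarith [Real.log_two_lt_d9]
    nlinarith
  have h1 : N * ∑ n ∈ Ioc 0 N, vonMangoldt n / n ≤ Real.log (N.factorial) + ∑ n ∈ Ioc 0 N, vonMangoldt n := by
    rw [← log_fact, mul_sum, ← sum_add_distrib]
    refine sum_le_sum fun n hn => ?_
    rw [mem_Ioc] at hn
    have hn0 : (0:ℝ) < n := by exact_mod_cast hn.1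
    have : (N:ℝ) / n ≤ ((N / n : ℕ) : ℝ) + 1 := by
      rw [div_le_iff₀ hn0]
      have := Nat.lt_mul_div_succ N hn.1
      have h : (N:ℝ) < n * ((N/n : ℕ) + 1) := by exact_mod_cast this
      linarith
    calc _ = vonMangoldt n * ((N:ℝ)/n) := by ring
      _ ≤ vonMangoldt n * (((N / n : ℕ) : ℝ) + 1) := mul_le_mul_of_nonneg_left this ArithmeticFunction.vonMangoldt_nonneg
      _ = _ := by ring
  have h2 : Real.log (N.factorial) ≤ N * Real.log N := by
    rw [← Real.log_pow]
    apply Real.log_le_log (by positivity)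
    exact_mod_cast Nat.factorial_le_pow N
  have h3 : N * ∑ n ∈ Ioc 0 N, vonMangoldt n / n ≤ N * (Real.log N + 6) := by linarith
  exact le_of_mul_le_mul_left h3 hN0

lemma T0_lower : ∀ᶠ R : ℕ in Filter.atTop, Real.log R ≤ T0 R := by
  obtain ⟨C, hC, hpp⟩ := pp_nu
  filter_upwards [Filter.eventually_ge_atTop 3, log_tendsto.eventually_ge_atTop (C + 7)] with R hR hl
  have hR0 : (0:ℝ) < R := by exact_mod_cast (by omega)
  have hlog := one_le_log hR
  have h1 := hpp R hR
  have h2 : C / (R:ℝ)^58 ≤ C := div_le_self hC.le (one_le_pow₀ (by exact_mod_cast (by omega)))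
  have h3 : ∑ n ∈ range (R^240), (vonMangoldt n - vp n) * nu R n = ∑ n ∈ range (R^240), vonMangoldt n * nu R n - T0 R := by
    rw [T0, ← sum_sub_distrib]; exact sum_congr rfl fun n _ => by ring
  have hle : R^150 ≤ R^210 := Nat.pow_le_pow_right (by omega) (by norm_num)
  have hlt : R^210 < R^240 := Nat.pow_lt_pow_right (by omega) (by norm_num)
  have h4 : ∑ n ∈ Ioc 0 (R^210) \ Ioc 0 (R^150), vonMangoldt n / n ≤ ∑ n ∈ range (R^240), vonMangoldt n * nu R n := by
    rw [← sum_subset (s₁ := Ioc 0 (R^210) \ Ioc 0 (R^150)) (s₂ := Ioc 0 (R^210) \ Ioc 0 (R^150)) (subset_refl _) (fun x h h' => absurd h h')]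
    calc _ ≤ ∑ n ∈ Ioc 0 (R^210) \ Ioc 0 (R^150), vonMangoldt n * nu R n := by
          refine sum_le_sum fun n hn => ?_
          simp only [mem_sdiff, mem_Ioc, not_and, not_le] at hn
          have hn1 : R^150 < n := hn.2 hn.1.1
          have hn0 : (0:ℝ) < n := by exact_mod_cast hn.1.1
          have a1 : Real.log ((R:ℝ)^150) ≤ Real.log n := Real.log_le_log (by positivity) (by exact_mod_cast hn1.le)
          have a2 : Real.log n ≤ Real.log ((R:ℝ)^210) := Real.log_le_log (by positivity) (by exact_mod_cast hn.1.2)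
          rw [Real.log_pow] at a1 a2
          push_cast at a1 a2
          have hL : 0 < LL R := by unfold LL; linarith
          rw [nu, F_one]
          · apply le_of_eq; ring
          · rw [le_div_iff₀ hL]; unfold LL; linarith
          · rw [div_le_iff₀ hL]; unfold LL; linarith
      _ ≤ _ := by
          apply sum_le_sum_of_subset_of_nonneg
          · intro n hn
            simp only [mem_sdiff, mem_Ioc] at hn
            rw [mem_range]; omega
          · intro n _ _
            exact mul_nonneg ArithmeticFunction.vonMangoldt_nonneg (nu_nonneg _ _)
  rw [sum_sdiff_eq_sub (Ioc_subset_Ioc_right hle)] at h4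
  have m1 := mertens_lower (N := R^210) (Nat.one_le_pow _ _ (by omega))
  have m2 := mertens_upper (N := R^150) (Nat.one_le_pow _ _ (by omega))
  rw [Nat.cast_pow, Real.log_pow] at m1 m2
  push_cast at m1 m2
  linarith

noncomputable def X0 (R : ℕ) : ℝ := ∑ n ∈ range (R^240), nu R n

lemma X0_nonneg (R : ℕ) : 0 ≤ X0 R := sum_nonneg fun n _ => nu_nonneg R n

lemma X0_upper {R : ℕ} (hR : 3 ≤ R) : X0 R ≤ 241 * Real.log R := by
  have hlog := one_le_log hR
  have h := inv_sum_log (R^240)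
  rw [Nat.cast_pow, Real.log_pow] at h
  push_cast at h
  have : X0 R ≤ ∑ n ∈ Ico 1 (R^240), 1 / (n:ℝ) := by
    unfold X0
    rw [range_eq_Ico, ← sum_subset (s₁ := Ico 1 (R^240))]
    · exact sum_le_sum fun n _ => nu_le R n
    · intro x hx; simp at hx ⊢; omega
    · intro x hx hx'
      simp at hx hx'
      have : x = 0 := by omega
      subst this
      simp [nu]
  linarith

end DSR
namespace DSR
open Finset
set_option linter.unusedSectionVars false

section
variable {ι : Type*} [Fintype ι] [DecidableEq ι]

def Om (S : Finset ℕ) (h : ι → ℕ) (n : ℕ) : Finset (ℕ × ι) := (UU ι S).filter (fun x => x.1 ∣ n + h x.2)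

lemma sub_Om {S : Finset ℕ} {h : ι → ℕ} {n : ℕ} {D : Finset (ℕ × ι)} (hD : D ⊆ UU ι S) :
    D ⊆ Om S h n ↔ ∀ x ∈ D, x.1 ∣ n + h x.2 := by
  constructor
  · intro hh x hx
    exact (mem_filter.1 (hh hx)).2
  · intro hh x hx
    exact mem_filter.2 ⟨hD hx, hh x hx⟩

lemma Om_ok {S : Finset ℕ} {h : ι → ℕ} {n W : ℕ} {D : Finset (ℕ × ι)} (hS : ∀ p ∈ S, p.Prime ∧ ¬ p ∣ W)
    (hH : ∀ i j p, p.Prime → ¬ p ∣ W → h i ≡ h j [MOD p] → i = j) (hD : D ⊆ Om S h n) : ok D := by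
  intro x hx y hy hxy
  have h1 := mem_filter.1 (hD hx)
  have h2 := mem_filter.1 (hD hy)
  have hp := hS _ (mem_UU.1 h1.1)
  have h3 : x.2 = y.2 := by
    apply hH _ _ x.1 hp.1 hp.2
    have a1 := (Nat.modEq_zero_iff_dvd.2 h1.2)
    have a2 := (Nat.modEq_zero_iff_dvd.2 h2.2)
    rw [← hxy] at a2
    exact Nat.ModEq.add_left_cancel' n (a1.trans a2.symm)
  exact Prod.ext hxy h3

lemma W_coprime_ND {S : Finset ℕ} {W : ℕ} {D : Finset (ℕ × ι)} (hS : ∀ p ∈ S, p.Prime ∧ ¬ p ∣ W)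
    (hD : D ⊆ UU ι S) : W.Coprime (ND D) := by
  unfold ND
  apply Nat.Coprime.prod_right
  intro x hx
  have := hS _ (mem_UU.1 (hD hx))
  exact ((Nat.Prime.coprime_iff_not_dvd this.1).2 this.2).symm

lemma Om_crt {S : Finset ℕ} {W : ℕ} (hS : ∀ p ∈ S, p.Prime ∧ ¬ p ∣ W) (h : ι → ℕ) (v : ℕ) (D : Finset (ℕ × ι)) (hD : D ⊆ UU ι S)
    (hok : ok D) : ∃ a, ∀ n, (n ≡ v [MOD W] ∧ D ⊆ Om S h n) ↔ n ≡ a [MOD W * ND D] := by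
  suffices H : ∃ a, ∀ n, (n ≡ v [MOD W] ∧ ∀ x ∈ D, x.1 ∣ n + h x.2) ↔ n ≡ a [MOD W * ND D] by
    obtain ⟨a, ha⟩ := H
    exact ⟨a, fun n => by rw [sub_Om hD]; exact ha n⟩
  induction D using Finset.induction_on with
  | empty => exact ⟨v, fun n => by simp [ND]⟩
  | insert x D hx ih =>
    have hDs : D ⊆ UU ι S := (subset_insert _ _).trans hD
    have hokD : ok D := fun a ha b hb hab => hok a (mem_insert_of_mem ha) b (mem_insert_of_mem hb) hab
    obtain ⟨a, ha⟩ := ih hDs hokD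
    have hxp := hS _ (mem_UU.1 (hD (mem_insert_self x D)))
    have hcop : (W * ND D).Coprime x.1 := by
      apply Nat.Coprime.mul_left
      · exact ((Nat.Prime.coprime_iff_not_dvd hxp.1).2 hxp.2).symm
      · unfold ND
        apply Nat.Coprime.prod_left
        intro y hy
        have hyp := hS _ (mem_UU.1 (hDs hy))
        rw [Nat.coprime_primes hyp.1 hxp.1]
        intro hxy
        have := hok y (mem_insert_of_mem hy) x (mem_insert_self _ _) hxy
        exact hx (this ▸ hy)
    obtain ⟨c, hc⟩ : ∃ c, ∀ n, x.1 ∣ n + h x.2 ↔ n ≡ c [MOD x.1] := by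
      have hpos := hxp.1.pos
      refine ⟨h x.2 * (x.1 - 1), fun n => ?_⟩
      have e : h x.2 * (x.1 - 1) + h x.2 = h x.2 * x.1 := by
        obtain ⟨q, hq⟩ : ∃ q, x.1 = q + 1 := ⟨x.1 - 1, by omega⟩
        rw [hq]; simp; ring
      constructor
      · intro hn
        apply Nat.ModEq.add_right_cancel' (h x.2)
        rw [e]
        exact (Nat.modEq_zero_iff_dvd.2 hn).trans (Nat.modEq_zero_iff_dvd.2 (dvd_mul_left _ _)).symm
      · intro hn
        have := hn.add_right (h x.2)
        rw [e] at this
        exact Nat.modEq_zero_iff_dvd.1 (this.trans (Nat.modEq_zero_iff_dvd.2 (dvd_mul_left _ _)))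
    refine ⟨(Nat.chineseRemainder hcop a c : ℕ), fun n => ?_⟩
    have hcr := (Nat.chineseRemainder hcop a c).2
    have hnd : W * ND (insert x D) = W * ND D * x.1 := by
      unfold ND; rw [prod_insert hx]; ring
    rw [hnd, ← Nat.modEq_and_modEq_iff_modEq_mul hcop]
    have e0 : (n ≡ v [MOD W] ∧ ∀ y ∈ insert x D, y.1 ∣ n + h y.2) ↔
        ((n ≡ v [MOD W] ∧ ∀ y ∈ D, y.1 ∣ n + h y.2) ∧ x.1 ∣ n + h x.2) := by
      rw [forall_mem_insert]; tauto
    rw [e0, ha, hc]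
    constructor
    · rintro ⟨h1, h2⟩
      exact ⟨h1.trans hcr.1.symm, h2.trans hcr.2.symm⟩
    · rintro ⟨h1, h2⟩
      exact ⟨h1.trans hcr.1, h2.trans hcr.2⟩

lemma PP_one {S : Finset ℕ} (hS2 : ∀ p ∈ S, 2 * Fintype.card ι < p) (D : Finset (ℕ × ι)) (hD : D ⊆ UU ι S) (hok : ok D) :
    PP (fun x : ℕ × ι => bb (Fintype.card ι) x.1) D = 1 / (ND D : ℝ) := by
  unfold PP ND
  rw [if_pos hok]
  push_cast
  rw [one_div, ← prod_inv_distrib]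
  apply prod_congr rfl
  intro x hx
  have h1 := hS2 _ (mem_UU.1 (hD hx))
  have h2 : ((2 * Fintype.card ι : ℕ) : ℝ) < x.1 := by exact_mod_cast h1
  push_cast at h2
  have h3 : (0:ℝ) ≤ Fintype.card ι := by positivity
  simp only [sum_const, card_univ, nsmul_eq_mul]
  rw [bb_pos_eq h1]
  have : (x.1:ℝ) - Fintype.card ι ≠ 0 := by intro h; linarith
  have h6 : (x.1:ℝ) ≠ 0 := by intro h; linarith
  have h7 : 1 + (Fintype.card ι : ℝ) * (1 / ((x.1:ℝ) - Fintype.card ι)) = (x.1:ℝ) / ((x.1:ℝ) - Fintype.card ι) := by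
    field_simp; ring
  rw [h7]
  field_simp

lemma PP_kap {S : Finset ℕ} (hS2 : ∀ p ∈ S, p.Prime ∧ 2 * Fintype.card ι < p) (m : ι) (D : Finset (ℕ × ι)) (hD : D ⊆ UU ι S) (hok : ok D)
    (hm : ∀ x ∈ D, x.2 ≠ m) :
    PP (kap (bb (Fintype.card ι)) m) D = 1 / ((ND D).totient : ℝ) := by
  have hk : 1 ≤ Fintype.card ι := Fintype.card_pos_iff.2 ⟨m⟩
  rw [ok_ND hok, totient_NN, prod_image (fun x hx y hy hxy => hok x hx y hy hxy)]
  · unfold PP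
    rw [if_pos hok, one_div, ← prod_inv_distrib]
    apply prod_congr rfl
    intro x hx
    have h1 := (hS2 _ (mem_UU.1 (hD hx))).2
    have h2 : ((2 * Fintype.card ι : ℕ) : ℝ) < x.1 := by exact_mod_cast h1
    push_cast at h2
    have h3 : (1:ℝ) ≤ Fintype.card ι := by exact_mod_cast hk
    rw [kap_sum, kap, if_neg (hm x hx), bb_pos_eq h1, Nat.cast_sub hk]
    have : (x.1:ℝ) - Fintype.card ι ≠ 0 := by intro h; linarith
    have h5 : (x.1:ℝ) - 1 ≠ 0 := by intro h; linarith
    have : 1 + ((Fintype.card ι : ℝ) - (1:ℕ)) * (1 / ((x.1:ℝ) - Fintype.card ι)) = ((x.1:ℝ) - 1) / ((x.1:ℝ) - Fintype.card ι) := by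
      field_simp; push_cast; ring
    rw [this]
    field_simp
  · intro p hp
    rw [mem_image] at hp
    obtain ⟨x, hx, rfl⟩ := hp
    exact (hS2 _ (mem_UU.1 (hD hx))).1

lemma PP_kap_zero (m : ι) (b : ℕ → ℝ) (D : Finset (ℕ × ι)) (x : ℕ × ι) (hx : x ∈ D) (hm : x.2 = m) :
    PP (kap b m) D = 0 := by
  unfold PP
  split_ifs
  · apply prod_eq_zero hx
    simp [kap, hm]
  · rfl

end
end DSR
namespace DSR
open Finset
set_option linter.unusedSectionVars false

lemma nu_class : ∃ C : ℝ, 0 < C ∧ ∀ R q a : ℕ, 3 ≤ R → 0 < q →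
    |∑ n ∈ range (R^240) with n ≡ a [MOD q], nu R n - X0 R / q| ≤ C / (R:ℝ)^120 := by
  obtain ⟨C, hC, h⟩ := nu_var
  refine ⟨C, hC, fun R q a hR hq => ?_⟩
  have h1 := class_sum_bound hq a (fun n => ((nu R n : ℝ) : ℂ)) (R^240)
  rw [nu_eq_zero hR (Or.inr le_rfl)] at h1
  have h2 : ∑ n ∈ range (R^240), ‖((nu R (n+1) : ℝ) : ℂ) - ((nu R n : ℝ) : ℂ)‖ ≤ C / (R:ℝ)^120 := by
    refine le_trans (le_of_eq ?_) (h R (R^240) hR)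
    apply sum_congr rfl
    intro n _
    rw [← Complex.ofReal_sub, Complex.norm_real, Real.norm_eq_abs]
  have h3 : ((∑ n ∈ range (R^240) with n ≡ a [MOD q], ((nu R n : ℝ) : ℂ)) - (1 / q) * ∑ n ∈ range (R^240), ((nu R n : ℝ) : ℂ)) =
      ((∑ n ∈ range (R^240) with n ≡ a [MOD q], nu R n - X0 R / q : ℝ) : ℂ) := by
    unfold X0; push_cast; ring
  simp only [Complex.ofReal_zero, norm_zero, zero_add] at h1
  rw [h3, Complex.norm_real, Real.norm_eq_abs] at h1
  exact h1.trans h2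

noncomputable def wS (R H n : ℕ) : ℝ := nu R n + ∑ j ∈ range H, |nu R (n+j+1) - nu R (n+j)|

lemma wS_ge (R : ℕ) {H h : ℕ} (n : ℕ) (hh : h ≤ H) : nu R (n+h) ≤ wS R H n := by
  have h1 : nu R (n+h) - nu R n = ∑ j ∈ range h, (nu R (n+j+1) - nu R (n+j)) := by
    have := sum_range_sub (fun j => nu R (n+j)) h
    simp only [add_zero] at this
    rw [← this]; rfl
  have h2 : ∑ j ∈ range h, (nu R (n+j+1) - nu R (n+j)) ≤ ∑ j ∈ range H, |nu R (n+j+1) - nu R (n+j)| := by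
    calc _ ≤ ∑ j ∈ range h, |nu R (n+j+1) - nu R (n+j)| := sum_le_sum fun j _ => le_abs_self _
      _ ≤ _ := sum_le_sum_of_subset_of_nonneg (range_subset_range.2 hh) fun _ _ _ => abs_nonneg _
  unfold wS; linarith

lemma wS_nonneg (R H n : ℕ) : 0 ≤ wS R H n :=
  add_nonneg (nu_nonneg _ _) (sum_nonneg fun _ _ => abs_nonneg _)

lemma wS_class : ∃ C : ℝ, 0 < C ∧ ∀ R H q a : ℕ, 3 ≤ R → 0 < q →
    |∑ n ∈ range (R^240) with n ≡ a [MOD q], wS R H n - X0 R / q| ≤ C * (H + 1) / (R:ℝ)^120 := by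
  obtain ⟨C1, hC1, h1⟩ := nu_class
  obtain ⟨C, hC, h⟩ := nu_var
  refine ⟨C1 + C, by positivity, fun R H q a hR hq => ?_⟩
  have hR0 : (0:ℝ) < (R:ℝ)^120 := by
    have : (0:ℝ) < R := by exact_mod_cast (by omega)
    positivity
  have e : ∑ n ∈ range (R^240) with n ≡ a [MOD q], wS R H n - X0 R / q =
      (∑ n ∈ range (R^240) with n ≡ a [MOD q], nu R n - X0 R / q) +
      ∑ n ∈ range (R^240) with n ≡ a [MOD q], ∑ j ∈ range H, |nu R (n+j+1) - nu R (n+j)| := by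
    unfold wS; rw [sum_add_distrib]; ring
  have h2 : ∑ n ∈ range (R^240) with n ≡ a [MOD q], ∑ j ∈ range H, |nu R (n+j+1) - nu R (n+j)| ≤ H * (C / (R:ℝ)^120) := by
    rw [sum_comm]
    have : ∀ j ∈ range H, ∑ n ∈ range (R^240) with n ≡ a [MOD q], |nu R (n+j+1) - nu R (n+j)| ≤ C / (R:ℝ)^120 := by
      intro j _
      refine le_trans ?_ (h R (R^240 + j) hR)
      calc _ ≤ ∑ n ∈ range (R^240), |nu R (n+j+1) - nu R (n+j)| :=
            sum_le_sum_of_subset_of_nonneg (filter_subset _ _) fun _ _ _ => abs_nonneg _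
        _ = ∑ n ∈ (range (R^240)).image (fun n => n + j), |nu R (n+1) - nu R n| := by
            rw [sum_image (by intro x _ y _ hxy; simpa using hxy)]
        _ ≤ _ := by
            apply sum_le_sum_of_subset_of_nonneg
            · intro x hx
              rw [mem_image] at hx
              obtain ⟨n, hn, rfl⟩ := hx
              rw [mem_range] at hn ⊢; omega
            · intros; exact abs_nonneg _
    refine (sum_le_sum this).trans ?_
    rw [sum_const, card_range, nsmul_eq_mul]
  have h3 : 0 ≤ ∑ n ∈ range (R^240) with n ≡ a [MOD q], ∑ j ∈ range H, |nu R (n+j+1) - nu R (n+j)| :=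
    sum_nonneg fun _ _ => sum_nonneg fun _ _ => abs_nonneg _
  rw [e]
  refine (abs_add_le _ _).trans ?_
  rw [abs_of_nonneg h3]
  refine (add_le_add (h1 R q a hR hq) h2).trans ?_
  rw [← mul_div_assoc, ← add_div]
  apply div_le_div_of_nonneg_right _ hR0.le
  have : (0:ℝ) ≤ H := by positivity
  nlinarith

lemma count_T (R M c : ℕ) (hR : 3 ≤ R) :
    ∑ T ∈ (SW R M).powerset with NN T ≤ R^2, (c:ℝ)^(#T) ≤ (R:ℝ)^2 * (4 * Real.log R)^c := by
  have hR0 : (0:ℝ) < R := by exact_mod_cast (by omega)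
  have hlog := one_le_log hR
  have hS : ∀ p ∈ SW R M, p.Prime := fun p hp => (mem_SW.1 hp).2.1
  have h1 : ∑ T ∈ (SW R M).powerset with NN T ≤ R^2, (c:ℝ)^(#T) ≤ (R:ℝ)^2 * GG (SW R M) (R^2) (fun p => c * (1 / (p:ℝ))) := by
    unfold GG
    rw [mul_sum]
    apply sum_le_sum
    intro T hT
    rw [mem_filter, mem_powerset] at hT
    have hpos : (0:ℝ) < NN T := by exact_mod_cast NN_pos (fun p hp => hS p (hT.1 hp))
    have e : ∏ p ∈ T, ((c:ℝ) * (1 / (p:ℝ))) = (c:ℝ)^(#T) / NN T := by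
      rw [prod_mul_distrib, prod_const]
      unfold NN
      push_cast
      rw [prod_div_distrib]; simp [div_eq_mul_inv]
    rw [e, ← mul_div_assoc, le_div_iff₀ hpos, mul_comm]
    apply mul_le_mul_of_nonneg_right _ (by positivity)
    exact_mod_cast hT.2
  refine h1.trans (mul_le_mul_of_nonneg_left ?_ (by positivity))
  refine (GG_nat_mul (fun p hp => (hS p hp).one_le) _ _ (fun p _ => by positivity) c).trans ?_
  have h2 : GG (SW R M) (R^2) (fun p => 1 / (p:ℝ)) ≤ 4 * Real.log R := by
    refine (GG_inv_le hS (R^2) 1 (fun p hp hd => (hS p hp).one_lt.ne' (Nat.dvd_one.1 hd))).trans ?_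
    refine (sum_le_sum_of_subset_of_nonneg (filter_subset _ _) (fun _ _ _ => by positivity)).trans ?_
    refine (inv_sum_log _).trans ?_
    have h3 : Real.log ((R^2+1 : ℕ) : ℝ) ≤ Real.log ((R:ℝ)^3) := by
      apply Real.log_le_log (by positivity)
      have : R^2 + 1 ≤ R^3 := by
        have h9 : 9 ≤ R^2 := by nlinarith
        calc R^2+1 ≤ R^2*3 := by omega
          _ ≤ R^2*R := Nat.mul_le_mul_left _ hR
          _ = R^3 := by ring
      exact_mod_cast this
    rw [Real.log_pow] at h3
    push_cast at h3 ⊢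
    linarith
  refine pow_le_pow_left₀ ?_ h2 c
  exact GG_nonneg _ _ (fun p _ => by positivity)

end DSR
namespace DSR
open Finset
set_option linter.unusedSectionVars false

section
variable {ι : Type*} [Fintype ι] [DecidableEq ι]

lemma ok_ind_zero {S : Finset ℕ} {h : ι → ℕ} {W : ℕ} (hS : ∀ p ∈ S, p.Prime ∧ ¬ p ∣ W)
    (hH : ∀ i j p, p.Prime → ¬ p ∣ W → h i ≡ h j [MOD p] → i = j) (I : Finset ℕ) (w : ℕ → ℝ) (T : ℝ) (κ : ℕ × ι → ℝ)
    (D : Finset (ℕ × ι)) (hD : ¬ ok D) :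
    |∑ n ∈ I, w n * (if D ⊆ Om S h n then 1 else 0) - T * PP κ D| = 0 := by
  rw [abs_eq_zero, PP, if_neg hD, mul_zero, sub_zero]
  apply sum_eq_zero
  intro n _
  rw [if_neg (fun hh => hD (Om_ok hS hH hh)), mul_zero]

lemma S1_final [Nonempty ι] (W : ℕ) (hW1 : 1 ≤ W) (hW : ∀ p, p.Prime → p ≤ 16 * (Fintype.card ι) ^ 2 → p ∣ W) (h : ι → ℕ) (v H : ℕ)
    (hH : ∀ i j p, p.Prime → ¬ p ∣ W → h i ≡ h j [MOD p] → i = j) :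
    ∃ C : ℝ, 0 < C ∧ ∀ (R E : ℕ) (g : ℕ → ℝ), 3 ≤ R → (∀ n, 0 ≤ g n) → Antitone g →
    ∑ n ∈ range (R^240) with n ≡ v [MOD W], wS R H n *
      fU (UU ι (SW R (W*E))) (fun x => bb (Fintype.card ι) x.1) (yy (SW R (W*E)) g R) (Om (SW R (W*E)) h n) ^ 2 ≤
    X0 R / W * (2 * gam (SW R (W*E)) (bb (Fintype.card ι)) (fun n => g n ^ 2) ^ Fintype.card ι) +
      (gam (SW R (W*E)) (bb (Fintype.card ι)) g ^ Fintype.card ι) ^ 2 *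
        (C / (R:ℝ)^120 * ((R:ℝ)^2 * (4 * Real.log R) ^ (4 ^ (Fintype.card ι + 1)))) := by
  obtain ⟨C, hC, hcl⟩ := wS_class
  refine ⟨C * (H + 1), by positivity, fun R E g hR hg hga => ?_⟩
  obtain ⟨S, hSd⟩ : ∃ S, S = SW R (W*E) := ⟨_, rfl⟩
  obtain ⟨k, hk⟩ : ∃ k, k = Fintype.card ι := ⟨_, rfl⟩
  have hk1 : 1 ≤ k := by rw [hk]; exact Fintype.card_pos
  have hSp : ∀ p ∈ S, p.Prime ∧ ¬ p ∣ W := by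
    intro p hp; rw [hSd, mem_SW] at hp
    exact ⟨hp.2.1, fun hh => hp.2.2 (hh.mul_right _)⟩
  have hS1 : ∀ p ∈ S, 1 ≤ p := fun p hp => (hSp p hp).1.one_le
  have hS2 : ∀ p ∈ S, 2 * Fintype.card ι < p := by
    intro p hp; rw [hSd] at hp
    have := SW_large hW hp
    rw [← hk] at this ⊢
    nlinarith
  have hb2 := bb_sq hk1 R W E (by rw [hk]; exact hW)
  rw [hk] at hb2
  rw [← hSd] at hb2 ⊢
  have hb := bb_nonneg (Fintype.card ι)
  have hq := quad S (fun x : ℕ × ι => bb (Fintype.card ι) x.1) (fun x => hb _) (lam (UU ι S) (fun x => bb (Fintype.card ι) x.1) (yy S g R))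
    (fU (UU ι S) (fun x => bb (Fintype.card ι) x.1) (yy S g R)) (fun ω => fU_lam _ _ _ ω)
    {n ∈ range (R^240) | n ≡ v [MOD W]} (wS R H) (Om S h) (X0 R / W)
  obtain ⟨σ, hσ, hqe⟩ := quad_err S hS1 (lam (UU ι S) (fun x => bb (Fintype.card ι) x.1) (yy S g R))
    (fun D => |∑ n ∈ range (R^240) with n ≡ v [MOD W], wS R H n * (if D ⊆ Om S h n then 1 else 0) -
      X0 R / W * PP (fun x : ℕ × ι => bb (Fintype.card ι) x.1) D|)
    (gam S (bb (Fintype.card ι)) g ^ Fintype.card ι) (pow_nonneg (gam_nonneg hb hg) _) R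
    (fun d hd => lam_bound hS1 hb (fun p _ => bb_le_one (hk ▸ hk1) p) hg hga d hd)
    (fun d _ hd => lam_zero hS1 d hd) (fun D => abs_nonneg _)
    (fun D hD => ok_ind_zero hSp hH _ _ _ _ D hD)
  have herr : ∑ T ∈ S.powerset with NN T ≤ R ^ 2, ((4 ^ (Fintype.card ι + 1) : ℕ) : ℝ) ^ #T *
      |∑ n ∈ range (R^240) with n ≡ v [MOD W], wS R H n * (if σ T ⊆ Om S h n then 1 else 0) -
      X0 R / W * PP (fun x : ℕ × ι => bb (Fintype.card ι) x.1) (σ T)| ≤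
      C * (H + 1) / (R:ℝ)^120 * ((R:ℝ)^2 * (4 * Real.log R) ^ (4 ^ (Fintype.card ι + 1))) := by
    have hct := count_T R (W*E) (4 ^ (Fintype.card ι + 1)) hR
    rw [← hSd] at hct
    refine le_trans ?_ (mul_le_mul_of_nonneg_left hct (by positivity))
    rw [mul_sum]
    apply sum_le_sum
    intro T hT
    rw [mem_filter] at hT
    obtain ⟨s1, s2, s3⟩ := hσ T hT.1
    rw [mul_comm]
    apply mul_le_mul_of_nonneg_right _ (by positivity)
    rw [PP_one hS2 _ s1 s2]
    obtain ⟨a, ha⟩ := Om_crt hSp h v (σ T) s1 s2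
    have hNDpos : 0 < ND (σ T) := prod_pos fun x hx => (hSp _ (mem_UU.1 (s1 hx))).1.pos
    have := hcl R H (W * ND (σ T)) a hR (Nat.mul_pos hW1 hNDpos)
    refine le_trans (le_of_eq ?_) this
    congr 2
    · simp only [mul_ite, mul_one, mul_zero]
      rw [← sum_filter, filter_filter]
      simp only [ha]
    · push_cast
      rw [div_mul_div_comm, mul_one]
  have hup := S1_upper (ι := ι) S (bb (Fintype.card ι)) hb hb2 (yy S g R)
  have hma := S1_main (ι := ι) (S := S) (R := R) hb hg
  have hXW : 0 ≤ X0 R / W := div_nonneg (X0_nonneg R) (by positivity)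
  have hfin := (abs_le.1 (hq.trans (hqe.trans (mul_le_mul_of_nonneg_left herr (by positivity))))).2
  have h5 := mul_le_mul_of_nonneg_left (hup.trans (mul_le_mul_of_nonneg_left hma (by norm_num))) hXW
  linarith

lemma S2_final (W : ℕ) (hW1 : 1 ≤ W) (hW : ∀ p, p.Prime → p ≤ 16 * (Fintype.card ι) ^ 2 → p ∣ W) (h : ι → ℕ) (v H : ℕ)
    (hH : ∀ i j p, p.Prime → ¬ p ∣ W → h i ≡ h j [MOD p] → i = j) (hv : ∀ i, (v + h i).Coprime W)
    (R E : ℕ) (g : ℕ → ℝ) (ε : ℝ) (hR : 3 ≤ R) (hT0 : 0 ≤ T0 R) (m : ι) (hm : h m ≤ R)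
    (hbv : ∀ a : Finset ℕ → ℕ, (∀ T ∈ (SW R (W*E)).powerset, (a T).Coprime (W * NN T)) →
      ∑ T ∈ (SW R (W*E)).powerset with NN T ≤ R^2, ((4 ^ (Fintype.card ι + 1) : ℕ) : ℝ)^(#T) *
      |∑ n ∈ range (R^240) with n ≡ a T [MOD W * NN T], vp n * nu R n - T0 R / (W * NN T).totient| ≤ ε)
    (hg : ∀ n, 0 ≤ g n) (hga : Antitone g) (Zz B : ℕ) (hB : 1 < B) (hZB : Zz * B ≤ R)
    (hgz : ∀ n, Zz < n → g n = 0) (hgam : 0 < gam (SW R (W*E)) (bb (Fintype.card ι)) (fun n => g n ^ 2))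
    (hdel : (Fintype.card ι : ℝ) * gam (SW R (W*E)) (bb (Fintype.card ι)) (fun n => g n ^ 2 * Real.log n) ≤
      (1 / 2) * gam (SW R (W*E)) (bb (Fintype.card ι)) (fun n => g n ^ 2) * Real.log B) :
    T0 R / W.totient * ((1 / 2) * ((1 / 2) * gam (SW R (W*E)) (bb (Fintype.card ι)) g ^ 2 *
      gam (SW R (W*E)) (bb (Fintype.card ι)) (fun n => g n ^ 2) ^ (Fintype.card ι - 1))) -
      (gam (SW R (W*E)) (bb (Fintype.card ι)) g ^ Fintype.card ι) ^ 2 * ε ≤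
    ∑ n ∈ range (R^240) with n ≡ v [MOD W], (vp (n + h m) * nu R (n + h m)) *
      fU (UU ι (SW R (W*E))) (fun x => bb (Fintype.card ι) x.1) (yy (SW R (W*E)) g R) (Om (SW R (W*E)) h n) ^ 2 := by
  have : Nonempty ι := ⟨m⟩
  obtain ⟨S, hSd⟩ : ∃ S, S = SW R (W*E) := ⟨_, rfl⟩
  obtain ⟨k, hk⟩ : ∃ k, k = Fintype.card ι := ⟨_, rfl⟩
  have hk1 : 1 ≤ k := by rw [hk]; exact Fintype.card_pos
  have hSp : ∀ p ∈ S, p.Prime ∧ ¬ p ∣ W := by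
    intro p hp; rw [hSd, mem_SW] at hp
    exact ⟨hp.2.1, fun hh => hp.2.2 (hh.mul_right _)⟩
  have hSR : ∀ p ∈ S, p ≤ R := by
    intro p hp; rw [hSd, mem_SW] at hp; exact hp.1
  have hS1 : ∀ p ∈ S, 1 ≤ p := fun p hp => (hSp p hp).1.one_le
  have hS2 : ∀ p ∈ S, p.Prime ∧ 2 * Fintype.card ι < p := by
    intro p hp
    refine ⟨(hSp p hp).1, ?_⟩
    rw [hSd] at hp
    have := SW_large hW hp
    rw [← hk] at this ⊢
    nlinarith
  have hb2 := bb_sq hk1 R W E (by rw [hk]; exact hW)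
  rw [hk] at hb2
  rw [← hSd] at hb2 hbv hgam hdel ⊢
  have hb := bb_nonneg (Fintype.card ι)
  have hq := quad S (kap (bb (Fintype.card ι)) m) (kap_nonneg _ hb m) (lam (UU ι S) (fun x => bb (Fintype.card ι) x.1) (yy S g R))
    (fU (UU ι S) (fun x => bb (Fintype.card ι) x.1) (yy S g R)) (fun ω => fU_lam _ _ _ ω)
    {n ∈ range (R^240) | n ≡ v [MOD W]} (fun n => vp (n + h m) * nu R (n + h m)) (Om S h) (T0 R / W.totient)
  obtain ⟨σ, hσ, hqe⟩ := quad_err S hS1 (lam (UU ι S) (fun x => bb (Fintype.card ι) x.1) (yy S g R))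
    (fun D => |∑ n ∈ range (R^240) with n ≡ v [MOD W], vp (n + h m) * nu R (n + h m) * (if D ⊆ Om S h n then 1 else 0) -
      T0 R / W.totient * PP (kap (bb (Fintype.card ι)) m) D|)
    (gam S (bb (Fintype.card ι)) g ^ Fintype.card ι) (pow_nonneg (gam_nonneg hb hg) _) R
    (fun d hd => lam_bound hS1 hb (fun p _ => bb_le_one (hk ▸ hk1) p) hg hga d hd)
    (fun d _ hd => lam_zero hS1 d hd) (fun D => abs_nonneg _)
    (fun D hD => ok_ind_zero hSp hH _ _ _ _ D hD)
  have hRp : R ≤ R^120 := Nat.le_self_pow (by norm_num) R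
  have hexa : ∀ T ∈ S.powerset, ∃ a : ℕ, a.Coprime (W * NN T) ∧
      |∑ n ∈ range (R^240) with n ≡ v [MOD W], vp (n + h m) * nu R (n + h m) * (if σ T ⊆ Om S h n then 1 else 0) -
      T0 R / W.totient * PP (kap (bb (Fintype.card ι)) m) (σ T)| ≤
      |∑ n ∈ range (R^240) with n ≡ a [MOD W * NN T], vp n * nu R n - T0 R / (W * NN T).totient| := by
    intro T hT
    obtain ⟨s1, s2, s3⟩ := hσ T hT
    by_cases hx : ∃ x ∈ σ T, x.2 = m
    · obtain ⟨x, hx, hxm⟩ := hx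
      refine ⟨1, Nat.coprime_one_left _, ?_⟩
      rw [PP_kap_zero m _ _ x hx hxm, mul_zero, sub_zero, sum_eq_zero, abs_zero]
      · exact abs_nonneg _
      · intro n _
        split_ifs with hsub
        · rw [mul_one]
          by_contra hne
          have hd := (sub_Om s1).1 hsub x hx
          have hxS := mem_UU.1 (s1 hx)
          rw [hxm] at hd
          have hc := vpnu_coprime hR (hS1 _ hxS) ((hSR _ hxS).trans hRp) hne
          have := Nat.dvd_gcd hd (dvd_refl x.1)
          rw [hc] at this
          exact (hSp _ hxS).1.one_lt.ne' (Nat.dvd_one.1 this)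
        · rw [mul_zero]
    · push Not at hx
      obtain ⟨a, ha⟩ := Om_crt hSp h v (σ T) s1 s2
      have hNN : ND (σ T) = NN T := by rw [ok_ND s2, s3]
      have haa := (ha a).2 (Nat.ModEq.refl a)
      rw [hNN] at ha
      refine ⟨a + h m, ?_, le_of_eq ?_⟩
      · apply Nat.Coprime.mul_right
        · have h1 := haa.1.add_right (h m)
          have h2 := hv m
          unfold Nat.Coprime at h2 ⊢
          rw [h1.gcd_eq, h2]
        · rw [← hNN]
          unfold ND
          apply Nat.Coprime.prod_right
          intro x hxs
          have hp := hSp _ (mem_UU.1 (s1 hxs))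
          apply Nat.Coprime.symm
          rw [Nat.Prime.coprime_iff_not_dvd hp.1]
          intro hd
          have hd2 := (sub_Om s1).1 haa.2 x hxs
          apply hx x hxs
          apply hH _ _ x.1 hp.1 hp.2
          exact Nat.ModEq.add_left_cancel' a ((Nat.modEq_zero_iff_dvd.2 hd2).trans (Nat.modEq_zero_iff_dvd.2 hd).symm)
      · rw [PP_kap hS2 m _ s1 s2 hx, hNN]
        congr 2
        · simp only [mul_ite, mul_one, mul_zero]
          rw [← sum_filter, filter_filter]
          simp only [ha]
          apply sum_bij_ne_zero (fun n _ _ => n + h m)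
          · intro n hn hne
            rw [mem_filter] at hn ⊢
            have hnu : nu R (n + h m) ≠ 0 := right_ne_zero_of_mul hne
            exact ⟨mem_range.2 (nu_supp hR hnu).2, hn.2.add_right _⟩
          · intro n _ _ n' _ _ he
            exact Nat.add_right_cancel he
          · intro n hn hne
            rw [mem_filter, mem_range] at hn
            have hnu : nu R n ≠ 0 := right_ne_zero_of_mul hne
            have h1 := (nu_supp hR hnu).1
            have h2 : n - h m + h m = n := by omega
            refine ⟨n - h m, ?_, ?_, h2⟩
            · rw [mem_filter, mem_range]
              refine ⟨by omega, ?_⟩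
              apply Nat.ModEq.add_right_cancel' (h m)
              rw [h2]; exact hn.2
            · rw [h2]; exact hne
          · intro n _ _; rfl
        · rw [Nat.totient_mul]
          · push_cast
            rw [div_mul_div_comm, mul_one]
          · rw [← hNN]; exact W_coprime_ND hSp s1
  choose! a ha1 ha2 using hexa
  have herr := hbv a ha1
  have herr2 : ∑ T ∈ S.powerset with NN T ≤ R ^ 2, ((4 ^ (Fintype.card ι + 1) : ℕ) : ℝ) ^ #T *
      |∑ n ∈ range (R^240) with n ≡ v [MOD W], vp (n + h m) * nu R (n + h m) * (if σ T ⊆ Om S h n then 1 else 0) -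
      T0 R / W.totient * PP (kap (bb (Fintype.card ι)) m) (σ T)| ≤ ε := by
    refine le_trans (sum_le_sum fun T hT => ?_) herr
    rw [mem_filter] at hT
    exact mul_le_mul_of_nonneg_left (ha2 T hT.1) (by positivity)
  have hlo := S2_lower (ι := ι) S (bb (Fintype.card ι)) hb hb2 (yy S g R) (fun r => yy_nonneg hg r) (fun r s hrs => yy_mono hS1 hg hga r s hrs) m
  have hma := S2_main (ι := ι) hS1 hb hg Zz B hB hZB hgz m hgam hdel
  have hTW : 0 ≤ T0 R / W.totient := div_nonneg hT0 (by positivity)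
  have hfin := (abs_le.1 (hq.trans (hqe.trans (mul_le_mul_of_nonneg_left herr2 (by positivity))))).1
  have h5 := mul_le_mul_of_nonneg_left (le_trans (mul_le_mul_of_nonneg_left hma (by norm_num)) hlo) hTW
  linarith

end
end DSR
namespace DSR
open Finset
set_option linter.unusedSectionVars false

lemma vp_le_log (n : ℕ) : vp n ≤ Real.log n := by
  unfold vp; split_ifs
  · exact le_rfl
  · exact Real.log_natCast_nonneg n

lemma prime_count {k : ℕ} (R H n K : ℕ) (h : Fin k → ℕ) (hR : 3 ≤ R) (hh : ∀ m, h m ≤ H)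
    (hs : 241 * (K:ℝ) * Real.log R * wS R H n < ∑ m, vp (n + h m) * nu R (n + h m)) :
    K ≤ #{m : Fin k | (n + h m).Prime ∧ R^120 < n + h m} := by
  by_contra hc
  push Not at hc
  have hlog := one_le_log hR
  have hw := wS_nonneg R H n
  have h1 : ∑ m, vp (n + h m) * nu R (n + h m) ≤ ∑ m : Fin k, if (n + h m).Prime ∧ R^120 < n + h m then 241 * Real.log R * wS R H n else 0 := by
    apply sum_le_sum
    intro m _
    by_cases hne : vp (n + h m) * nu R (n + h m) = 0
    · rw [hne]; split_ifs
      · positivity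
      · exact le_rfl
    · have hp : (n + h m).Prime := by
        by_contra hp
        apply hne; simp [vp, hp]
      have hnu := nu_supp hR (right_ne_zero_of_mul hne)
      rw [if_pos ⟨hp, hnu.1⟩]
      have h2 : vp (n + h m) ≤ 240 * Real.log R := by
        refine (vp_le_log _).trans ?_
        have : Real.log ((n + h m : ℕ) : ℝ) ≤ Real.log ((R:ℝ)^240) := by
          apply Real.log_le_log (by exact_mod_cast hp.pos)
          exact_mod_cast hnu.2.le
        rw [Real.log_pow] at this
        exact_mod_cast this
      have h3 := wS_ge R n (hh m)
      calc _ ≤ (240 * Real.log R) * wS R H n := mul_le_mul h2 h3 (nu_nonneg _ _) (by positivity)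
        _ ≤ _ := by nlinarith
  rw [← sum_filter, sum_const, nsmul_eq_mul] at h1
  have h4 : ((#{m : Fin k | (n + h m).Prime ∧ R^120 < n + h m} : ℕ) : ℝ) ≤ K := by exact_mod_cast hc.le
  have h5 : ((#{m : Fin k | (n + h m).Prime ∧ R^120 < n + h m} : ℕ) : ℝ) * (241 * Real.log R * wS R H n) ≤ K * (241 * Real.log R * wS R H n) :=
    mul_le_mul_of_nonneg_right h4 (by positivity)
  nlinarith

lemma final_real (k j K M l W θ Γ γ P t x η : ℝ) (hk : 1 ≤ k) (hj : 1 ≤ j) (hK : 1 ≤ K) (hM1 : 1 ≤ M) (hM : M ≤ 257 * k * j) (hl : 1 ≤ l)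
    (hW : 0 < W) (hθ : 0 < θ) (hjK : 2 * 64 * 241^2 * 256 * 257 * K ≤ j) (hΓ : j * (θ / 8 * l) ≤ Γ) (hγ : γ ≤ 32 * θ * l) (hγ0 : 0 ≤ γ)
    (hP : 0 ≤ P) (ht : M * l ≤ t) (hx : x ≤ 241 * (M * l)) (hη : η ≤ θ * P / W) :
    241 * K * (M * l) * (x / W * (2 * (γ * P))) + η ≤ k * (t / (θ * W) * ((1 / 2) * ((1 / 2) * Γ ^ 2 * P))) := by
  have ht0 : 0 ≤ t := le_trans (by positivity) ht
  obtain ⟨Q, hQ⟩ : ∃ Q, Q = θ * P / W * l ^ 3 * M := ⟨_, rfl⟩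
  have hQ0 : 0 ≤ Q := by rw [hQ]; positivity
  have h1 : k * j ^ 2 / 256 * Q ≤ k * (t / (θ * W) * ((1 / 2) * ((1 / 2) * Γ ^ 2 * P))) := by
    calc k * j ^ 2 / 256 * Q = k * ((M * l) / (θ * W) * ((1 / 2) * ((1 / 2) * (j * (θ / 8 * l)) ^ 2 * P))) := by
          rw [hQ]; field_simp; ring
      _ ≤ _ := by gcongr
  have h2 : 241 * K * (M * l) * (x / W * (2 * (γ * P))) ≤ 64 * 241 ^ 2 * K * M * Q := by
    calc 241 * K * (M * l) * (x / W * (2 * (γ * P))) ≤ 241 * K * (M * l) * (241 * (M * l) / W * (2 * (32 * θ * l * P))) := by gcongr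
      _ = _ := by rw [hQ]; ring
  have h3 : 2 * (64 * 241 ^ 2 * K * M) ≤ k * j ^ 2 / 256 := by
    have a1 : 2 * (64 * 241 ^ 2 * K * M) ≤ 2 * (64 * 241 ^ 2 * K * (257 * k * j)) := by gcongr
    have a2 : k * j * (2 * 64 * 241^2 * 256 * 257 * K) ≤ k * j * j := by gcongr
    nlinarith
  have h4 : η ≤ 64 * 241 ^ 2 * K * M * Q := by
    have b1 : θ * P / W ≤ Q := by
      rw [hQ]
      have : 1 ≤ l ^ 3 * M := one_le_mul_of_one_le_of_one_le (one_le_pow₀ hl) hM1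
      have h0 : 0 ≤ θ * P / W := by positivity
      rw [mul_assoc]
      exact le_mul_of_one_le_right h0 this
    have b2 : 1 ≤ 64 * 241 ^ 2 * K * M := by nlinarith
    exact hη.trans (b1.trans (le_mul_of_one_le_left hQ0 b2))
  have h5 := mul_le_mul_of_nonneg_right h3 hQ0
  linarith

lemma log_pow_small (n : ℕ) (δ : ℝ) (hδ : 0 < δ) : ∀ᶠ R : ℕ in Filter.atTop, Real.log R ^ n ≤ δ * R := by
  have h := (Real.isLittleO_pow_log_id_atTop (n := n)).def hδ
  have h2 := tendsto_natCast_atTop_atTop.eventually h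
  filter_upwards [h2, Filter.eventually_ge_atTop 3] with R h hR
  simp only [id, Real.norm_eq_abs] at h
  rw [abs_of_nonneg (pow_nonneg (by linarith [one_le_log hR]) _), abs_of_nonneg (by positivity)] at h
  exact h

end DSR
namespace DSR
open Finset
set_option linter.unusedSectionVars false

lemma err_one (K A C η : ℝ) (k c : ℕ) (hK : 0 ≤ K) (hA : 0 ≤ A) (hC : 0 ≤ C) (hη : 0 < η) : ∀ᶠ R : ℕ in Filter.atTop,
    241 * K * Real.log R * ((A * Real.log R ^ (2 * k)) * (C / (R:ℝ)^120 * ((R:ℝ)^2 * (4 * Real.log R) ^ c))) ≤ η := by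
  obtain ⟨X, hX⟩ : ∃ X, X = 241 * K * A * C * 4 ^ c := ⟨_, rfl⟩
  have hX0 : 0 ≤ X := by rw [hX]; positivity
  filter_upwards [log_pow_small (1 + 2 * k + c) (η / (X + 1)) (by positivity), Filter.eventually_ge_atTop 3] with R h hR
  have hR1 : (1:ℝ) ≤ R := by exact_mod_cast (by omega)
  have hR0 : (0:ℝ) < R := by linarith
  have e : 241 * K * Real.log R * ((A * Real.log R ^ (2 * k)) * (C / (R:ℝ)^120 * ((R:ℝ)^2 * (4 * Real.log R) ^ c))) =
      X * (Real.log R ^ (1 + 2 * k + c) / (R:ℝ)^118) := by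
    have : (R:ℝ)^120 = (R:ℝ)^118 * (R:ℝ)^2 := by ring
    rw [hX, this, mul_pow, pow_add, pow_add]
    field_simp
  rw [e]
  have h2 : Real.log R ^ (1 + 2 * k + c) / (R:ℝ)^118 ≤ η / (X + 1) := by
    rw [div_le_iff₀ (by positivity)]
    refine h.trans (mul_le_mul_of_nonneg_left ?_ (by positivity))
    exact le_self_pow₀ hR1 (by norm_num)
  calc _ ≤ X * (η / (X+1)) := mul_le_mul_of_nonneg_left h2 hX0
    _ ≤ (X+1) * (η / (X+1)) := mul_le_mul_of_nonneg_right (by linarith) (by positivity)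
    _ = η := by field_simp

lemma err_two (A η : ℝ) (k : ℕ) (hη : 0 < η) : ∀ᶠ R : ℕ in Filter.atTop,
    k * ((A * Real.log R ^ (2 * k)) * (1 / Real.log R ^ (2 * k + 1))) ≤ η := by
  filter_upwards [log_tendsto.eventually_ge_atTop (k * A / η), Filter.eventually_ge_atTop 3] with R h hR
  have hlog := one_le_log hR
  have hl0 : 0 < Real.log R := by linarith
  have e : k * ((A * Real.log R ^ (2 * k)) * (1 / Real.log R ^ (2 * k + 1))) = k * A / Real.log R := by
    rw [pow_succ]; field_simp
  rw [e, div_le_iff₀ hl0]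
  rw [div_le_iff₀ hη] at h
  linarith

theorem dhl (J K k : ℕ) (hk : k = 2 ^ J) (hK : 1 ≤ K) (hJ : 2 * 64 * 241^2 * 256 * 257 * (K:ℝ) ≤ J) (W : ℕ) (hW1 : 1 ≤ W)
    (hW : ∀ p, p.Prime → p ≤ 16 * k ^ 2 → p ∣ W) (h : Fin k → ℕ) (v H : ℕ) (hh : ∀ m, h m ≤ H)
    (hH : ∀ i j p, p.Prime → ¬ p ∣ W → h i ≡ h j [MOD p] → i = j) (hv : ∀ i, (v + h i).Coprime W) (N : ℕ) :
    ∃ n, n ≡ v [MOD W] ∧ K ≤ #{m : Fin k | (n + h m).Prime ∧ N < n + h m} := by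
  have hk1 : 1 ≤ k := by rw [hk]; exact Nat.one_le_two_pow
  have hk1r : (1:ℝ) ≤ k := by exact_mod_cast hk1
  have hKr : (1:ℝ) ≤ K := by exact_mod_cast hK
  have : Nonempty (Fin k) := ⟨⟨0, hk1⟩⟩
  obtain ⟨M, hM⟩ : ∃ M, M = k + 256 * k * (J + 1) := ⟨_, rfl⟩
  have hM1 : 1 ≤ M := by omega
  obtain ⟨θ, hθ⟩ : ∃ θ : ℝ, θ = (W.totient : ℝ) / W := ⟨_, rfl⟩
  have hWr : (0:ℝ) < W := by exact_mod_cast hW1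
  have hφ : (0:ℝ) < W.totient := by exact_mod_cast Nat.totient_pos.2 hW1
  have hθ0 : 0 < θ := by rw [hθ]; positivity
  have hθ1 : θ ≤ 1 := by
    rw [hθ, div_le_one hWr]; exact_mod_cast Nat.totient_le W
  have hφe : (W.totient : ℝ) = θ * W := by rw [hθ]; field_simp
  obtain ⟨η, hη⟩ : ∃ η : ℝ, η = θ * (θ / 8) ^ (k - 1) / W := ⟨_, rfl⟩
  have hη0 : 0 < η := by rw [hη]; positivity
  obtain ⟨A, hA⟩ : ∃ A : ℝ, A = (4 * ((J:ℝ) + 1)) ^ (2 * k) := ⟨_, rfl⟩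
  have hA0 : 0 ≤ A := by rw [hA]; positivity
  have hcard : Fintype.card (Fin k) = k := Fintype.card_fin k
  obtain ⟨C, hC, hS1⟩ := S1_final (ι := Fin k) W hW1 (by rw [hcard]; exact hW) h v H hH
  have htend : Filter.Tendsto (fun z : ℕ => z ^ M) Filter.atTop Filter.atTop := Filter.tendsto_pow_atTop (by omega)
  have E1 := htend.eventually (bv_main W (4 ^ (k + 1)) (2 * k + 1) (Nat.one_le_pow _ _ (by norm_num)) hW1)
  have E2 := htend.eventually T0_lower
  have E3 := htend.eventually (err_one K A C (η / 4) k (4 ^ (k + 1)) (by positivity) hA0 hC.le (by positivity))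
  have E4 := htend.eventually (err_two A (η / 4) k (by positivity))
  obtain ⟨z, ⟨E, hE, hbv⟩, hT0, he1, he2, hz3, hzN, hzH, hzl⟩ := (E1.and (E2.and (E3.and (E4.and
    ((Filter.eventually_ge_atTop 3).and ((Filter.eventually_ge_atTop N).and ((Filter.eventually_ge_atTop H).and
      (log_tendsto.eventually_ge_atTop (2 * ((W:ℝ) + 1))))))))) ).exists
  obtain ⟨R, hR⟩ : ∃ R, R = z ^ M := ⟨_, rfl⟩
  rw [← hR] at hbv hT0 he1 he2
  have hzR : z ≤ R := by rw [hR]; exact Nat.le_self_pow (by omega) z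
  have hR3 : 3 ≤ R := hz3.trans hzR
  have hlogR : Real.log R = M * Real.log z := by rw [hR]; push_cast; rw [Real.log_pow]
  have hl1 : 1 ≤ Real.log z := one_le_log hz3
  have hlzR : Real.log z ≤ Real.log R := by
    rw [hlogR]; exact le_mul_of_one_le_left (by linarith) (by exact_mod_cast hM1)
  have hlogR1 := one_le_log hR3
  have hzz : z ^ (2 ^ J) ≤ R := by
    rw [hR, ← hk]; exact Nat.pow_le_pow_right (by omega) (by omega)
  obtain ⟨g1, g2, g3, g4, g5⟩ := gam_bounds hk1 R W E J z hW1 hW hE hzl hzz θ hθ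
  obtain ⟨S, hS⟩ : ∃ S, S = SW R (W * E) := ⟨_, rfl⟩
  have hs1 := hS1 R E (gg J z) hR3 (gg_nonneg J z) (gg_anti J z)
  have hT00 : 0 ≤ T0 R := by linarith
  have hgam0 : 0 < gam (SW R (W * E)) (bb k) (fun n => gg J z n ^ 2) := lt_of_lt_of_le (by positivity) g3
  have hs2 : ∀ m : Fin k, _ := fun m => S2_final (ι := Fin k) W hW1 (by rw [hcard]; exact hW) h v H hH hv R E (gg J z)
    (1 / Real.log R ^ (2 * k + 1)) hR3 hT00 m ((hh m).trans (hzH.trans hzR)) (by rw [hcard]; exact hbv) (gg_nonneg J z) (gg_anti J z)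
    (z ^ (2 ^ J)) (z ^ (256 * k * (J + 1))) (Nat.one_lt_pow (by positivity) (by omega))
    (by rw [← pow_add, hR, hM, ← hk]) (fun n hn => gg_zero J z n (by omega) hn) (by rw [hcard]; exact hgam0)
    (by
      rw [hcard]
      push_cast
      rw [Real.log_pow]
      push_cast
      calc (k:ℝ) * gam (SW R (W * E)) (bb k) (fun n => gg J z n ^ 2 * Real.log n) ≤ k * (16 * (J + 1) * θ * Real.log z ^ 2) := by gcongr
        _ = 1 / 2 * (θ / 8 * Real.log z) * (256 * k * (J + 1) * Real.log z) := by ring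
        _ ≤ _ := by gcongr)
  rw [hcard] at hs1 hs2
  rw [← hS] at hs1 hs2 g1 g2 g3 g4 hgam0
  obtain ⟨Γ, hΓ⟩ : ∃ Γ, Γ = gam S (bb k) (gg J z) := ⟨_, rfl⟩
  obtain ⟨γ, hγ⟩ : ∃ γ, γ = gam S (bb k) (fun n => gg J z n ^ 2) := ⟨_, rfl⟩
  rw [← hΓ] at hs1 hs2 g1 g2
  rw [← hγ] at hs1 hs2 g3 g4 hgam0
  obtain ⟨f, hf⟩ : ∃ f : ℕ → ℝ, f = fun n => fU (UU (Fin k) S) (fun x => bb k x.1) (yy S (gg J z) R) (Om S h n) ^ 2 := ⟨_, rfl⟩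
  have hf0 : ∀ n, 0 ≤ f n := fun n => by rw [hf]; positivity
  have hs1' : ∑ n ∈ range (R^240) with n ≡ v [MOD W], wS R H n * f n ≤ X0 R / W * (2 * γ ^ k) +
      (Γ ^ k) ^ 2 * (C / (R:ℝ)^120 * ((R:ℝ)^2 * (4 * Real.log R) ^ (4 ^ (k + 1)))) := by rw [hf]; exact hs1
  have hs2' : ∀ m : Fin k, T0 R / (θ * W) * ((1 / 2) * ((1 / 2) * Γ ^ 2 * γ ^ (k - 1))) - (Γ ^ k) ^ 2 * (1 / Real.log R ^ (2 * k + 1)) ≤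
      ∑ n ∈ range (R^240) with n ≡ v [MOD W], (vp (n + h m) * nu R (n + h m)) * f n := by
    intro m
    rw [hf, ← hφe]; exact hs2 m
  have hΓ0 : 0 ≤ Γ := le_trans (by positivity) g1
  have hΓA : (Γ ^ k) ^ 2 ≤ A * Real.log R ^ (2 * k) := by
    rw [← pow_mul, mul_comm k 2, hA, ← mul_pow]
    apply pow_le_pow_left₀ hΓ0
    refine g2.trans ?_
    calc ((J:ℝ) + 1) * (4 * θ * Real.log z) ≤ ((J:ℝ) + 1) * (4 * 1 * Real.log R) := by gcongr
      _ = _ := by ring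
  have hγk : γ ^ k = γ * γ ^ (k - 1) := by
    rw [← pow_succ']; congr 1; omega
  have hmain := final_real k (J + 1) K M (Real.log z) W θ Γ γ (γ ^ (k - 1)) (T0 R) (X0 R) η hk1r
    (by linarith [Nat.cast_nonneg (α := ℝ) J]) hKr (by exact_mod_cast hM1)
    (by rw [hM]; push_cast
        have : (k:ℝ) ≤ k * (J + 1) := le_mul_of_one_le_right (by positivity) (by linarith [Nat.cast_nonneg (α := ℝ) J])
        linarith)
    hl1 hWr hθ0 (by linarith) g1 g4 hgam0.le (by positivity) (by rw [← hlogR]; exact hT0) (by rw [← hlogR]; exact X0_upper hR3)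
    (by
      rw [hη]
      gcongr
      refine le_trans ?_ g3
      exact le_mul_of_one_le_right (by positivity) hl1)
  rw [← hlogR, ← hγk] at hmain
  have hlow : ∑ n ∈ range (R^240) with n ≡ v [MOD W], (241 * (K:ℝ) * Real.log R * wS R H n) * f n <
      ∑ n ∈ range (R^240) with n ≡ v [MOD W], (∑ m, vp (n + h m) * nu R (n + h m)) * f n := by
    have a1 : ∑ n ∈ range (R^240) with n ≡ v [MOD W], (∑ m, vp (n + h m) * nu R (n + h m)) * f n =
        ∑ m, ∑ n ∈ range (R^240) with n ≡ v [MOD W], (vp (n + h m) * nu R (n + h m)) * f n := by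
      rw [sum_comm]; exact sum_congr rfl fun n _ => by rw [sum_mul]
    have a2 : ∑ n ∈ range (R^240) with n ≡ v [MOD W], (241 * (K:ℝ) * Real.log R * wS R H n) * f n =
        241 * K * Real.log R * ∑ n ∈ range (R^240) with n ≡ v [MOD W], wS R H n * f n := by
      rw [mul_sum]; exact sum_congr rfl fun n _ => by ring
    rw [a1, a2]
    have a3 := sum_le_sum fun m (_ : m ∈ (univ : Finset (Fin k))) => hs2' m
    rw [sum_const, card_univ, hcard, nsmul_eq_mul] at a3
    have a4 := mul_le_mul_of_nonneg_left hs1' (show 0 ≤ 241 * (K:ℝ) * Real.log R by positivity)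
    have a5 : 241 * (K:ℝ) * Real.log R * ((Γ ^ k) ^ 2 * (C / (R:ℝ)^120 * ((R:ℝ)^2 * (4 * Real.log R) ^ (4 ^ (k + 1))))) ≤ η / 4 := by
      refine le_trans ?_ he1
      gcongr
    have a6 : k * ((Γ ^ k) ^ 2 * (1 / Real.log R ^ (2 * k + 1))) ≤ η / 4 := by
      refine le_trans ?_ he2
      gcongr
    linarith
  obtain ⟨n, hn, hlt⟩ := exists_lt_of_sum_lt hlow
  have hlt2 := lt_of_mul_lt_mul_right hlt (hf0 n)
  refine ⟨n, (mem_filter.1 hn).2, (prime_count R H n K h hR3 hh hlt2).trans (card_le_card ?_)⟩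
  intro m hm
  rw [mem_filter] at hm ⊢
  refine ⟨hm.1, hm.2.1, lt_of_le_of_lt ?_ hm.2.2⟩
  exact hzN.trans (hzR.trans (Nat.le_self_pow (by norm_num) R))

end DSR
namespace DSR
open Finset

lemma ds_mul (g : ℕ) (hg : 2 ≤ g) (x : ℕ) : (Nat.digits g (g * x)).sum = (Nat.digits g x).sum := by
  rcases Nat.eq_zero_or_pos x with rfl | hx
  · simp
  · have := Nat.digits_add g (by omega) 0 x (by omega) (Or.inr (by omega))
    rw [zero_add] at this
    rw [this]; simp

lemma ds_one (g : ℕ) (hg : 2 ≤ g) (x : ℕ) : (Nat.digits g (1 + g * x)).sum = 1 + (Nat.digits g x).sum := by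
  rw [Nat.digits_add g (by omega) 1 x (by omega) (Or.inl (by omega))]; simp

lemma ds_pow (g : ℕ) (hg : 2 ≤ g) (a x : ℕ) : (Nat.digits g (g ^ a * x)).sum = (Nat.digits g x).sum := by
  induction a with
  | zero => simp
  | succ a ih => rw [pow_succ', mul_assoc, ds_mul g hg, ih]

lemma ds_tuple (g : ℕ) (hg : 2 ≤ g) (a L q : ℕ) (ha : 1 ≤ a) (haL : a < L) :
    (Nat.digits g (g ^ L * q + (1 + g ^ a))).sum = 2 + (Nat.digits g q).sum := by
  obtain ⟨b, rfl⟩ : ∃ b, a = b + 1 := ⟨a - 1, by omega⟩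
  obtain ⟨c, rfl⟩ : ∃ c, L = b + 1 + (c + 1) := ⟨L - (b + 2), by omega⟩
  have e : g ^ (b + 1 + (c + 1)) * q + (1 + g ^ (b + 1)) = 1 + g * (g ^ b * (1 + g * (g ^ c * q))) := by ring
  rw [e, ds_one g hg, ds_pow g hg, ds_one g hg, ds_pow g hg]; ring

/-- a residue avoiding all `-h i` mod `p` -/
lemma avoid (g : ℕ) (k p : ℕ) (hp : p.Prime) (hpg : ¬ p ∣ g) (h : Fin k → ℕ) (hh : ∀ i, h i = 1 + g ^ ((i.1 + 1) * k.factorial)) :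
    ∃ r, ∀ i, ¬ p ∣ r + h i := by
  have hfact : Fact p.Prime := ⟨hp⟩
  by_cases hpk : p ≤ k
  · refine ⟨p - 1, fun i hd => ?_⟩
    have h1 : p - 1 ∣ (i.1 + 1) * k.factorial :=
      Dvd.dvd.mul_left (Nat.dvd_factorial (by have := hp.two_le; omega) (by omega)) _
    obtain ⟨c, hc⟩ := h1
    have h2 : g ^ ((i.1 + 1) * k.factorial) ≡ 1 [MOD p] := by
      rw [hc, pow_mul]
      have hcop : g.Coprime p := ((Nat.Prime.coprime_iff_not_dvd hp).2 hpg).symm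
      have := Nat.ModEq.pow_totient hcop
      rw [Nat.totient_prime hp] at this
      simpa using this.pow c
    have h3 : p - 1 + h i ≡ p - 1 + (1 + 1) [MOD p] := by
      rw [hh]; exact (h2.add_left 1).add_left _
    have h4 : p - 1 + (1 + 1) = p + 1 := by have := hp.two_le; omega
    rw [h4] at h3
    have h5 := (Nat.modEq_zero_iff_dvd.2 hd).symm.trans h3
    have h6 : p ∣ p + 1 := Nat.modEq_zero_iff_dvd.1 h5.symm
    have h7 : p ∣ 1 := (Nat.dvd_add_right (dvd_refl p)).1 h6
    exact hp.one_lt.ne' (Nat.dvd_one.1 h7)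
  · push Not at hpk
    have hcard : #(univ.image (fun i : Fin k => -((h i : ℕ) : ZMod p))) < Fintype.card (ZMod p) := by
      rw [ZMod.card]
      exact lt_of_le_of_lt card_image_le (by simpa using hpk)
    obtain ⟨r, hr⟩ : ∃ r : ZMod p, r ∉ univ.image (fun i : Fin k => -((h i : ℕ) : ZMod p)) := by
      by_contra hcon
      push Not at hcon
      have : univ.image (fun i : Fin k => -((h i : ℕ) : ZMod p)) = univ := eq_univ_iff_forall.2 hcon
      rw [this, card_univ] at hcard
      exact lt_irrefl _ hcard
    refine ⟨r.val, fun i hd => hr ?_⟩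
    rw [mem_image]
    refine ⟨i, mem_univ _, ?_⟩
    have := (ZMod.natCast_eq_zero_iff (r.val + h i) p).2 hd
    push_cast at this
    rw [ZMod.natCast_zmod_val] at this
    exact (eq_neg_of_add_eq_zero_left this).symm

lemma tuple_exists (g : ℕ) (hg : 2 ≤ g) (k : ℕ) (h : Fin k → ℕ) (hh : ∀ i, h i = 1 + g ^ ((i.1 + 1) * k.factorial))
    (L H : ℕ) (hL : 1 ≤ L) (hH : ∀ i, h i ≤ H) :
    ∃ W v : ℕ, 1 ≤ W ∧ g ^ L ∣ W ∧ g ^ L ∣ v ∧ (∀ p, p.Prime → p ≤ 16 * k ^ 2 → p ∣ W) ∧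
      (∀ i j p, p.Prime → ¬ p ∣ W → h i ≡ h j [MOD p] → i = j) ∧ (∀ i, (v + h i).Coprime W) ∧
      (∀ j ≤ H, (∀ i, j ≠ h i) → ∃ p, 2 ≤ p ∧ p ∣ W ∧ p ∣ v + j) := by
  obtain ⟨B, hB⟩ : ∃ B, B = 16 * k ^ 2 + H + g := ⟨_, rfl⟩
  obtain ⟨pj, hpj⟩ : ∃ pj : ℕ → ℕ, pj = fun j => Nat.nth Nat.Prime (B + j) := ⟨_, rfl⟩
  have hpjp : ∀ j, (pj j).Prime := fun j => by rw [hpj]; exact Nat.prime_nth_prime _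
  have hpjinj : Function.Injective pj := by
    intro a b hab
    rw [hpj] at hab
    have := Nat.nth_injective Nat.infinite_setOf_prime hab
    omega
  have hpjB : ∀ j, B < pj j := by
    intro j
    rw [hpj]
    have := Nat.add_two_le_nth_prime (B + j)
    show B < Nat.nth Nat.Prime (B + j)
    omega
  obtain ⟨X, hX⟩ : ∃ X, ∀ j ≤ H, pj j ≤ X := by
    refine ⟨∑ j ∈ range (H+1), pj j, fun j hj => ?_⟩
    exact single_le_sum (f := pj) (fun _ _ => Nat.zero_le _) (mem_range.2 (by omega))
  obtain ⟨PS, hPS⟩ : ∃ PS : Finset ℕ, PS = {p ∈ range (B + X + 1) | p.Prime ∧ ¬ p ∣ g} := ⟨_, rfl⟩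
  have hmem : ∀ p, p ∈ PS ↔ p < B + X + 1 ∧ p.Prime ∧ ¬ p ∣ g := fun p => by rw [hPS, mem_filter, mem_range]
  have hres : ∀ p ∈ PS, ∃ r, (∀ i, ¬ p ∣ r + h i) ∧ ∀ j ≤ H, (∀ i, j ≠ h i) → p = pj j → p ∣ r + j := by
    intro p hp
    have hp' := (hmem p).1 hp
    by_cases hj : ∃ j ≤ H, (∀ i, j ≠ h i) ∧ p = pj j
    · obtain ⟨j, hjH, hji, hpe⟩ := hj
      have hpB := hpjB j
      rw [← hpe] at hpB
      have hjp : p - j + j = p := by omega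
      refine ⟨p - j, fun i hd => ?_, ?_⟩
      · have h1 : p - j + h i ≡ p - j + j [MOD p] := by
          rw [hjp]
          exact (Nat.modEq_zero_iff_dvd.2 hd).trans (Nat.modEq_zero_iff_dvd.2 (dvd_refl p)).symm
        have h2 := Nat.ModEq.add_left_cancel' _ h1
        have h3 := hH i
        exact hji i (Nat.ModEq.eq_of_lt_of_lt h2 (by omega) (by omega)).symm
      · intro j' _ _ hpe'
        have : j' = j := hpjinj (hpe'.symm.trans hpe)
        rw [this, hjp]
    · push Not at hj
      obtain ⟨r, hr⟩ := avoid g k p hp'.2.1 hp'.2.2 h hh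
      exact ⟨r, hr, fun j hjH hji hpe => absurd hpe (hj j hjH hji)⟩
  choose! r hr1 hr2 using hres
  obtain ⟨v0, hv0⟩ := Nat.chineseRemainderOfFinset r (fun p => p) PS (fun p hp => ((hmem p).1 hp).2.1.ne_zero)
    (fun p hp q hq hpq => (Nat.coprime_primes ((hmem p).1 hp).2.1 ((hmem q).1 hq).2.1).2 hpq)
  have hcop : (g ^ L).Coprime (∏ p ∈ PS, p) := by
    apply Nat.Coprime.pow_left
    apply Nat.Coprime.prod_right
    intro p hp
    exact ((Nat.Prime.coprime_iff_not_dvd ((hmem p).1 hp).2.1).2 ((hmem p).1 hp).2.2).symm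
  obtain ⟨v, hv1, hv2⟩ := Nat.chineseRemainder hcop 0 v0
  have hvp : ∀ p ∈ PS, v ≡ r p [MOD p] := fun p hp =>
    (hv2.of_dvd (dvd_prod_of_mem _ hp)).trans (hv0 p hp)
  have hgv : g ^ L ∣ v := Nat.modEq_zero_iff_dvd.1 hv1
  have hWd : ∀ p, p.Prime → p ≤ B + X → p ∣ g ^ L * ∏ p ∈ PS, p := by
    intro p hp hpB
    by_cases hpg : p ∣ g
    · exact (hpg.trans (dvd_pow_self g (by omega))).mul_right _
    · exact (dvd_prod_of_mem (fun p => p) ((hmem p).2 ⟨by omega, hp, hpg⟩)).mul_left _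
  have hWpos : 1 ≤ g ^ L * ∏ p ∈ PS, p :=
    Nat.mul_pos (by positivity) (prod_pos fun p hp => ((hmem p).1 hp).2.1.pos)
  refine ⟨g ^ L * ∏ p ∈ PS, p, v, hWpos, dvd_mul_right _ _, hgv, fun p hp hpk => hWd p hp (by omega), ?_, ?_, ?_⟩
  · intro i j p hp hpW hij
    have hpB : B + X < p := by
      by_contra hcon
      exact hpW (hWd p hp (by omega))
    have h1 := hH i
    have h2 := hH j
    have h3 := Nat.ModEq.eq_of_lt_of_lt hij (by omega) (by omega)
    rw [hh, hh] at h3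
    have h4 := Nat.pow_right_injective hg (Nat.add_left_cancel h3)
    have h5 := Nat.eq_of_mul_eq_mul_right (Nat.factorial_pos k) h4
    exact Fin.ext (by omega)
  · intro i
    apply Nat.Coprime.mul_right
    · apply Nat.Coprime.pow_right
      have hg1 : g ∣ v + (h i - 1) := by
        apply dvd_add ((dvd_pow_self g (by omega)).trans hgv)
        rw [hh, Nat.add_sub_cancel_left]
        exact dvd_pow_self g (Nat.mul_pos (by omega) (Nat.factorial_pos k)).ne'
      have e : v + h i = (v + (h i - 1)) + 1 := by rw [hh]; omega
      rw [e]
      obtain ⟨c, hc⟩ := hg1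
      rw [hc]
      simp
    · apply Nat.Coprime.prod_right
      intro p hp
      apply Nat.Coprime.symm
      rw [Nat.Prime.coprime_iff_not_dvd ((hmem p).1 hp).2.1]
      intro hd
      apply hr1 p hp i
      exact Nat.modEq_zero_iff_dvd.1 (((hvp p hp).add_right (h i)).symm.trans (Nat.modEq_zero_iff_dvd.2 hd))
  · intro j hj hji
    have hpg : ¬ pj j ∣ g := by
      intro hd
      have h1 := Nat.le_of_dvd (by omega) hd
      have h2 := hpjB j
      omega
    have hp : pj j ∈ PS := (hmem _).2 ⟨by have := hX j hj; omega, hpjp j, hpg⟩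
    refine ⟨pj j, (hpjp j).two_le, (dvd_prod_of_mem (fun p => p) hp).mul_left _, ?_⟩
    exact Nat.modEq_zero_iff_dvd.1 (((hvp _ hp).add_right j).trans (Nat.modEq_zero_iff_dvd.2 (hr2 _ hp j hj hji rfl)))

lemma run_exists (g : ℕ) (hg : 2 ≤ g) (K : ℕ) (hK : 1 ≤ K) (N : ℕ) :
    ∃ n H s : ℕ, N < n ∧ (∀ j ≤ H, (n + j).Prime → (Nat.digits g (n + j)).sum = s) ∧
      K ≤ #{j ∈ range (H+1) | (n + j).Prime} := by
  obtain ⟨J, hJ⟩ := exists_nat_ge (2 * 64 * 241^2 * 256 * 257 * (K:ℝ))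
  obtain ⟨k, hk⟩ : ∃ k, k = 2 ^ J := ⟨_, rfl⟩
  obtain ⟨L, hL⟩ : ∃ L, L = (k + 1) * k.factorial + 1 := ⟨_, rfl⟩
  obtain ⟨h, hh⟩ : ∃ h : Fin k → ℕ, ∀ i, h i = 1 + g ^ ((i.1 + 1) * k.factorial) := ⟨fun i => _, fun i => rfl⟩
  obtain ⟨H, hH⟩ : ∃ H, ∀ i, h i ≤ H :=
    ⟨∑ i, h i, fun i => single_le_sum (f := h) (fun _ _ => Nat.zero_le _) (mem_univ i)⟩
  obtain ⟨W, v, hW1, hgW, hgv, hW, hdiff, hcop, hkill⟩ := tuple_exists g hg k h hh L H (by omega) hH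
  obtain ⟨n, hnv, hcount⟩ := dhl J K k hk hK hJ W hW1 hW h v H hH hdiff hcop (N + H + W)
  have hne : ({m : Fin k | (n + h m).Prime ∧ N + H + W < n + h m} : Finset (Fin k)).Nonempty :=
    card_pos.1 (by omega)
  obtain ⟨m0, hm0⟩ := hne
  rw [mem_filter] at hm0
  have hn : N + W < n := by
    have := hH m0; have := hm0.2.2; omega
  have hgn : g ^ L ∣ n :=
    Nat.modEq_zero_iff_dvd.1 ((hnv.of_dvd hgW).trans (Nat.modEq_zero_iff_dvd.2 hgv))
  obtain ⟨q, hq⟩ := hgn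
  have hinj : Function.Injective h := by
    intro i j hij
    rw [hh, hh] at hij
    have h4 := Nat.pow_right_injective hg (Nat.add_left_cancel hij)
    have h5 := Nat.eq_of_mul_eq_mul_right (Nat.factorial_pos k) h4
    exact Fin.ext (by omega)
  refine ⟨n, H, 2 + (Nat.digits g q).sum, by omega, ?_, ?_⟩
  · intro j hj hp
    by_cases hji : ∀ i, j ≠ h i
    · exfalso
      obtain ⟨p, hp2, hpW, hpv⟩ := hkill j hj hji
      have hd : p ∣ n + j := Nat.modEq_zero_iff_dvd.1
        (((hnv.of_dvd hpW).add_right j).trans (Nat.modEq_zero_iff_dvd.2 hpv))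
      have hpe := (Nat.dvd_prime hp).1 hd
      have := Nat.le_of_dvd (by omega) hpW
      omega
    · push Not at hji
      obtain ⟨i, rfl⟩ := hji
      rw [hh, hq]
      apply ds_tuple g hg
      · exact Nat.mul_pos (by omega) (Nat.factorial_pos k)
      · rw [hL]
        have : (i.1 + 1) * k.factorial ≤ (k + 1) * k.factorial := Nat.mul_le_mul_right _ (by omega)
        omega
  · refine hcount.trans ?_
    apply card_le_card_of_injOn h
    · intro m hm
      have hm' := (mem_filter.1 hm).2
      simp only [coe_filter, mem_range, Set.mem_ofPred_eq]
      exact ⟨by have := hH m; omega, hm'.1⟩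
    · exact hinj.injOn

end DSR

theorem digitSum_constant_runs (g : ℕ) (hg : 2 ≤ g) (K : ℕ) (hK : 1 ≤ K) :
    {n : ℕ | ∀ i : ℕ, i + 1 < K →
      (Nat.digits g (Nat.nth Nat.Prime (n + i))).sum =
        (Nat.digits g (Nat.nth Nat.Prime (n + i + 1))).sum}.Infinite := by
  apply Set.infinite_of_not_bddAbove
  rintro ⟨N, hN⟩
  obtain ⟨n, H, s, hn, hs, hc⟩ := DSR.run_exists g hg K hK (Nat.nth Nat.Prime N)
  have hcount : Nat.count Nat.Prime n + K ≤ Nat.count Nat.Prime (n + (H + 1)) := by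
    rw [Nat.count_add, Nat.count_eq_card_filter_range (fun k => Nat.Prime (n + k))]
    omega
  have key : ∀ i < K, (Nat.digits g (Nat.nth Nat.Prime (Nat.count Nat.Prime n + i))).sum = s := by
    intro i hi
    have h1 : Nat.nth Nat.Prime (Nat.count Nat.Prime n + i) < n + (H + 1) :=
      Nat.nth_lt_of_lt_count (by omega)
    have h2 : n ≤ Nat.nth Nat.Prime (Nat.count Nat.Prime n + i) := by
      rw [← Nat.count_le_iff_le_nth Nat.infinite_setOf_prime]
      exact Nat.le_add_right _ _
    obtain ⟨j, hj⟩ := Nat.exists_eq_add_of_le h2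
    rw [hj]
    apply hs j (by omega)
    rw [← hj]
    exact Nat.prime_nth_prime _
  have hmem : Nat.count Nat.Prime n ∈ {n : ℕ | ∀ i : ℕ, i + 1 < K →
      (Nat.digits g (Nat.nth Nat.Prime (n + i))).sum =
        (Nat.digits g (Nat.nth Nat.Prime (n + i + 1))).sum} := by
    intro i hi
    rw [key i (by omega), add_assoc, key (i + 1) hi]
  have h3 := hN hmem
  have h4 : N < Nat.count Nat.Prime n := by
    have := Nat.count_strict_mono (p := Nat.Prime) (Nat.prime_nth_prime N) hn
    rwa [Nat.count_nth_of_infinite Nat.infinite_setOf_prime] at this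
  omega
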